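/- arXiv:1206.4712 — 2 statements merged into one kernel-verified Lean document; each statement's English description precedes it below -/
import Mathlib

section
/- Let 0 < ρ ≤ 1 and let a ∈ S^0_{ρ,0}(n,2) satisfy, for each multi-index α, sup_{x_0,ζ∈ℝⁿ} (∫_{B_1(x_0)}∫_{ℝⁿ} |∂_x^α a(x,ζ−η,η)|² dη dx)^{1/2} < ∞, where B_1(x_0) is the unit ball centred at x_0. Then for all p, q ∈ [2,∞] and r ∈ [1,2] with 1/p + 1/q = 1/r, there is a constant C such that ‖T_a(f,g)‖_{L^r(ℝⁿ)} ≤ C‖f‖_{L^p(ℝⁿ)}‖g‖_{L^q(ℝⁿ)} for all Schwartz functions f, g on ℝⁿ. -/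
open MeasureTheory Metric Complex
open scoped ENNReal NNReal RealInnerProductSpace BigOperators

noncomputable section

abbrev Rn (n : ℕ) : Type := EuclideanSpace ℝ (Fin n)

/-- The bilinear Hörmander class `S^m_{ρ,δ}(n,2)`. -/
def BilinSmRhoDelta (n : ℕ) (m ρ δ : ℝ) (a : Rn n → Rn n → Rn n → ℂ) : Prop :=
  ContDiff ℝ (⊤ : ℕ∞) (fun p : Rn n × Rn n × Rn n => a p.1 p.2.1 p.2.2) ∧
  ∀ kx kξ kη : ℕ, ∃ C : ℝ, ∀ (x ξ η : Rn n),
    ‖iteratedFDeriv ℝ kx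
        (fun x' => iteratedFDeriv ℝ kξ
          (fun ξ' => iteratedFDeriv ℝ kη (fun η' => a x' ξ' η') η) ξ) x‖ ≤
      C * (1 + ‖ξ‖ ^ 2 + ‖η‖ ^ 2) ^ ((m - ρ * (kξ + kη) + δ * kx) / 2)

/-- The Fourier transform `f̂(ξ) = ∫ f(y) e^{-i ξ·y} dy`. -/
def fourierT {n : ℕ} (f : Rn n → ℂ) (ξ : Rn n) : ℂ :=
  ∫ y : Rn n, f y * Complex.exp (-Complex.I * (⟪ξ, y⟫ : ℂ))

/-- The bilinear pseudodifferential operator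
`T_a(f,g)(x) = ∬ a(x,ξ,η) f̂(ξ) ĝ(η) e^{ix·(ξ+η)} dξ dη`. -/
def Tbilin {n : ℕ} (a : Rn n → Rn n → Rn n → ℂ) (f g : Rn n → ℂ) (x : Rn n) : ℂ :=
  ∫ ξ : Rn n, ∫ η : Rn n,
    a x ξ η * fourierT f ξ * fourierT g η * Complex.exp (Complex.I * ((⟪x, ξ + η⟫ : ℝ) : ℂ))

section DirectionalDerivatives

variable {V W : Type*} [NormedAddCommGroup V] [NormedSpace ℝ V]
  [NormedAddCommGroup W] [NormedSpace ℝ W]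

/-- The iterated directional derivative along a list of vectors (the last one acts first). -/
def dirDeriv (F : V → ℂ) : List V → V → ℂ
  | [] => F
  | v :: vs => fun p => fderiv ℝ (dirDeriv F vs) p v

theorem dirDeriv_append (F : V → ℂ) (vs ws : List V) :
    dirDeriv F (vs ++ ws) = dirDeriv (dirDeriv F ws) vs := by
  induction vs with
  | nil => rfl
  | cons v vs ih => simp only [List.cons_append, dirDeriv, ih]

theorem contDiff_dirDeriv {F : V → ℂ} (hF : ContDiff ℝ (⊤ : ℕ∞) F) (vs : List V) :
    ContDiff ℝ (⊤ : ℕ∞) (dirDeriv F vs) := by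
  induction vs with
  | nil => exact hF
  | cons v vs ih => exact (ih.fderiv_right (by simp)).clm_apply contDiff_const

theorem fderiv_fderiv_apply_comm {F : V → ℂ} (hF : ContDiff ℝ (⊤ : ℕ∞) F) (v w p : V) :
    fderiv ℝ (fun p => fderiv ℝ F p v) p w = fderiv ℝ (fun p => fderiv ℝ F p w) p v := by
  have hd : DifferentiableAt ℝ (fderiv ℝ F) p :=
    ((hF.fderiv_right (m := (⊤ : ℕ∞)) (by simp)).differentiable (by simp)) p
  have h := (hF.contDiffAt (x := p)).isSymmSndFDerivAt
    (by simp only [minSmoothness_of_isRCLikeNormedField]; exact WithTop.coe_le_coe.2 le_top)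
  rw [fderiv_clm_apply hd (by fun_prop), fderiv_clm_apply hd (by fun_prop)]
  simpa using h w v

theorem dirDeriv_perm {F : V → ℂ} (hF : ContDiff ℝ (⊤ : ℕ∞) F) {vs ws : List V}
    (h : vs.Perm ws) : dirDeriv F vs = dirDeriv F ws := by
  induction h with
  | nil => rfl
  | cons v _ ih => simp only [dirDeriv, ih]
  | swap v w l =>
    funext p
    exact fderiv_fderiv_apply_comm (contDiff_dirDeriv hF l) v w p
  | trans _ _ h1 h2 => exact h1.trans h2

theorem dirDeriv_eq_iteratedFDeriv {F : V → ℂ} (hF : ContDiff ℝ (⊤ : ℕ∞) F) (vs : List V) (p : V) :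
    dirDeriv F vs p = iteratedFDeriv ℝ vs.length F p vs.get := by
  induction vs generalizing p with
  | nil => simp [dirDeriv]
  | cons v vs ih =>
    have hd : DifferentiableAt ℝ (iteratedFDeriv ℝ vs.length F) p :=
      ((hF.iteratedFDeriv_right (m := (⊤ : ℕ∞)) (i := vs.length)
        (by exact_mod_cast le_top)).differentiable
        (by simp)) p
    have e : dirDeriv F vs = fun p => iteratedFDeriv ℝ vs.length F p vs.get := funext ih
    simp only [dirDeriv, e]
    rw [fderiv_continuousMultilinear_apply_const hd]
    exact (iteratedFDeriv_succ_apply_left (𝕜 := ℝ) (f := F) (x := p) (n := vs.length)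
      (v :: vs).get).symm

theorem dirDeriv_comp_affine {F : W → ℂ} (hF : ContDiff ℝ (⊤ : ℕ∞) F) (c : W) (T : V →L[ℝ] W)
    (vs : List V) (p : V) :
    dirDeriv (fun y => F (c + T y)) vs p = dirDeriv F (vs.map T) (c + T p) := by
  induction vs generalizing p with
  | nil => rfl
  | cons v vs ih =>
    have e : dirDeriv (fun y => F (c + T y)) vs = fun p => dirDeriv F (vs.map T) (c + T p) :=
      funext ih
    have hd : DifferentiableAt ℝ (dirDeriv F (vs.map T)) (c + T p) :=
      (contDiff_dirDeriv hF _).differentiable (by simp) _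
    have hT : HasFDerivAt (fun y => c + T y) T p := T.hasFDerivAt.const_add c
    simp only [dirDeriv, e, List.map_cons]
    exact congrArg (fun M => M v) (hd.hasFDerivAt.comp p hT).fderiv

theorem contDiff_iteratedFDeriv_param {P : Type*} [NormedAddCommGroup P] [NormedSpace ℝ P]
    {F : P → V → W} (hF : ContDiff ℝ (⊤ : ℕ∞) (Function.uncurry F)) (k : ℕ) :
    ContDiff ℝ (⊤ : ℕ∞) (fun q : P × V => iteratedFDeriv ℝ k (F q.1) q.2) := by
  induction k with
  | zero =>
    simp only [iteratedFDeriv_zero_eq_comp]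
    exact ((continuousMultilinearCurryFin0 ℝ V W).symm.contDiff).comp hF
  | succ k ih =>
    simp only [iteratedFDeriv_succ_eq_comp_left]
    refine ContDiff.comp (g := (continuousMultilinearCurryLeftEquiv ℝ
      (fun _ : Fin (k + 1) => V) W).symm) (LinearIsometryEquiv.contDiff _) ?_
    refine ContDiff.fderiv (m := (⊤ : ℕ∞)) (f := fun (q : P × V) v => iteratedFDeriv ℝ k (F q.1) v)
      (g := Prod.snd) ?_ contDiff_snd (by simp)
    exact ih.comp (f := fun r : (P × V) × V => (r.1.1, r.2)) (by fun_prop)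

theorem ContDiff.multilinear_apply_const {Z : Type*} [NormedAddCommGroup Z]
    [NormedSpace ℝ Z] {m : ℕ} {G : V → W [×m]→L[ℝ] Z}
    (hG : ContDiff ℝ (⊤ : ℕ∞) G) (w : Fin m → W) : ContDiff ℝ (⊤ : ℕ∞) (fun q => G q w) :=
  (ContinuousMultilinearMap.apply ℝ (fun _ : Fin m => W) Z w).contDiff.comp hG

theorem iteratedFDeriv_multilinear_apply_const {Z : Type*} [NormedAddCommGroup Z]
    [NormedSpace ℝ Z] {m k : ℕ} {G : V → W [×m]→L[ℝ] Z}
    (hG : ContDiff ℝ (⊤ : ℕ∞) G) (w : Fin m → W) (p : V) (v : Fin k → V) :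
    iteratedFDeriv ℝ k (fun q => G q w) p v = iteratedFDeriv ℝ k G p v w := by
  have := (ContinuousMultilinearMap.apply ℝ (fun _ : Fin m => W) Z w).iteratedFDeriv_comp_left
    (f := G) (x := p) (n := (⊤ : ℕ∞)) hG.contDiffAt (i := k) (by exact_mod_cast le_top)
  have h2 := congrArg (fun M => M v) this
  simpa [Function.comp_def] using h2

end DirectionalDerivatives

section SymbolClass

/-- The phase space of triples `(x, ξ, η)`. -/
abbrev PhaseSp (n : ℕ) : Type := Rn n × (Rn n × Rn n)

variable {n : ℕ}

/-- The coordinate direction `j` in the variable `x`. -/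
def dirX (j : Fin n) : PhaseSp n := (EuclideanSpace.single j 1, 0, 0)

/-- The coordinate direction `j` in the variable `ξ`. -/
def dirXi (j : Fin n) : PhaseSp n := (0, EuclideanSpace.single j 1, 0)

/-- The coordinate direction `j` in the variable `η`. -/
def dirEta (j : Fin n) : PhaseSp n := (0, 0, EuclideanSpace.single j 1)

/-- Symbols of class `S^0_{ρ,0}` whose `x`-derivatives are uniformly square integrable along the
antidiagonals `ξ + η = ζ`. -/
structure GoodSymbol (ρ : ℝ) (A : PhaseSp n → ℂ) : Prop where
  smooth : ContDiff ℝ (⊤ : ℕ∞) A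
  bound : ∀ xs vs ws : List (Fin n), ∃ C : ℝ, ∀ p : PhaseSp n,
    ‖dirDeriv A (xs.map dirX ++ (vs.map dirXi ++ ws.map dirEta)) p‖ ≤
      C * (1 + ‖p.2.1‖ ^ 2 + ‖p.2.2‖ ^ 2) ^ (-(ρ * (vs.length + ws.length)) / 2)
  sq : ∀ xs : List (Fin n), ∃ B : ℝ≥0, ∀ x₀ ζ : Rn n,
    ∫⁻ z : Rn n × Rn n, ‖dirDeriv A (xs.map dirX) (z.1, ζ - z.2, z.2)‖ₑ ^ 2
      ∂((volume.restrict (ball x₀ 1)).prod volume) ≤ B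

theorem norm_multilinear_basis_le {m : ℕ} {Z : Type*} [NormedAddCommGroup Z] [NormedSpace ℝ Z]
    (M : (Rn n) [×m]→L[ℝ] Z) {v : Fin m → Rn n} (hv : ∀ i, ‖v i‖ = 1) : ‖M v‖ ≤ ‖M‖ := by
  simpa [hv] using M.le_opNorm v

theorem norm_get_map_single (l : List (Fin n))
    (i : Fin (l.map fun j => (EuclideanSpace.single j 1 : Rn n)).length) :
    ‖(l.map fun j => (EuclideanSpace.single j 1 : Rn n)).get i‖ = 1 := by
  simp

theorem dirDeriv_slice_x {A : PhaseSp n → ℂ} (hA : ContDiff ℝ (⊤ : ℕ∞) A) (l : List (Fin n))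
    (x ξ η : Rn n) : dirDeriv A (l.map dirX) (x, ξ, η) =
      dirDeriv (fun x' => A (x', ξ, η)) (l.map fun j => EuclideanSpace.single j 1) x := by
  have := dirDeriv_comp_affine hA ((0, ξ, η) : PhaseSp n)
    (ContinuousLinearMap.inl ℝ (Rn n) (Rn n × Rn n)) (l.map fun j => EuclideanSpace.single j 1) x
  simp only [ContinuousLinearMap.inl_apply, Prod.mk_add_mk, zero_add, add_zero, List.map_map,
    ← Prod.mk_zero_zero] at this
  exact this.symm

theorem dirDeriv_slice_xi {A : PhaseSp n → ℂ} (hA : ContDiff ℝ (⊤ : ℕ∞) A) (l : List (Fin n))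
    (x ξ η : Rn n) : dirDeriv A (l.map dirXi) (x, ξ, η) =
      dirDeriv (fun ξ' => A (x, ξ', η)) (l.map fun j => EuclideanSpace.single j 1) ξ := by
  have := dirDeriv_comp_affine hA ((x, 0, η) : PhaseSp n)
    ((ContinuousLinearMap.inr ℝ (Rn n) (Rn n × Rn n)).comp
      (ContinuousLinearMap.inl ℝ (Rn n) (Rn n))) (l.map fun j => EuclideanSpace.single j 1) ξ
  simp only [ContinuousLinearMap.comp_apply, ContinuousLinearMap.inr_apply,
    ContinuousLinearMap.inl_apply, Prod.mk_add_mk, zero_add, add_zero, List.map_map] at this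
  exact this.symm

theorem dirDeriv_slice_eta {A : PhaseSp n → ℂ} (hA : ContDiff ℝ (⊤ : ℕ∞) A) (l : List (Fin n))
    (x ξ η : Rn n) : dirDeriv A (l.map dirEta) (x, ξ, η) =
      dirDeriv (fun η' => A (x, ξ, η')) (l.map fun j => EuclideanSpace.single j 1) η := by
  have := dirDeriv_comp_affine hA ((x, ξ, 0) : PhaseSp n)
    ((ContinuousLinearMap.inr ℝ (Rn n) (Rn n × Rn n)).comp
      (ContinuousLinearMap.inr ℝ (Rn n) (Rn n))) (l.map fun j => EuclideanSpace.single j 1) η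
  simp only [ContinuousLinearMap.comp_apply, ContinuousLinearMap.inr_apply,
    Prod.mk_add_mk, zero_add, add_zero, List.map_map] at this
  exact this.symm

theorem norm_dirDeriv_le_iteratedFDeriv {a : Rn n → Rn n → Rn n → ℂ}
    (ha : ContDiff ℝ (⊤ : ℕ∞) (fun p : PhaseSp n => a p.1 p.2.1 p.2.2)) (xs vs ws : List (Fin n))
    (x ξ η : Rn n) :
    ‖dirDeriv (fun p : PhaseSp n => a p.1 p.2.1 p.2.2)
      (xs.map dirX ++ (vs.map dirXi ++ ws.map dirEta)) (x, ξ, η)‖ ≤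
    ‖iteratedFDeriv ℝ xs.length (fun x' => iteratedFDeriv ℝ vs.length
      (fun ξ' => iteratedFDeriv ℝ ws.length (fun η' => a x' ξ' η') η) ξ) x‖ := by
  set A : PhaseSp n → ℂ := fun p => a p.1 p.2.1 p.2.2 with hAdef
  set e : Fin n → Rn n := fun j => EuclideanSpace.single j 1 with he
  have hw : ∀ x ξ, dirDeriv A (ws.map dirEta) (x, ξ, η) =
      iteratedFDeriv ℝ (ws.map e).length (a x ξ) η (ws.map e).get := by
    intro x ξ
    rw [dirDeriv_slice_eta ha, dirDeriv_eq_iteratedFDeriv]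
    exact ha.comp (f := fun η' : Rn n => ((x, ξ, η') : PhaseSp n)) (by fun_prop)
  have s1 : ContDiff ℝ (⊤ : ℕ∞) (fun q : PhaseSp n =>
      iteratedFDeriv ℝ (ws.map e).length (a q.1 q.2.1) q.2.2) :=
    (contDiff_iteratedFDeriv_param (P := Rn n × Rn n) (F := fun q => a q.1 q.2)
      (ha.comp (f := fun q : (Rn n × Rn n) × Rn n => ((q.1.1, q.1.2, q.2) : PhaseSp n))
        (by fun_prop)) _).comp
      (f := fun q : PhaseSp n => (((q.1, q.2.1), q.2.2) : (Rn n × Rn n) × Rn n)) (by fun_prop)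
  have hv : ∀ x, dirDeriv A (vs.map dirXi ++ ws.map dirEta) (x, ξ, η) =
      iteratedFDeriv ℝ (vs.map e).length (fun ξ' => iteratedFDeriv ℝ (ws.map e).length
        (a x ξ') η) ξ (vs.map e).get (ws.map e).get := by
    intro x
    have s2 : ContDiff ℝ (⊤ : ℕ∞) (fun ξ' => iteratedFDeriv ℝ (ws.map e).length (a x ξ') η) :=
      s1.comp (f := fun ξ' : Rn n => ((x, ξ', η) : PhaseSp n)) (by fun_prop)
    rw [dirDeriv_append, dirDeriv_slice_xi (contDiff_dirDeriv ha _)]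
    simp only [hw]
    rw [dirDeriv_eq_iteratedFDeriv (s2.multilinear_apply_const _),
      iteratedFDeriv_multilinear_apply_const s2]
  have s3 : ContDiff ℝ (⊤ : ℕ∞) (fun x => iteratedFDeriv ℝ (vs.map e).length
      (fun ξ' => iteratedFDeriv ℝ (ws.map e).length (a x ξ') η) ξ) :=
    (contDiff_iteratedFDeriv_param (P := Rn n)
      (F := fun x ξ' => iteratedFDeriv ℝ (ws.map e).length (a x ξ') η)
      (s1.comp (f := fun q : Rn n × Rn n => ((q.1, q.2, η) : PhaseSp n)) (by fun_prop)) _).comp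
      (f := fun x : Rn n => (x, ξ)) (by fun_prop)
  have s4 : ContDiff ℝ (⊤ : ℕ∞) (fun x => iteratedFDeriv ℝ (vs.map e).length
      (fun ξ' => iteratedFDeriv ℝ (ws.map e).length (a x ξ') η) ξ (vs.map e).get) :=
    s3.multilinear_apply_const _
  rw [dirDeriv_append, dirDeriv_slice_x (contDiff_dirDeriv ha _)]
  simp only [hv]
  rw [dirDeriv_eq_iteratedFDeriv (s4.multilinear_apply_const _),
      iteratedFDeriv_multilinear_apply_const s4, iteratedFDeriv_multilinear_apply_const s3]
  refine (norm_multilinear_basis_le _ (norm_get_map_single ws)).trans ?_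
  refine (norm_multilinear_basis_le _ (norm_get_map_single vs)).trans ?_
  refine (norm_multilinear_basis_le _ (norm_get_map_single xs)).trans ?_
  have key : ∀ k₁ k₂ k₃ : ℕ, k₁ = xs.length → k₂ = vs.length → k₃ = ws.length →
      ‖iteratedFDeriv ℝ k₁ (fun x' => iteratedFDeriv ℝ k₂
        (fun ξ' => iteratedFDeriv ℝ k₃ (a x' ξ') η) ξ) x‖ ≤
      ‖iteratedFDeriv ℝ xs.length (fun x' => iteratedFDeriv ℝ vs.length
        (fun ξ' => iteratedFDeriv ℝ ws.length (a x' ξ') η) ξ) x‖ := by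
    rintro _ _ _ rfl rfl rfl
    exact le_rfl
  exact key _ _ _ (List.length_map _) (List.length_map _) (List.length_map _)

theorem goodSymbol_of_bilinSmRhoDelta {ρ : ℝ} {a : Rn n → Rn n → Rn n → ℂ}
    (ha : BilinSmRhoDelta n 0 ρ 0 a)
    (hx : ∀ k : ℕ, ∃ B : ℝ, ∀ (x0 ζ : Rn n),
      ((∫⁻ x in Metric.ball x0 1, ∫⁻ η : Rn n,
          (‖iteratedFDeriv ℝ k (fun x' => a x' (ζ - η) η) x‖₊ : ℝ≥0∞) ^ (2:ℝ)) ^ ((1:ℝ)/2))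
        ≤ ENNReal.ofReal B) :
    GoodSymbol ρ (fun p : PhaseSp n => a p.1 p.2.1 p.2.2) where
  smooth := ha.1
  bound xs vs ws := by
    obtain ⟨C, hC⟩ := ha.2 xs.length vs.length ws.length
    refine ⟨C, fun p => (norm_dirDeriv_le_iteratedFDeriv ha.1 xs vs ws p.1 p.2.1 p.2.2).trans
      ((hC p.1 p.2.1 p.2.2).trans (le_of_eq ?_))⟩
    congr 2
    ring
  sq xs := by
    obtain ⟨B, hB⟩ := hx xs.length
    refine ⟨(B.toNNReal) ^ 2, fun x₀ ζ => ?_⟩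
    have hcont := (contDiff_dirDeriv ha.1 (xs.map dirX)).continuous
    rw [lintegral_prod _ (Continuous.measurable (by fun_prop)).aemeasurable]
    have h1 : ∫⁻ x in ball x₀ 1, ∫⁻ η : Rn n,
        ‖dirDeriv (fun p : PhaseSp n => a p.1 p.2.1 p.2.2) (xs.map dirX) (x, ζ - η, η)‖ₑ ^ 2 ≤
        ∫⁻ x in Metric.ball x₀ 1, ∫⁻ η : Rn n,
          (‖iteratedFDeriv ℝ xs.length (fun x' => a x' (ζ - η) η) x‖₊ : ℝ≥0∞) ^ (2:ℝ) := by
      refine lintegral_mono fun x => lintegral_mono fun η => ?_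
      rw [← ENNReal.rpow_natCast, Nat.cast_ofNat]
      refine ENNReal.rpow_le_rpow ?_ (by norm_num)
      have hs : ContDiff ℝ (⊤ : ℕ∞) (fun x' : Rn n => a x' (ζ - η) η) :=
        ha.1.comp (f := fun x' : Rn n => ((x', ζ - η, η) : PhaseSp n)) (by fun_prop)
      rw [dirDeriv_slice_x ha.1, dirDeriv_eq_iteratedFDeriv hs]
      refine (enorm_le_iff_norm_le.2 (norm_multilinear_basis_le _ (norm_get_map_single xs))).trans ?_
      exact le_of_eq (congrArg (fun k => ‖iteratedFDeriv ℝ k (fun x' => a x' (ζ - η) η) x‖ₑ)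
        (List.length_map _))
    refine h1.trans ?_
    have h2 := ENNReal.rpow_le_rpow (hB x₀ ζ) (z := 2) (by norm_num)
    rw [← ENNReal.rpow_mul] at h2
    norm_num at h2
    simpa [ENNReal.ofReal] using h2

end SymbolClass

section Interpolation

theorem norm_sub_taylor_le (N : ℕ) : ∀ (h : ℕ → ℝ → ℂ) (K : ℝ),
    (∀ k < N, ∀ t, HasDerivAt (h k) (h (k + 1) t) t) → (∀ t, ‖h N t‖ ≤ K) → ∀ t, 0 ≤ t →
    ‖h 0 t - ∑ k ∈ Finset.range N, ((t ^ k / k.factorial : ℝ) : ℂ) * h k 0‖ ≤ K * t ^ N := by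
  induction N with
  | zero => intro h K _ hK t _; simpa using hK t
  | succ N ih =>
    intro h K hd hK t ht
    have hK0 : 0 ≤ K := (norm_nonneg _).trans (hK 0)
    have ih' := ih (fun k => h (k + 1)) K (fun k hk => hd (k + 1) (by omega)) hK
    set r : ℝ → ℂ := fun s => h 0 s -
      ∑ k ∈ Finset.range (N + 1), ((s ^ k / k.factorial : ℝ) : ℂ) * h k 0 with hr
    have hr' : ∀ s, HasDerivAt r (h 1 s -
        ∑ k ∈ Finset.range N, ((s ^ k / k.factorial : ℝ) : ℂ) * h (k + 1) 0) s := by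
      intro s
      refine (hd 0 (by omega) s).sub ?_
      have hs : ∀ k ∈ Finset.range (N + 1), HasDerivAt
          (fun s : ℝ => ((s ^ k / k.factorial : ℝ) : ℂ) * h k 0)
          (((k * s ^ (k - 1) / k.factorial : ℝ) : ℂ) * h k 0) s := fun k _ =>
        (((hasDerivAt_pow k s).div_const _).ofReal_comp).mul_const _
      refine (HasDerivAt.fun_sum hs).congr_deriv ?_
      rw [Finset.sum_range_succ']
      simp only [Nat.cast_zero, zero_mul, zero_div, ofReal_zero, add_zero]
      refine Finset.sum_congr rfl fun k _ => ?_
      congr 2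
      rw [Nat.factorial_succ]
      push_cast
      have : (k.factorial : ℝ) ≠ 0 := by positivity
      have : (k : ℝ) + 1 ≠ 0 := by positivity
      field_simp
    have hr0 : r 0 = 0 := by
      simp [hr, Finset.sum_range_succ']
    have := norm_image_sub_le_of_norm_deriv_le_segment' (f := r) (a := 0) (b := t)
      (C := K * t ^ N) (fun s _ => (hr' s).hasDerivWithinAt)
      (fun s hs => (ih' s hs.1).trans (by
        have := hs.1
        have := hs.2.le
        gcongr)) t ⟨ht, le_rfl⟩
    rw [hr0, sub_zero, sub_zero] at this
    calc _ = ‖r t‖ := rfl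
      _ ≤ _ := this
      _ = _ := by ring

theorem exists_differentiation_weights (N : ℕ) : ∃ c : ℕ → ℝ, ∀ k < N,
    ∑ m ∈ Finset.range N, c m * (m : ℝ) ^ k = if k = 1 then 1 else 0 := by
  refine ⟨fun m => (Polynomial.derivative
    (Lagrange.basis (Finset.range N) (fun m : ℕ => (m : ℝ)) m)).eval 0, fun k hk => ?_⟩
  have h := Lagrange.eq_interpolate (s := Finset.range N) (v := fun m : ℕ => (m : ℝ))
    (f := (Polynomial.X ^ k : Polynomial ℝ)) (fun a _ b _ hab => by
      simpa using hab)
    (by rw [Polynomial.degree_X_pow]; simpa using hk)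
  have h2 := congrArg (fun P => (Polynomial.derivative P).eval 0) h
  simp only [Lagrange.interpolate_apply, Polynomial.derivative_sum, Polynomial.eval_finsetSum,
    Polynomial.derivative_C_mul, Polynomial.eval_pow, Polynomial.eval_X,
    Polynomial.derivative_X_pow, Polynomial.eval_mul, Polynomial.eval_C] at h2
  simp only [mul_comm _ ((_ : ℝ) ^ k)]
  rw [← h2]
  rcases k with _ | _ | k <;> simp

/-- A discrete Landau–Kolmogorov inequality. -/
theorem exists_landau_const (N : ℕ) (hN : 2 ≤ N) : ∃ C : ℝ, 0 ≤ C ∧ ∀ (h : ℕ → ℝ → ℂ) (K : ℝ),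
    (∀ k < N, ∀ t, HasDerivAt (h k) (h (k + 1) t) t) → (∀ t, ‖h N t‖ ≤ K) →
    ‖h 1 0‖ ≤ C * (∑ m ∈ Finset.range N, ‖h 0 m‖ + K) := by
  obtain ⟨c, hc⟩ := exists_differentiation_weights N
  set C₀ := ∑ m ∈ Finset.range N, |c m| * (1 + (m : ℝ) ^ N) with hC₀
  refine ⟨C₀, by positivity, fun h K hd hK => ?_⟩
  have hK0 : 0 ≤ K := (norm_nonneg _).trans (hK 0)
  have key : h 1 0 = ∑ m ∈ Finset.range N, (c m : ℂ) * h 0 m - ∑ m ∈ Finset.range N, (c m : ℂ) *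
      (h 0 m - ∑ k ∈ Finset.range N, (((m : ℝ) ^ k / k.factorial : ℝ) : ℂ) * h k 0) := by
    simp only [mul_sub, Finset.sum_sub_distrib, sub_sub_cancel, Finset.mul_sum]
    rw [Finset.sum_comm]
    have : ∀ k ∈ Finset.range N, ∑ m ∈ Finset.range N,
        (c m : ℂ) * ((((m : ℝ) ^ k / k.factorial : ℝ) : ℂ) * h k 0) =
        if k = 1 then h 1 0 else 0 := by
      intro k hk
      have e : ∑ m ∈ Finset.range N, (c m : ℂ) * ((((m : ℝ) ^ k / k.factorial : ℝ) : ℂ) * h k 0) =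
          ((∑ m ∈ Finset.range N, c m * (m : ℝ) ^ k : ℝ) : ℂ) * (h k 0 / k.factorial) := by
        rw [ofReal_sum, Finset.sum_mul]
        refine Finset.sum_congr rfl fun m _ => ?_
        push_cast
        ring
      rw [e, hc k (Finset.mem_range.1 hk)]
      split_ifs with h1
      · subst h1; simp
      · simp
    rw [Finset.sum_congr rfl this, Finset.sum_ite_eq' , if_pos (Finset.mem_range.2 (by omega))]
  rw [key]
  refine (norm_sub_le _ _).trans ?_
  have h1 : ‖∑ m ∈ Finset.range N, (c m : ℂ) * h 0 m‖ ≤ C₀ * ∑ m ∈ Finset.range N, ‖h 0 m‖ := by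
    refine (norm_sum_le _ _).trans ?_
    rw [Finset.mul_sum]
    refine Finset.sum_le_sum fun m hm => ?_
    rw [norm_mul, norm_real, Real.norm_eq_abs]
    gcongr
    calc |c m| ≤ |c m| * (1 + (m : ℝ) ^ N) :=
          le_mul_of_one_le_right (abs_nonneg _) (by have : (0 : ℝ) ≤ (m : ℝ) ^ N := by positivity
                                                    linarith)
      _ ≤ C₀ := Finset.single_le_sum (f := fun m : ℕ => |c m| * (1 + (m : ℝ) ^ N))
          (fun i _ => by positivity) hm
  have h2 : ‖∑ m ∈ Finset.range N, (c m : ℂ) * (h 0 m -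
      ∑ k ∈ Finset.range N, (((m : ℝ) ^ k / k.factorial : ℝ) : ℂ) * h k 0)‖ ≤ C₀ * K := by
    refine (norm_sum_le _ _).trans ?_
    rw [hC₀, Finset.sum_mul]
    refine Finset.sum_le_sum fun m _ => ?_
    rw [norm_mul, norm_real, Real.norm_eq_abs, mul_assoc]
    gcongr
    refine (norm_sub_taylor_le N h K hd hK m (by positivity)).trans ?_
    nlinarith
  linarith

end Interpolation

section Closure

variable {n : ℕ}

theorem norm_dirDeriv_cons_le {V : Type*} [NormedAddCommGroup V] [NormedSpace ℝ V] (N : ℕ)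
    (hN : 2 ≤ N) : ∃ C : ℝ, 0 ≤ C ∧ ∀ (A : V → ℂ), ContDiff ℝ (⊤ : ℕ∞) A → ∀ (l : List V) (v p : V)
    (K : ℝ), (∀ t : ℝ, ‖dirDeriv A (List.replicate N v ++ l) (p + t • v)‖ ≤ K) →
    ‖dirDeriv A (v :: l) p‖ ≤
      C * (∑ m ∈ Finset.range N, ‖dirDeriv A l (p + (m : ℝ) • v)‖ + K) := by
  obtain ⟨C, hC0, hC⟩ := exists_landau_const N hN
  refine ⟨C, hC0, fun A hA l v p K hK => ?_⟩
  have := hC (fun k t => dirDeriv A (List.replicate k v ++ l) (p + t • v)) K ?_ hK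
  · simpa using this
  intro k _ t
  have hd : DifferentiableAt ℝ (dirDeriv A (List.replicate k v ++ l)) (p + t • v) :=
    (contDiff_dirDeriv hA _).differentiable (by simp) _
  have hl : HasDerivAt (fun t : ℝ => p + t • v) v t := by
    simpa using ((hasDerivAt_id t).smul_const v).const_add p
  exact hd.hasFDerivAt.comp_hasDerivAt t hl

theorem ENNReal.sum_sq_le {ι : Type*} (s : Finset ι) (f : ι → ℝ≥0∞) :
    (∑ i ∈ s, f i) ^ 2 ≤ s.card * ∑ i ∈ s, f i ^ 2 := by
  have := ENNReal.rpow_sum_le_const_mul_sum_rpow s f (p := 2) (by norm_num)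
  norm_num at this
  exact this

theorem lintegral_sq_dirDeriv_cons_le {A : PhaseSp n → ℂ} (hA : ContDiff ℝ (⊤ : ℕ∞) A)
    (l : List (PhaseSp n)) (v : PhaseSp n) (N : ℕ) (hN : 2 ≤ N) (κ : Rn n → Rn n → ℝ)
    (hκ : ∀ (x ζ η : Rn n) (t : ℝ),
      ‖dirDeriv A (List.replicate N v ++ l) ((x, ζ - η, η) + t • v)‖ ≤ κ ζ η)
    (hκm : ∀ ζ, Measurable (κ ζ)) (B₁ B₂ : ℝ≥0)
    (hB₁ : ∀ ζ, ∫⁻ η, ‖κ ζ η‖ₑ ^ 2 ≤ B₁)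
    (hB₂ : ∀ (t : ℝ) (x₀ ζ : Rn n), ∫⁻ z : Rn n × Rn n,
      ‖dirDeriv A l ((z.1, ζ - z.2, z.2) + t • v)‖ₑ ^ 2
      ∂((volume.restrict (ball x₀ 1)).prod volume) ≤ B₂) :
    ∃ B : ℝ≥0, ∀ x₀ ζ : Rn n, ∫⁻ z : Rn n × Rn n, ‖dirDeriv A (v :: l) (z.1, ζ - z.2, z.2)‖ₑ ^ 2
      ∂((volume.restrict (ball x₀ 1)).prod volume) ≤ B := by
  obtain ⟨C, hC0, hC⟩ := norm_dirDeriv_cons_le (V := PhaseSp n) N hN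
  have hc := (contDiff_dirDeriv hA l).continuous
  have hvol : ∀ x₀ : Rn n, volume (ball x₀ 1) = volume (ball (0 : Rn n) 1) := fun x₀ =>
    Measure.addHaar_ball_center _ _ _
  set b : ℝ≥0 := (volume (ball (0 : Rn n) 1)).toNNReal
  have hb : volume (ball (0 : Rn n) 1) = b := (ENNReal.coe_toNNReal measure_ball_lt_top.ne).symm
  refine ⟨(C.toNNReal ^ 2 * 2) * (N * (N * B₂) + b * B₁), fun x₀ ζ => ?_⟩
  set μ := (volume.restrict (ball x₀ 1)).prod (volume : Measure (Rn n)) with hμ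
  have hpt : ∀ z : Rn n × Rn n, ‖dirDeriv A (v :: l) (z.1, ζ - z.2, z.2)‖ₑ ^ 2 ≤
      (C.toNNReal ^ 2 * 2 : ℝ≥0) * (N * ∑ m ∈ Finset.range N,
        ‖dirDeriv A l ((z.1, ζ - z.2, z.2) + (m : ℝ) • v)‖ₑ ^ 2 + ‖κ ζ z.2‖ₑ ^ 2) := by
    intro z
    have hk : 0 ≤ κ ζ z.2 := (norm_nonneg _).trans (hκ z.1 ζ z.2 0)
    have h1 := hC A hA l v (z.1, ζ - z.2, z.2) (κ ζ z.2) (hκ z.1 ζ z.2)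
    have h2 : ‖dirDeriv A (v :: l) (z.1, ζ - z.2, z.2)‖ₑ ≤ (C.toNNReal : ℝ≥0∞) *
        (∑ m ∈ Finset.range N, ‖dirDeriv A l ((z.1, ζ - z.2, z.2) + (m : ℝ) • v)‖ₑ
          + ‖κ ζ z.2‖ₑ) := by
      rw [← ofReal_norm]
      refine (ENNReal.ofReal_le_ofReal h1).trans (le_of_eq ?_)
      rw [ENNReal.ofReal_mul hC0, ENNReal.ofReal_add (by positivity) hk,
        ENNReal.ofReal_sum_of_nonneg (fun _ _ => norm_nonneg _)]
      simp only [ofReal_norm, Real.enorm_of_nonneg hk]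
      rfl
    calc _ ≤ ((C.toNNReal : ℝ≥0∞) *
        (∑ m ∈ Finset.range N, ‖dirDeriv A l ((z.1, ζ - z.2, z.2) + (m : ℝ) • v)‖ₑ
          + ‖κ ζ z.2‖ₑ)) ^ 2 := by gcongr
      _ ≤ (C.toNNReal : ℝ≥0∞) ^ 2 * (2 *
        ((∑ m ∈ Finset.range N, ‖dirDeriv A l ((z.1, ζ - z.2, z.2) + (m : ℝ) • v)‖ₑ) ^ 2
          + ‖κ ζ z.2‖ₑ ^ 2)) := by
        rw [mul_pow]
        gcongr
        simpa using ENNReal.sum_sq_le Finset.univ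
          ![∑ m ∈ Finset.range N, ‖dirDeriv A l ((z.1, ζ - z.2, z.2) + (m : ℝ) • v)‖ₑ, ‖κ ζ z.2‖ₑ]
      _ ≤ (C.toNNReal : ℝ≥0∞) ^ 2 * (2 *
        (N * ∑ m ∈ Finset.range N, ‖dirDeriv A l ((z.1, ζ - z.2, z.2) + (m : ℝ) • v)‖ₑ ^ 2
          + ‖κ ζ z.2‖ₑ ^ 2)) := by
        gcongr
        simpa using ENNReal.sum_sq_le (Finset.range N)
          fun m : ℕ => ‖dirDeriv A l ((z.1, ζ - z.2, z.2) + (m : ℝ) • v)‖ₑ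
      _ = _ := by push_cast; ring
  have hm1 : ∀ m : ℕ, Measurable fun z : Rn n × Rn n =>
      ‖dirDeriv A l ((z.1, ζ - z.2, z.2) + (m : ℝ) • v)‖ₑ ^ 2 := fun m =>
    Continuous.measurable (by fun_prop)
  have hm2 : Measurable fun z : Rn n × Rn n => ‖κ ζ z.2‖ₑ ^ 2 :=
    (((hκm ζ).comp measurable_snd).enorm).pow_const 2
  refine (lintegral_mono hpt).trans ?_
  rw [lintegral_const_mul' _ _ ENNReal.coe_ne_top, lintegral_add_right _ hm2,
    lintegral_const_mul' _ _ (ENNReal.natCast_ne_top N),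
    lintegral_finsetSum _ (fun m _ => hm1 m)]
  push_cast
  have e1 : ∫⁻ z : Rn n × Rn n, ‖κ ζ z.2‖ₑ ^ 2 ∂μ ≤ b * B₁ := by
    rw [hμ, lintegral_prod _ hm2.aemeasurable]
    simp only [lintegral_const, Measure.restrict_apply_univ, hvol, hb]
    rw [mul_comm]
    gcongr
    exact hB₁ ζ
  have e2 : ∑ m ∈ Finset.range N, ∫⁻ z : Rn n × Rn n,
      ‖dirDeriv A l ((z.1, ζ - z.2, z.2) + (m : ℝ) • v)‖ₑ ^ 2 ∂μ ≤ N * B₂ := by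
    refine (Finset.sum_le_sum fun (m : ℕ) _ => hB₂ m x₀ ζ).trans ?_
    simp
  gcongr

end Closure

section SymbolClosure

variable {n : ℕ}

theorem exists_lintegral_sq_weight_le (K : ℝ) {s : ℝ} (hs : (n : ℝ) < 2 * s) :
    ∃ B : ℝ≥0, ∫⁻ η : Rn n, ‖K * (1 + ‖η‖ ^ 2) ^ (-s / 2)‖ₑ ^ 2 ≤ B := by
  have h := (integrable_rpow_neg_one_add_norm_sq (E := Rn n) (μ := volume) (r := 2 * s)
    (by simpa using hs)).const_mul (K ^ 2)
  have h2 := h.hasFiniteIntegral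
  rw [HasFiniteIntegral] at h2
  refine ⟨(∫⁻ η : Rn n, ‖K ^ 2 * (1 + ‖η‖ ^ 2) ^ (-(2 * s) / 2)‖ₑ).toNNReal, ?_⟩
  rw [ENNReal.coe_toNNReal h2.ne]
  refine lintegral_mono fun η => le_of_eq ?_
  rw [← enorm_pow]
  congr 1
  rw [mul_pow, ← Real.rpow_natCast (_ ^ (-s / 2)), ← Real.rpow_mul (by positivity)]
  congr 2
  push_cast
  ring

theorem exists_nat_weight (n : ℕ) {ρ : ℝ} (hρ : 0 < ρ) : ∃ N : ℕ, 2 ≤ N ∧ (n : ℝ) < 2 * (ρ * N) := by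
  obtain ⟨N, hN⟩ := exists_nat_gt ((n : ℝ) / (2 * ρ))
  refine ⟨N + 2, by omega, ?_⟩
  rw [div_lt_iff₀ (by positivity)] at hN
  push_cast
  nlinarith

theorem dirDeriv_dirDeriv_cons {A : PhaseSp n → ℂ} (hA : ContDiff ℝ (⊤ : ℕ∞) A) (v : PhaseSp n)
    (l : List (PhaseSp n)) : dirDeriv (dirDeriv A [v]) l = dirDeriv A (v :: l) := by
  rw [← dirDeriv_append]
  exact dirDeriv_perm hA (by simp)

theorem bound_exponent_mono {C a s t : ℝ} (hst : s ≤ t) (ha : 0 ≤ a) :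
    C * (1 + a) ^ s ≤ |C| * (1 + a) ^ t := by
  have : (1 + a) ^ s ≤ (1 + a) ^ t := Real.rpow_le_rpow_of_exponent_le (by linarith) hst
  have h0 : 0 ≤ (1 + a) ^ s := by positivity
  nlinarith [le_abs_self C, abs_nonneg C]

theorem weight_base_anti {C a b s : ℝ} (hs : s ≤ 0) (ha : 0 ≤ a) (hab : a ≤ b) :
    C * (1 + b) ^ s ≤ |C| * (1 + a) ^ s := by
  have : (1 + b) ^ s ≤ (1 + a) ^ s := Real.rpow_le_rpow_of_nonpos (by linarith) (by linarith) hs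
  have h0 : 0 ≤ (1 + b) ^ s := Real.rpow_nonneg (by linarith) _
  nlinarith [le_abs_self C, abs_nonneg C]

theorem GoodSymbol.dirXi {ρ : ℝ} (hρ : 0 < ρ) {A : PhaseSp n → ℂ} (hA : GoodSymbol ρ A)
    (j : Fin n) : GoodSymbol ρ (dirDeriv A [dirXi j]) := by
  refine ⟨contDiff_dirDeriv hA.smooth _, fun xs vs ws => ?_, fun xs => ?_⟩
  · obtain ⟨C, hC⟩ := hA.bound xs (j :: vs) ws
    refine ⟨|C|, fun p => ?_⟩
    have h := hC p
    rw [dirDeriv_dirDeriv_cons hA.smooth, dirDeriv_perm hA.smooth (ws := xs.map dirX ++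
      ((j :: vs).map _root_.dirXi ++ ws.map dirEta)) (by
        simpa using (List.perm_middle).symm)]
    refine h.trans ?_
    rw [add_assoc]
    refine bound_exponent_mono ?_ (by positivity)
    push_cast [List.length_cons]
    nlinarith
  · obtain ⟨N, hN, hNn⟩ := exists_nat_weight n hρ
    obtain ⟨C, hC⟩ := hA.bound xs (List.replicate N j) []
    obtain ⟨B₁, hB₁⟩ := exists_lintegral_sq_weight_le (n := n) |C| hNn
    obtain ⟨B₂, hB₂⟩ := hA.sq xs
    rw [dirDeriv_dirDeriv_cons hA.smooth]
    refine lintegral_sq_dirDeriv_cons_le hA.smooth _ _ N hN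
      (fun _ η => |C| * (1 + ‖η‖ ^ 2) ^ (-(ρ * N) / 2)) (fun x ζ η t => ?_) (fun ζ => ?_) B₁ B₂
      (fun ζ => hB₁) (fun t x₀ ζ => ?_)
    · have h := hC ((x, ζ - η, η) + t • _root_.dirXi j)
      rw [dirDeriv_perm hA.smooth (ws := List.replicate N (_root_.dirXi j) ++ xs.map dirX) (by
        simpa using List.perm_append_comm)] at h
      refine h.trans ?_
      simp only [_root_.dirXi, Prod.smul_mk, Prod.mk_add_mk, smul_zero, add_zero,
        List.length_replicate, List.length_nil, Nat.cast_zero]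
      rw [add_assoc]
      refine weight_base_anti (by nlinarith [mul_pos hρ (show (0:ℝ) < N by exact_mod_cast (by omega))])
        (by positivity) (by nlinarith [sq_nonneg ‖ζ - η + t • EuclideanSpace.single j (1:ℝ)‖])
    · fun_prop
    · convert hB₂ x₀ (ζ + t • EuclideanSpace.single j (1:ℝ)) using 6 with z
      simp only [_root_.dirXi, Prod.smul_mk, Prod.mk_add_mk, smul_zero, add_zero]
      congr 2
      abel

theorem GoodSymbol.dirEta {ρ : ℝ} (hρ : 0 < ρ) {A : PhaseSp n → ℂ} (hA : GoodSymbol ρ A)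
    (j : Fin n) : GoodSymbol ρ (dirDeriv A [dirEta j]) := by
  refine ⟨contDiff_dirDeriv hA.smooth _, fun xs vs ws => ?_, fun xs => ?_⟩
  · obtain ⟨C, hC⟩ := hA.bound xs vs (j :: ws)
    refine ⟨|C|, fun p => ?_⟩
    have h := hC p
    rw [dirDeriv_dirDeriv_cons hA.smooth, dirDeriv_perm hA.smooth (ws := xs.map dirX ++
      (vs.map _root_.dirXi ++ (j :: ws).map _root_.dirEta)) (by
        simpa [← List.append_assoc] using (List.perm_middle).symm)]
    refine h.trans ?_
    rw [add_assoc]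
    refine bound_exponent_mono ?_ (by positivity)
    push_cast [List.length_cons]
    nlinarith
  · obtain ⟨N, hN, hNn⟩ := exists_nat_weight n hρ
    obtain ⟨C, hC⟩ := hA.bound xs [] (List.replicate N j)
    obtain ⟨B₁, hB₁⟩ := exists_lintegral_sq_weight_le (n := n) |C| hNn
    obtain ⟨B₂, hB₂⟩ := hA.sq xs
    rw [dirDeriv_dirDeriv_cons hA.smooth]
    refine lintegral_sq_dirDeriv_cons_le hA.smooth _ _ N hN
      (fun ζ η => |C| * (1 + ‖ζ - η‖ ^ 2) ^ (-(ρ * N) / 2)) (fun x ζ η t => ?_) (fun ζ => ?_) B₁ B₂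
      (fun ζ => ?_) (fun t x₀ ζ => ?_)
    · have h := hC ((x, ζ - η, η) + t • _root_.dirEta j)
      rw [dirDeriv_perm hA.smooth (ws := List.replicate N (_root_.dirEta j) ++ xs.map dirX) (by
        simpa using List.perm_append_comm)] at h
      refine h.trans ?_
      simp only [_root_.dirEta, Prod.smul_mk, Prod.mk_add_mk, smul_zero, add_zero,
        List.length_replicate, List.length_nil, Nat.cast_zero, zero_add]
      rw [add_assoc]
      refine weight_base_anti (by nlinarith [mul_pos hρ (show (0:ℝ) < N by exact_mod_cast (by omega))])
        (by positivity) (by nlinarith [sq_nonneg ‖η + t • EuclideanSpace.single j (1:ℝ)‖])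
    · fun_prop
    · rw [lintegral_sub_left_eq_self (fun η : Rn n => ‖|C| * (1 + ‖η‖ ^ 2) ^ (-(ρ * N) / 2)‖ₑ ^ 2) ζ]
      exact hB₁
    · refine le_trans (le_of_eq ?_) (hB₂ x₀ (ζ + t • EuclideanSpace.single j (1:ℝ)))
      have hc := (contDiff_dirDeriv hA.smooth (xs.map dirX)).continuous
      rw [lintegral_prod _ (by fun_prop), lintegral_prod _ (by fun_prop)]
      refine lintegral_congr fun x => ?_
      refine Eq.trans ?_ (lintegral_add_right_eq_self _ (t • EuclideanSpace.single j (1:ℝ)))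
      refine lintegral_congr fun η => ?_
      simp only [_root_.dirEta, Prod.smul_mk, Prod.mk_add_mk, smul_zero, add_zero]
      congr 5
      abel

end SymbolClosure

section Plancherel

open scoped FourierTransform ContDiff

variable {n : ℕ}

theorem fourier_ae_eq_Lp_fourier {G : Rn n → ℂ} (hG : Integrable G) (hG2 : MemLp G 2) :
    𝓕 G =ᵐ[volume] (𝓕 (hG2.toLp G) : Lp ℂ 2 (volume : Measure (Rn n))) := by
  have hcont : Continuous (𝓕 G) := VectorFourier.fourierIntegral_continuous Real.continuous_fourierChar
    (by exact continuous_inner) hG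
  refine ae_eq_of_integral_contDiff_smul_eq hcont.locallyIntegrable
    ((Lp.memLp _).locallyIntegrable (by norm_num)) fun g hg hgc => ?_
  have hg₁ : HasCompactSupport (Complex.ofRealCLM ∘ g) := hgc.comp_left rfl
  have hg₂ : ContDiff ℝ ∞ (Complex.ofRealCLM ∘ g) := by fun_prop
  set ψ : SchwartzMap (Rn n) ℂ := hg₁.toSchwartzMap hg₂ with hψ
  have h1 := congrArg (fun S => S ψ) (Lp.fourier_toTemperedDistribution_eq (hG2.toLp G))
  simp only [TemperedDistribution.fourier_apply, Lp.toTemperedDistribution_apply] at h1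
  have h2 : ∫ x, (𝓕 ψ) x • (hG2.toLp G) x = ∫ x, (𝓕 ψ) x • G x := by
    refine integral_congr_ae ?_
    filter_upwards [hG2.coeFn_toLp] with x hx
    rw [hx]
  have h3 : ∫ x, (𝓕 (ψ : Rn n → ℂ)) x • G x = ∫ x, ψ x • 𝓕 G x := by
    have := VectorFourier.integral_fourierIntegral_smul_eq_flip (L := innerₗ (Rn n))
      (μ := volume) (ν := volume) Real.continuous_fourierChar (by exact continuous_inner)
      (ψ.integrable (μ := volume)) hG
    rw [flip_innerₗ] at this
    exact this
  have h4 : ∀ F : Rn n → ℂ, ∫ x, ψ x • F x = ∫ x, g x • F x := fun F => by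
    refine integral_congr_ae (Filter.Eventually.of_forall fun x => ?_)
    simp [hψ]
  rw [← h4, ← h4, ← h1, h2, ← h3, SchwartzMap.fourier_coe]

theorem eLpNorm_fourier_eq {G : Rn n → ℂ} (hG : Integrable G) (hG2 : MemLp G 2) :
    eLpNorm (𝓕 G) 2 = eLpNorm G 2 := by
  rw [eLpNorm_congr_ae (fourier_ae_eq_Lp_fourier hG hG2), ← Lp.enorm_def, ← ofReal_norm,
    Lp.norm_fourier_eq, ofReal_norm, Lp.enorm_def, eLpNorm_congr_ae hG2.coeFn_toLp]

theorem lintegral_comp_smul (f : Rn n → ℝ≥0∞) {R : ℝ} (hR : R ≠ 0) :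
    ∫⁻ x, f (R • x) = ENNReal.ofReal |(R ^ n)⁻¹| * ∫⁻ x, f x := by
  have h := Measure.map_addHaar_smul (volume : Measure (Rn n)) hR
  have h2 := lintegral_map_equiv (μ := (volume : Measure (Rn n))) f
    (Homeomorph.smul (Units.mk0 R hR)).toMeasurableEquiv
  have h3 : ⇑(Homeomorph.smul (Units.mk0 R hR) : Rn n ≃ₜ Rn n).toMeasurableEquiv = fun x => R • x := rfl
  rw [h3, show Measure.map (fun x : Rn n => R • x) volume = Measure.map (R • ·) volume from rfl, h,
    lintegral_smul_measure] at h2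
  simpa using h2.symm

theorem eLpNorm_two_sq {X : Type*} [MeasurableSpace X] (μ : Measure X) (f : X → ℂ) :
    eLpNorm f 2 μ ^ 2 = ∫⁻ x, ‖f x‖ₑ ^ 2 ∂μ := by
  have := eLpNorm_nnreal_pow_eq_lintegral (f := f) (μ := μ) (p := 2) (by norm_num)
  norm_num at this
  exact this

theorem lintegral_sq_expIntegral_le {G : Rn n → ℂ} (hG : Integrable G) :
    ∫⁻ x : Rn n, ‖∫ ζ, G ζ * exp (I * ((⟪x, ζ⟫ : ℝ) : ℂ))‖ₑ ^ 2 ≤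
      ENNReal.ofReal ((2 * Real.pi) ^ n) * ∫⁻ ζ, ‖G ζ‖ₑ ^ 2 := by
  have hpi : (0 : ℝ) < 2 * Real.pi := by positivity
  by_cases hG2 : MemLp G 2
  · have h1 : ∀ x : Rn n, ∫ ζ, G ζ * exp (I * ((⟪x, ζ⟫ : ℝ) : ℂ)) =
        𝓕 G ((-(2 * Real.pi)⁻¹ : ℝ) • x) := fun x => by
      rw [Real.fourier_eq']
      refine integral_congr_ae (Filter.Eventually.of_forall fun ζ => ?_)
      simp only [smul_eq_mul]
      rw [mul_comm]
      congr 2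
      rw [inner_smul_right, real_inner_comm]
      push_cast
      have : (Real.pi : ℂ) ≠ 0 := by exact_mod_cast Real.pi_ne_zero
      field_simp
    simp_rw [h1]
    rw [lintegral_comp_smul (fun x => ‖𝓕 G x‖ₑ ^ 2) (by simp [Real.pi_ne_zero]), ← eLpNorm_two_sq,
      ← eLpNorm_two_sq, eLpNorm_fourier_eq hG hG2]
    refine mul_le_mul_left (ENNReal.ofReal_le_ofReal (le_of_eq ?_)) _
    rw [abs_inv, abs_pow, abs_neg, abs_inv, abs_of_pos hpi, ← inv_pow, inv_inv]
  · have : ∫⁻ ζ, ‖G ζ‖ₑ ^ 2 = ⊤ := by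
      by_contra h
      refine hG2 ⟨hG.1, ?_⟩
      rw [← eLpNorm_two_sq] at h
      rw [lt_top_iff_ne_top]
      intro h'
      rw [h'] at h
      simp at h
    rw [this, ENNReal.mul_top (ENNReal.ofReal_pos.2 (pow_pos hpi n)).ne']
    exact le_top

end Plancherel

section LocalSobolev

variable {n : ℕ}

theorem enorm_le_lintegral_add_deriv {f f' : ℝ → ℂ} (hf : ∀ t, HasDerivAt f (f' t) t)
    (hf' : Continuous f') {a δ : ℝ} (hδ : 0 < δ) {s : ℝ} (hs : s ∈ Set.Icc (a - δ) (a + δ)) :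
    ‖f s‖ₑ ≤ (1 + ENNReal.ofReal (2 * δ)⁻¹) *
      ∫⁻ t in Set.Icc (a - δ) (a + δ), (‖f t‖ₑ + ‖f' t‖ₑ) := by
  set J := Set.Icc (a - δ) (a + δ) with hJ
  have hfc : Continuous f := continuous_iff_continuousAt.2 fun t => (hf t).continuousAt
  have h1 : ∀ t ∈ J, ‖f s‖ₑ ≤ ‖f t‖ₑ + ∫⁻ u in J, ‖f' u‖ₑ := fun t ht => by
    have h2 : ∫ u in t..s, f' u = f s - f t :=
      intervalIntegral.integral_eq_sub_of_hasDerivAt (fun u _ => hf u) (hf'.intervalIntegrable _ _)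
    have h3 : ‖f s - f t‖ₑ ≤ ∫⁻ u in J, ‖f' u‖ₑ := by
      rw [← h2, ← ofReal_norm, intervalIntegral.norm_intervalIntegral_eq, ofReal_norm]
      refine (enorm_integral_le_lintegral_enorm _).trans (lintegral_mono_set ?_)
      exact Set.uIoc_subset_uIcc.trans (Set.uIcc_subset_Icc ht hs)
    calc ‖f s‖ₑ = ‖f t + (f s - f t)‖ₑ := by simp
      _ ≤ _ := (enorm_add_le _ _).trans (by gcongr)
  have hvol : volume J = ENNReal.ofReal (2 * δ) := by rw [hJ, Real.volume_Icc]; congr 1; ring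
  have hδ2 : ENNReal.ofReal (2 * δ)⁻¹ * ENNReal.ofReal (2 * δ) = 1 := by
    rw [← ENNReal.ofReal_mul (by positivity), inv_mul_cancel₀ (by positivity), ENNReal.ofReal_one]
  have h4 : ENNReal.ofReal (2 * δ) * ‖f s‖ₑ ≤
      (∫⁻ t in J, ‖f t‖ₑ) + ENNReal.ofReal (2 * δ) * ∫⁻ u in J, ‖f' u‖ₑ := by
    have := setLIntegral_mono (μ := volume) (s := J) (f := fun _ => ‖f s‖ₑ)
      (g := fun t => ‖f t‖ₑ + ∫⁻ u in J, ‖f' u‖ₑ) (by fun_prop) h1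
    rw [lintegral_add_right _ measurable_const, setLIntegral_const, setLIntegral_const, hvol] at this
    rwa [mul_comm _ ‖f s‖ₑ, mul_comm (ENNReal.ofReal _) (∫⁻ u in J, ‖f' u‖ₑ)]
  rw [lintegral_add_left (by fun_prop)]
  calc ‖f s‖ₑ = ENNReal.ofReal (2 * δ)⁻¹ * (ENNReal.ofReal (2 * δ) * ‖f s‖ₑ) := by
        rw [← mul_assoc, hδ2, one_mul]
    _ ≤ ENNReal.ofReal (2 * δ)⁻¹ * ((∫⁻ t in J, ‖f t‖ₑ) +
          ENNReal.ofReal (2 * δ) * ∫⁻ u in J, ‖f' u‖ₑ) := by gcongr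
    _ = ENNReal.ofReal (2 * δ)⁻¹ * (∫⁻ t in J, ‖f t‖ₑ) + 1 * ∫⁻ u in J, ‖f' u‖ₑ := by
        rw [mul_add, ← mul_assoc _ (ENNReal.ofReal (2 * δ)), hδ2]
    _ ≤ _ := by
        rw [mul_add]
        gcongr
        · exact le_add_self
        · exact le_self_add

/-- The sum of the absolute values of all members of a family `h` whose index is obtained from `l`
by prepending at most `k` directions (counted with multiplicity). -/
def sobSum (h : List (Fin n) → Rn n → ℂ) : ℕ → List (Fin n) → Rn n → ℝ≥0∞
  | 0, l, y => ‖h l y‖ₑ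
  | k + 1, l, y => sobSum h k l y + ∑ j, sobSum h k (j :: l) y

theorem measurable_sobSum {h : List (Fin n) → Rn n → ℂ} (hc : ∀ l, Continuous (h l)) (k : ℕ)
    (l : List (Fin n)) : Measurable (sobSum h k l) := by
  induction k generalizing l with
  | zero => exact (hc l).enorm.measurable
  | succ k ih =>
    exact (ih l).add (Finset.measurable_fun_sum _ fun j _ => ih (j :: l))

theorem toLp_update (z : Fin n → ℝ) (j : Fin n) (t : ℝ) :
    (WithLp.toLp 2 (Function.update z j t) : Rn n) =
      WithLp.toLp 2 z + (t - z j) • EuclideanSpace.single j (1 : ℝ) := by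
  ext i
  by_cases hij : i = j
  · subst hij; simp
  · simp [hij]

/-- Each `h (j :: l)` is the derivative of `h l` in the coordinate direction `j`. -/
def IsDerivFamily (h : List (Fin n) → Rn n → ℂ) : Prop :=
  (∀ l, Continuous (h l)) ∧ ∀ l j y, HasDerivAt
    (fun t : ℝ => h l (y + t • EuclideanSpace.single j (1 : ℝ))) (h (j :: l) y) 0

theorem IsDerivFamily.hasDerivAt {h : List (Fin n) → Rn n → ℂ} (hh : IsDerivFamily h)
    (l : List (Fin n)) (j : Fin n) (z : Fin n → ℝ) (t : ℝ) :
    HasDerivAt (fun t => h l (WithLp.toLp 2 (Function.update z j t)))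
      (h (j :: l) (WithLp.toLp 2 (Function.update z j t))) t := by
  have h1 := hh.2 l j (WithLp.toLp 2 (Function.update z j t))
  have h2 : HasDerivAt (fun u : ℝ => u - t) 1 t := (hasDerivAt_id t).sub_const t
  have h3 := HasDerivAt.scomp (𝕜 := ℝ) (𝕜' := ℝ) (h := fun u : ℝ => u - t) t
    (g₁ := fun s : ℝ => h l (WithLp.toLp 2 (Function.update z j t) + s • EuclideanSpace.single j (1:ℝ)))
    (by simpa using h1) h2
  rw [one_smul] at h3
  refine h3.congr_of_eventuallyEq (Filter.Eventually.of_forall fun u => ?_)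
  simp only [Function.comp_def, toLp_update]
  congr 1
  rw [add_assoc, ← add_smul]
  congr 2
  ring

theorem sobSum_le_lintegral {h : List (Fin n) → Rn n → ℂ} (hh : IsDerivFamily h) {δ : ℝ}
    (hδ : 0 < δ) (k : ℕ) (l : List (Fin n)) (j : Fin n) (z : Fin n → ℝ) (a : ℝ)
    (hz : z j ∈ Set.Icc (a - δ) (a + δ)) :
    sobSum h k l (WithLp.toLp 2 z) ≤ (1 + ENNReal.ofReal (2 * δ)⁻¹) *
      ∫⁻ t in Set.Icc (a - δ) (a + δ), sobSum h (k + 1) l (WithLp.toLp 2 (Function.update z j t)) := by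
  have hm : ∀ k l, Measurable fun t =>
      sobSum h k l (WithLp.toLp 2 (Function.update z j t)) := fun k l =>
    (measurable_sobSum hh.1 k l).comp (by
      simp_rw [toLp_update]
      fun_prop)
  induction k generalizing l with
  | zero =>
    have h1 := enorm_le_lintegral_add_deriv (fun t => hh.hasDerivAt l j z t) (by
      simp_rw [toLp_update]
      have := hh.1 (j :: l)
      fun_prop) hδ hz
    simp only [Function.update_eq_self] at h1
    refine h1.trans ?_
    gcongr with t
    simp only [sobSum]
    gcongr
    exact Finset.single_le_sum (f := fun j => ‖h (j :: l) _‖ₑ) (fun _ _ => zero_le) (Finset.mem_univ j)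
  | succ k ih =>
    have e : ∀ y, sobSum h (k + 1 + 1) l y = sobSum h (k + 1) l y + ∑ i, sobSum h (k + 1) (i :: l) y :=
      fun y => rfl
    simp_rw [e]
    rw [lintegral_add_left (hm _ _), lintegral_finsetSum _ (fun i _ => hm _ _), mul_add,
      Finset.mul_sum]
    rw [sobSum]
    gcongr with i
    · exact ih l
    · exact ih (i :: l)

/-- The closed box with centre `c` and half side `δ`. -/
def box (c : Rn n) (δ : ℝ) : Set (Fin n → ℝ) := Set.univ.pi fun i => Set.Icc (c i - δ) (c i + δ)

theorem measurableSet_box (c : Rn n) (δ : ℝ) : MeasurableSet (box c δ) :=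
  MeasurableSet.univ_pi fun _ => measurableSet_Icc

theorem enorm_le_lmarginal {h : List (Fin n) → Rn n → ℂ} (hh : IsDerivFamily h) {δ : ℝ}
    (hδ : 0 < δ) (c : Rn n) (s : Finset (Fin n)) (z : Fin n → ℝ) (hz : z ∈ box c δ) :
    ‖h [] (WithLp.toLp 2 z)‖ₑ ≤ (1 + ENNReal.ofReal (2 * δ)⁻¹) ^ s.card *
      lmarginal (fun _ => volume) s ((box c δ).indicator
        fun w => sobSum h s.card [] (WithLp.toLp 2 w)) z := by
  have hm : ∀ k, Measurable ((box c δ).indicator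
        fun w => sobSum h k [] (WithLp.toLp 2 w)) := fun k =>
    ((measurable_sobSum hh.1 k []).comp (by fun_prop)).indicator (measurableSet_box c δ)
  induction s using Finset.induction_on with
  | empty => simp [hz, sobSum]
  | insert j s hj ih =>
    refine ih.trans ?_
    rw [Finset.card_insert_of_notMem hj, lmarginal_insert' _ (hm _) hj, pow_succ, mul_assoc]
    refine mul_le_mul' le_rfl ?_
    have h1 : ((box c δ).indicator fun w => sobSum h s.card [] (WithLp.toLp 2 w)) ≤
        fun w => (1 + ENNReal.ofReal (2 * δ)⁻¹) * ∫⁻ t, (box c δ).indicator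
          (fun w => sobSum h (s.card + 1) [] (WithLp.toLp 2 w)) (Function.update w j t) := by
      intro w
      by_cases hw : w ∈ box c δ
      · rw [Set.indicator_of_mem hw]
        refine (sobSum_le_lintegral hh hδ s.card [] j w (c j) (hw j (Set.mem_univ j))).trans ?_
        refine mul_le_mul' le_rfl ?_
        rw [← lintegral_indicator measurableSet_Icc]
        refine lintegral_mono fun t => ?_
        by_cases ht : t ∈ Set.Icc (c j - δ) (c j + δ)
        · rw [Set.indicator_of_mem ht, Set.indicator_of_mem]
          intro i _
          by_cases hij : i = j
          · subst hij; simpa using ht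
          · simpa [hij] using hw i (Set.mem_univ i)
        · simp [ht]
      · simp [hw]
    refine (lmarginal_mono h1 z).trans (le_of_eq ?_)
    rw [lmarginal, lmarginal, lintegral_const_mul' _ _ (by simp)]

theorem enorm_le_lintegral_sobSum {h : List (Fin n) → Rn n → ℂ} (hh : IsDerivFamily h)
    (c : Rn n) {y : Rn n} (hy : y ∈ ball c (1 / (n + 1))) :
    ‖h [] y‖ₑ ≤ (1 + ENNReal.ofReal (2 * (1 / (n + 1 : ℝ)))⁻¹) ^ n *
      ∫⁻ w in ball c 1, sobSum h n [] w := by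
  set δ : ℝ := 1 / (n + 1 : ℝ) with hδd
  have hδ : 0 < δ := by positivity
  have h1 := enorm_le_lmarginal hh hδ c Finset.univ (WithLp.ofLp y) (fun i _ => by
    have h2 : ‖(y - c) i‖ ≤ ‖y - c‖ := PiLp.norm_apply_le (y - c) i
    rw [mem_ball, dist_eq_norm] at hy
    have h3 := abs_le.1 (h2.trans hy.le)
    rw [PiLp.sub_apply] at h3
    constructor <;> linarith [h3.1, h3.2])
  simp only [Finset.card_univ, Fintype.card_fin, lmarginal_univ] at h1
  refine h1.trans ?_
  gcongr
  rw [← lintegral_indicator measurableSet_ball]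
  have h4 := (EuclideanSpace.volume_preserving_symm_measurableEquiv_toLp (Fin n)).symm
    |>.lintegral_comp_emb (MeasurableEquiv.measurableEmbedding _)
    ((ball c 1).indicator fun w => sobSum h n [] w)
  rw [← h4]
  refine lintegral_mono fun w => ?_
  by_cases hw : w ∈ box c δ
  · rw [Set.indicator_of_mem hw, Set.indicator_of_mem]
    · rfl
    · show (WithLp.toLp 2 w : Rn n) ∈ ball c 1
      rw [mem_ball, dist_eq_norm, EuclideanSpace.norm_eq, Real.sqrt_lt' one_pos]
      calc ∑ i, ‖((WithLp.toLp 2 w : Rn n) - c) i‖ ^ 2 ≤ ∑ i : Fin n, δ ^ 2 := by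
            gcongr with i
            rw [PiLp.sub_apply, Real.norm_eq_abs, abs_le]
            have := hw i (Set.mem_univ i)
            constructor <;> simp only [] <;> linarith [this.1, this.2]
        _ = n * δ ^ 2 := by simp
        _ < 1 ^ 2 := by
            rw [hδd, div_pow, one_pow, mul_one_div, div_lt_iff₀ (by positivity)]
            nlinarith [(Nat.cast_nonneg n : (0:ℝ) ≤ n)]
  · simp [hw]

end LocalSobolev

section BaseEstimate

variable {n : ℕ}

/-- The character `q ↦ e^{i x·(ξ+η)}`, `q = (ξ, η)`. -/
def phase (x : Rn n) (q : Rn n × Rn n) : ℂ := exp (I * ((⟪x, q.1 + q.2⟫ : ℝ) : ℂ))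

theorem continuous_phase (x : Rn n) : Continuous (phase x) := by
  unfold phase
  fun_prop

theorem continuous_phase_left (q : Rn n × Rn n) : Continuous fun x : Rn n => phase x q := by
  unfold phase
  fun_prop

theorem norm_phase (x : Rn n) (q : Rn n × Rn n) : ‖phase x q‖ = 1 := by
  rw [phase, mul_comm, norm_exp_ofReal_mul_I]

/-- The tensor product of two functions. -/
def tens (φ γ : Rn n → ℂ) (q : Rn n × Rn n) : ℂ := φ q.1 * γ q.2

/-- The oscillatory integral with symbol frozen at `y` and evaluated at `x`. -/
def freezeOp (A : PhaseSp n → ℂ) (Ψ : Rn n × Rn n → ℂ) (y x : Rn n) : ℂ :=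
  ∫ q : Rn n × Rn n, A (y, q) * Ψ q * phase x q

theorem integrable_symbol_mul {D : PhaseSp n → ℂ} (hD : Continuous D) {C : ℝ}
    (hC : ∀ p, ‖D p‖ ≤ C) {Ψ : Rn n × Rn n → ℂ} (hΨ : Integrable Ψ) (y x : Rn n) :
    Integrable fun q => D (y, q) * Ψ q * phase x q := by
  have h1 : Integrable fun q => D (y, q) * Ψ q :=
    hΨ.bdd_mul (c := C) (by fun_prop) (Filter.Eventually.of_forall fun q => hC _)
  refine (h1.bdd_mul (c := 1) (f := fun q => phase x q)
    (continuous_phase x).aestronglyMeasurable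
    (Filter.Eventually.of_forall fun q => (norm_phase x q).le)).congr
    (Filter.Eventually.of_forall fun q => ?_)
  simp only []
  ring

theorem continuous_freezeOp {D : PhaseSp n → ℂ} (hD : Continuous D) {C : ℝ}
    (hC : ∀ p, ‖D p‖ ≤ C) {Ψ : Rn n × Rn n → ℂ} (hΨ : Integrable Ψ) :
    Continuous fun z : Rn n × Rn n => freezeOp D Ψ z.1 z.2 := by
  unfold freezeOp
  refine continuous_of_dominated (bound := fun q => C * ‖Ψ q‖)
    (fun z => (integrable_symbol_mul hD hC hΨ z.1 z.2).1)
    (fun z => Filter.Eventually.of_forall fun q => ?_) (hΨ.norm.const_mul C)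
    (Filter.Eventually.of_forall fun q => ?_)
  · rw [norm_mul, norm_phase, mul_one, norm_mul]
    gcongr
    exact hC _
  · have := (continuous_phase_left q).comp (continuous_snd (X := Rn n))
    exact ((hD.comp (by fun_prop : Continuous fun z : Rn n × Rn n => ((z.1, q) : PhaseSp n))).mul
      continuous_const).mul this

theorem hasDerivAt_dirDeriv_line {V : Type*} [NormedAddCommGroup V] [NormedSpace ℝ V] {A : V → ℂ}
    (hA : ContDiff ℝ (⊤ : ℕ∞) A) (l : List V) (v p : V) (t : ℝ) :
    HasDerivAt (fun t : ℝ => dirDeriv A l (p + t • v)) (dirDeriv A (v :: l) (p + t • v)) t := by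
  have hd : DifferentiableAt ℝ (dirDeriv A l) (p + t • v) :=
    (contDiff_dirDeriv hA _).differentiable (by simp) _
  have hl : HasDerivAt (fun t : ℝ => p + t • v) v t := by
    simpa using ((hasDerivAt_id t).smul_const v).const_add p
  exact hd.hasFDerivAt.comp_hasDerivAt t hl

theorem GoodSymbol.bounded {ρ : ℝ} {A : PhaseSp n → ℂ} (hA : GoodSymbol ρ A) (xs : List (Fin n)) :
    ∃ C : ℝ, ∀ p, ‖dirDeriv A (xs.map dirX) p‖ ≤ C := by
  obtain ⟨C, hC⟩ := hA.bound xs [] []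
  exact ⟨C, fun p => by simpa using hC p⟩

theorem isDerivFamily_freezeOp {ρ : ℝ} {A : PhaseSp n → ℂ} (hA : GoodSymbol ρ A)
    {Ψ : Rn n × Rn n → ℂ} (hΨ : Integrable Ψ) (x : Rn n) :
    IsDerivFamily fun l y => freezeOp (dirDeriv A (l.map dirX)) Ψ y x := by
  have hc : ∀ l : List (Fin n), Continuous (dirDeriv A (l.map dirX)) := fun l =>
    (contDiff_dirDeriv hA.smooth _).continuous
  refine ⟨fun l => ?_, fun l j y => ?_⟩
  · obtain ⟨C, hC⟩ := hA.bounded l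
    exact (continuous_freezeOp (hc l) hC hΨ).comp (by fun_prop : Continuous fun y => (y, x))
  · obtain ⟨C, hC⟩ := hA.bounded l
    obtain ⟨C', hC'⟩ := hA.bounded (j :: l)
    have h := (hasDerivAt_integral_of_dominated_loc_of_deriv_le (μ := (volume : Measure (Rn n × Rn n)))
      (x₀ := (0 : ℝ)) (s := Set.univ) (bound := fun q => C' * ‖Ψ q‖)
      (F := fun t q => dirDeriv A (l.map dirX) (y + t • EuclideanSpace.single j (1:ℝ), q) * Ψ q * phase x q)
      (F' := fun t q => dirDeriv A ((j :: l).map dirX) (y + t • EuclideanSpace.single j (1:ℝ), q) * Ψ q *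
        phase x q) Filter.univ_mem
      (Filter.Eventually.of_forall fun t => (integrable_symbol_mul (hc l) hC hΨ _ x).1)
      (integrable_symbol_mul (hc l) hC hΨ _ x) (integrable_symbol_mul (hc (j :: l)) hC' hΨ _ x).1
      (Filter.Eventually.of_forall fun q t _ => ?_) (hΨ.norm.const_mul C')
      (Filter.Eventually.of_forall fun q t _ => ?_)).2
    · simpa [freezeOp] using h
    · rw [norm_mul, norm_phase, mul_one, norm_mul]
      gcongr
      exact hC' _
    · have h1 := hasDerivAt_dirDeriv_line hA.smooth (l.map dirX) (dirX j) (y, q) t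
      have h2 : ∀ t : ℝ, ((y, q) : PhaseSp n) + t • dirX j =
          (y + t • EuclideanSpace.single j (1:ℝ), q) := fun t => by
        simp [dirX]
      simp_rw [h2] at h1
      exact (h1.mul_const (Ψ q)).mul_const (phase x q)

/-- The shear `(ζ, η) ↦ (ζ - η, η)`. -/
def shear : (Rn n × Rn n) ≃ₜ (Rn n × Rn n) where
  toFun z := (z.1 - z.2, z.2)
  invFun z := (z.1 + z.2, z.2)
  left_inv z := by simp
  right_inv z := by simp

theorem shear_apply (z : Rn n × Rn n) : shear z = (z.1 - z.2, z.2) := rfl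

theorem measurePreserving_shear :
    MeasurePreserving (shear : Rn n × Rn n → Rn n × Rn n) volume volume :=
  measurePreserving_sub_prod volume volume

theorem integral_shear (F : Rn n × Rn n → ℂ) :
    ∫ q, F q = ∫ z : Rn n × Rn n, F (z.1 - z.2, z.2) :=
  (measurePreserving_shear.integral_comp shear.measurableEmbedding F).symm

theorem enorm_integral_mul_sq_le {X : Type*} [MeasurableSpace X] (μ : Measure X) {u v : X → ℂ}
    (hu : AEStronglyMeasurable u μ) (hv : AEStronglyMeasurable v μ) :
    ‖∫ x, u x * v x ∂μ‖ₑ ^ 2 ≤ (∫⁻ x, ‖u x‖ₑ ^ 2 ∂μ) * ∫⁻ x, ‖v x‖ₑ ^ 2 ∂μ := by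
  have h1 : ‖∫ x, u x * v x ∂μ‖ₑ ≤ ∫⁻ x, ‖u x‖ₑ * ‖v x‖ₑ ∂μ := by
    simpa [enorm_mul] using enorm_integral_le_lintegral_enorm (μ := μ) fun x => u x * v x
  have h2 := ENNReal.lintegral_mul_le_Lp_mul_Lq μ Real.HolderConjugate.two_two hu.enorm hv.enorm
  have h3 := pow_le_pow_left' (h1.trans h2) 2
  refine h3.trans (le_of_eq ?_)
  rw [mul_pow, ← ENNReal.rpow_natCast, ← ENNReal.rpow_mul, ← ENNReal.rpow_natCast,
    ← ENNReal.rpow_mul]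
  norm_num

theorem lintegral_sq_freezeOp_le {D : PhaseSp n → ℂ} (hD : Continuous D) {C : ℝ}
    (hC : ∀ p, ‖D p‖ ≤ C) (φ γ : SchwartzMap (Rn n) ℂ) (y : Rn n) :
    ∫⁻ x, ‖freezeOp D (tens φ γ) y x‖ₑ ^ 2 ≤ ENNReal.ofReal ((2 * Real.pi) ^ n) *
      ∫⁻ ζ, (∫⁻ η, ‖D (y, ζ - η, η)‖ₑ ^ 2) * ∫⁻ η, ‖φ (ζ - η) * γ η‖ₑ ^ 2 := by
  set G : Rn n → ℂ := fun ζ => ∫ η, D (y, ζ - η, η) * (φ (ζ - η) * γ η) with hG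
  have hΨ : Integrable (tens φ γ) (volume : Measure (Rn n × Rn n)) :=
    (φ.integrable (μ := volume)).mul_prod (γ.integrable (μ := volume))
  have h_int := fun x => (measurePreserving_shear.integrable_comp_emb
    shear.measurableEmbedding).2 (integrable_symbol_mul hD hC hΨ y x)
  have hGi : Integrable G := by
    have h0 := (h_int 0).integral_prod_left
    simpa [shear, phase, tens, Function.comp_def] using h0
  have hT : ∀ x, freezeOp D (tens φ γ) y x = ∫ ζ, G ζ * exp (I * ((⟪x, ζ⟫ : ℝ) : ℂ)) := fun x => by
    rw [freezeOp, integral_shear]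
    rw [Measure.volume_eq_prod]
    refine (integral_prod _ (h_int x)).trans ?_
    refine integral_congr_ae (Filter.Eventually.of_forall fun ζ => ?_)
    simp only [phase, shear_apply, Function.comp_def, sub_add_cancel, tens, hG, mul_assoc]
    rw [← integral_mul_const]
    simp only [mul_assoc]
  simp_rw [hT]
  refine (lintegral_sq_expIntegral_le hGi).trans ?_
  gcongr with ζ
  exact enorm_integral_mul_sq_le _ (by fun_prop) (by
    have := φ.continuous
    have := γ.continuous
    fun_prop)

theorem exists_freezeOp_bound {ρ : ℝ} {A : PhaseSp n → ℂ} (hA : GoodSymbol ρ A)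
    (l : List (Fin n)) : ∃ K : ℝ≥0, ∀ (x₀ : Rn n) (φ γ : SchwartzMap (Rn n) ℂ),
      ∫⁻ x, ∫⁻ y in ball x₀ 1, ‖freezeOp (dirDeriv A (l.map dirX)) (tens φ γ) y x‖ₑ ^ 2 ≤
        K * ((∫⁻ ξ, ‖φ ξ‖ₑ ^ 2) * ∫⁻ ξ, ‖γ ξ‖ₑ ^ 2) := by
  obtain ⟨C, hC⟩ := hA.bounded l
  obtain ⟨B, hB⟩ := hA.sq l
  have hc : Continuous (dirDeriv A (l.map dirX)) := (contDiff_dirDeriv hA.smooth _).continuous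
  set D := dirDeriv A (l.map dirX) with hD
  refine ⟨Real.toNNReal ((2 * Real.pi) ^ n) * B, fun x₀ φ γ => ?_⟩
  have hΨ : Integrable (tens φ γ) (volume : Measure (Rn n × Rn n)) :=
    (φ.integrable (μ := volume)).mul_prod (γ.integrable (μ := volume))
  have hφ := φ.continuous
  have hγ := γ.continuous
  have hcf := continuous_freezeOp hc hC hΨ
  have hM : Measurable fun z : Rn n × Rn n => ‖freezeOp D (tens φ γ) z.2 z.1‖ₑ ^ 2 :=
    ((hcf.comp continuous_swap).enorm.measurable).pow_const 2
  rw [lintegral_lintegral_swap hM.aemeasurable]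
  calc ∫⁻ y in ball x₀ 1, ∫⁻ x, ‖freezeOp D (tens φ γ) y x‖ₑ ^ 2
      ≤ ∫⁻ y in ball x₀ 1, ENNReal.ofReal ((2 * Real.pi) ^ n) *
        ∫⁻ ζ, (∫⁻ η, ‖D (y, ζ - η, η)‖ₑ ^ 2) * ∫⁻ η, ‖φ (ζ - η) * γ η‖ₑ ^ 2 :=
        lintegral_mono fun y => lintegral_sq_freezeOp_le hc hC φ γ y
    _ = ENNReal.ofReal ((2 * Real.pi) ^ n) * ∫⁻ ζ, ∫⁻ y in ball x₀ 1,
        (∫⁻ η, ‖D (y, ζ - η, η)‖ₑ ^ 2) * ∫⁻ η, ‖φ (ζ - η) * γ η‖ₑ ^ 2 := by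
        rw [lintegral_const_mul' _ _ ENNReal.ofReal_ne_top, lintegral_lintegral_swap]
        refine Measurable.aemeasurable (Measurable.mul ?_ ?_)
        · exact Measurable.lintegral_prod_right'
            (f := fun w : (Rn n × Rn n) × Rn n => ‖D (w.1.1, w.1.2 - w.2, w.2)‖ₑ ^ 2)
            (((hc.comp (by fun_prop : Continuous fun w : (Rn n × Rn n) × Rn n =>
              ((w.1.1, w.1.2 - w.2, w.2) : PhaseSp n))).enorm.measurable).pow_const 2)
        · exact Measurable.lintegral_prod_right'
            (f := fun w : (Rn n × Rn n) × Rn n => ‖φ (w.1.2 - w.2) * γ w.2‖ₑ ^ 2) (by fun_prop)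
    _ ≤ ENNReal.ofReal ((2 * Real.pi) ^ n) * ∫⁻ ζ, B * ∫⁻ η, ‖φ (ζ - η) * γ η‖ₑ ^ 2 := by
        gcongr with ζ
        rw [lintegral_mul_const'']
        · gcongr
          refine le_trans (le_of_eq ?_) (hB x₀ ζ)
          rw [lintegral_prod (fun z : Rn n × Rn n => ‖D (z.1, ζ - z.2, z.2)‖ₑ ^ 2)
            (((hc.comp (by fun_prop : Continuous fun w : Rn n × Rn n =>
            ((w.1, ζ - w.2, w.2) : PhaseSp n))).enorm.measurable).pow_const 2).aemeasurable]
        · exact (Measurable.lintegral_prod_right'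
            (f := fun w : Rn n × Rn n => ‖D (w.1, ζ - w.2, w.2)‖ₑ ^ 2)
            (((hc.comp (by fun_prop : Continuous fun w : Rn n × Rn n =>
              ((w.1, ζ - w.2, w.2) : PhaseSp n))).enorm.measurable).pow_const 2)).aemeasurable
    _ = _ := by
        rw [lintegral_const_mul' _ _ ENNReal.coe_ne_top, ENNReal.coe_mul, ENNReal.ofReal, mul_assoc]
        congr 2
        rw [lintegral_lintegral_swap (by fun_prop)]
        have : ∀ η, ∫⁻ ζ, ‖φ (ζ - η) * γ η‖ₑ ^ 2 = (∫⁻ ξ, ‖φ ξ‖ₑ ^ 2) * ‖γ η‖ₑ ^ 2 := fun η => by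
          simp_rw [enorm_mul, mul_pow]
          have hm : Measurable fun ζ => ‖φ (ζ - η)‖ₑ ^ 2 :=
            ((hφ.comp (continuous_sub_right η)).enorm.measurable).pow_const 2
          rw [lintegral_mul_const _ hm,
            lintegral_sub_right_eq_self (fun ξ => ‖φ ξ‖ₑ ^ 2)]
        simp_rw [this]
        rw [lintegral_const_mul _ (by fun_prop)]

theorem measurable_sobSum_param {X : Type*} [TopologicalSpace X] [MeasurableSpace X] [BorelSpace X]
    [SecondCountableTopology X] {h : X → List (Fin n) → Rn n → ℂ}
    (hc : ∀ l, Continuous fun z : X × Rn n => h z.1 l z.2) (k : ℕ) (l : List (Fin n)) :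
    Measurable fun z : X × Rn n => sobSum (h z.1) k l z.2 := by
  induction k generalizing l with
  | zero => exact (hc l).enorm.measurable
  | succ k ih =>
    exact (ih l).add (Finset.measurable_fun_sum _ fun j _ => ih (j :: l))

theorem exists_sobSum_bound {ρ : ℝ} {A : PhaseSp n → ℂ} (hA : GoodSymbol ρ A) (k : ℕ)
    (l : List (Fin n)) : ∃ K : ℝ≥0, ∀ (x₀ : Rn n) (φ γ : SchwartzMap (Rn n) ℂ),
      ∫⁻ x, ∫⁻ y in ball x₀ 1,
        sobSum (fun l y => freezeOp (dirDeriv A (l.map dirX)) (tens φ γ) y x) k l y ^ 2 ≤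
        K * ((∫⁻ ξ, ‖φ ξ‖ₑ ^ 2) * ∫⁻ ξ, ‖γ ξ‖ₑ ^ 2) := by
  induction k generalizing l with
  | zero => exact exists_freezeOp_bound hA l
  | succ k ih =>
    obtain ⟨K₀, hK₀⟩ := ih l
    choose K₁ hK₁ using fun j : Fin n => ih (j :: l)
    refine ⟨2 * (K₀ + n * ∑ j, K₁ j), fun x₀ φ γ => ?_⟩
    have hΨ : Integrable (tens φ γ) (volume : Measure (Rn n × Rn n)) :=
      (φ.integrable (μ := volume)).mul_prod (γ.integrable (μ := volume))
    set h : Rn n → List (Fin n) → Rn n → ℂ :=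
      fun x l y => freezeOp (dirDeriv A (l.map dirX)) (tens φ γ) y x with hh
    have hm : ∀ l, Measurable fun z : Rn n × Rn n => sobSum (h z.1) k l z.2 := fun l => by
      refine measurable_sobSum_param (fun l => ?_) k l
      obtain ⟨C, hC⟩ := hA.bounded l
      exact (continuous_freezeOp (contDiff_dirDeriv hA.smooth _).continuous hC hΨ).comp
        continuous_swap
    have hm1 : ∀ l x, Measurable fun y => sobSum (h x) k l y ^ 2 := fun l x =>
      ((hm l).comp (measurable_const.prodMk measurable_id)).pow_const 2
    have hm2 : ∀ l, Measurable fun x => ∫⁻ y in ball x₀ 1, sobSum (h x) k l y ^ 2 := fun l =>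
      ((hm l).pow_const 2).lintegral_prod_right'
    set R := (∫⁻ ξ, ‖φ ξ‖ₑ ^ 2) * ∫⁻ ξ, ‖γ ξ‖ₑ ^ 2 with hR
    have hpt : ∀ x y, sobSum (h x) (k + 1) l y ^ 2 ≤ 2 * (sobSum (h x) k l y ^ 2 +
        n * ∑ j, sobSum (h x) k (j :: l) y ^ 2) := fun x y => by
      have h1 := ENNReal.sum_sq_le Finset.univ fun j => sobSum (h x) k (j :: l) y
      have h2 := ENNReal.sum_sq_le Finset.univ
        ![sobSum (h x) k l y, ∑ j, sobSum (h x) k (j :: l) y]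
      simp only [Fin.sum_univ_two, Matrix.cons_val_zero, Matrix.cons_val_one, Finset.card_univ,
        Fintype.card_fin] at h1 h2
      norm_num at h2
      exact h2.trans (by gcongr)
    calc ∫⁻ x, ∫⁻ y in ball x₀ 1, sobSum (h x) (k + 1) l y ^ 2
        ≤ ∫⁻ x, ∫⁻ y in ball x₀ 1, 2 * (sobSum (h x) k l y ^ 2 +
          n * ∑ j, sobSum (h x) k (j :: l) y ^ 2) :=
          lintegral_mono fun x => lintegral_mono fun y => hpt x y
      _ = 2 * ((∫⁻ x, ∫⁻ y in ball x₀ 1, sobSum (h x) k l y ^ 2) +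
          n * ∑ j, ∫⁻ x, ∫⁻ y in ball x₀ 1, sobSum (h x) k (j :: l) y ^ 2) := by
          rw [← lintegral_finsetSum _ fun j _ => hm2 (j :: l),
            ← lintegral_const_mul' _ _ (ENNReal.natCast_ne_top n), ← lintegral_add_left (hm2 l),
            ← lintegral_const_mul' _ _ ENNReal.ofNat_ne_top]
          refine lintegral_congr fun x => ?_
          rw [lintegral_const_mul' _ _ ENNReal.ofNat_ne_top, lintegral_add_left (hm1 l x),
            lintegral_const_mul' _ _ (ENNReal.natCast_ne_top n),
            lintegral_finsetSum _ fun j _ => hm1 (j :: l) x]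
      _ ≤ 2 * (K₀ * R + n * ∑ j, K₁ j * R) := by
          gcongr with j
          · exact hK₀ x₀ φ γ
          · exact hK₁ j x₀ φ γ
      _ = _ := by
          rw [← Finset.sum_mul]
          push_cast
          ring

theorem exists_local_bound {ρ : ℝ} {A : PhaseSp n → ℂ} (hA : GoodSymbol ρ A) :
    ∃ K : ℝ≥0, ∀ (x₀ : Rn n) (φ γ : SchwartzMap (Rn n) ℂ),
      ∫⁻ x in ball x₀ (1 / (n + 1)), ‖freezeOp A (tens φ γ) x x‖ₑ ^ 2 ≤
        K * ((∫⁻ ξ, ‖φ ξ‖ₑ ^ 2) * ∫⁻ ξ, ‖γ ξ‖ₑ ^ 2) := by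
  obtain ⟨K, hK⟩ := exists_sobSum_bound hA n []
  set c : ℝ≥0∞ := (1 + ENNReal.ofReal (2 * (1 / (n + 1 : ℝ)))⁻¹) ^ n with hc
  have hcT : c ≠ ⊤ := by simp [hc]
  set V : ℝ≥0∞ := volume (ball (0 : Rn n) 1) with hV
  have hVT : V ≠ ⊤ := measure_ball_lt_top.ne
  refine ⟨c.toNNReal ^ 2 * V.toNNReal * K, fun x₀ φ γ => ?_⟩
  have hΨ : Integrable (tens φ γ) (volume : Measure (Rn n × Rn n)) :=
    (φ.integrable (μ := volume)).mul_prod (γ.integrable (μ := volume))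
  set h : Rn n → List (Fin n) → Rn n → ℂ :=
    fun x l y => freezeOp (dirDeriv A (l.map dirX)) (tens φ γ) y x with hh
  have hpt : ∀ x ∈ ball x₀ (1 / (n + 1)), ‖freezeOp A (tens φ γ) x x‖ₑ ^ 2 ≤
      c ^ 2 * V * ∫⁻ y in ball x₀ 1, sobSum (h x) n [] y ^ 2 := fun x hx => by
    have h1 := enorm_le_lintegral_sobSum (isDerivFamily_freezeOp hA hΨ x) x₀ hx
    have h2 := ENNReal.lintegral_mul_le_Lp_mul_Lq (volume.restrict (ball x₀ 1))
      Real.HolderConjugate.two_two (f := fun _ => 1) (g := sobSum (h x) n [])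
      aemeasurable_const (measurable_sobSum (isDerivFamily_freezeOp hA hΨ x).1 n []).aemeasurable
    simp only [Pi.mul_apply, one_mul, ENNReal.one_rpow, lintegral_const, Measure.restrict_apply_univ] at h2
    have h3 := pow_le_pow_left' h2 2
    rw [mul_pow, ← ENNReal.rpow_natCast, ← ENNReal.rpow_natCast, ← ENNReal.rpow_natCast,
      ← ENNReal.rpow_mul, ← ENNReal.rpow_mul] at h3
    norm_num at h3
    rw [Measure.addHaar_ball_center] at h3
    refine (pow_le_pow_left' h1 2).trans ?_
    rw [mul_pow, mul_assoc]
    exact mul_le_mul' le_rfl h3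
  calc ∫⁻ x in ball x₀ (1 / (n + 1)), ‖freezeOp A (tens φ γ) x x‖ₑ ^ 2
      ≤ ∫⁻ x in ball x₀ (1 / (n + 1)), c ^ 2 * V * ∫⁻ y in ball x₀ 1, sobSum (h x) n [] y ^ 2 :=
        setLIntegral_mono' measurableSet_ball hpt
    _ ≤ ∫⁻ x, c ^ 2 * V * ∫⁻ y in ball x₀ 1, sobSum (h x) n [] y ^ 2 := setLIntegral_le_lintegral _ _
    _ ≤ c ^ 2 * V * (K * ((∫⁻ ξ, ‖φ ξ‖ₑ ^ 2) * ∫⁻ ξ, ‖γ ξ‖ₑ ^ 2)) := by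
        rw [lintegral_const_mul' _ _ (by finiteness)]
        gcongr
        exact hK x₀ φ γ
    _ = _ := by
        push_cast
        rw [ENNReal.coe_toNNReal hcT, ENNReal.coe_toNNReal hVT]
        ring

end BaseEstimate

section Frequency

open scoped FourierTransform LineDeriv
open SchwartzMap

variable {n : ℕ}

/-- The Fourier transform of the theorem, as a map of Schwartz functions. -/
def freqT (f : SchwartzMap (Rn n) ℂ) : SchwartzMap (Rn n) ℂ :=
  compCLMOfContinuousLinearEquiv ℂ (ContinuousLinearEquiv.smulLeft
    (Units.mk0 (2 * Real.pi)⁻¹ (by positivity) : ℝˣ)) (𝓕 f)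

theorem freqT_apply (f : SchwartzMap (Rn n) ℂ) (ξ : Rn n) :
    freqT f ξ = 𝓕 (f : Rn n → ℂ) ((2 * Real.pi)⁻¹ • ξ) := rfl

theorem freqT_eq_fourierT (f : SchwartzMap (Rn n) ℂ) : (freqT f : Rn n → ℂ) = fourierT f := by
  ext ξ
  rw [freqT_apply, Real.fourier_eq', fourierT]
  refine integral_congr_ae (Filter.Eventually.of_forall fun y => ?_)
  simp only [smul_eq_mul, inner_smul_right, real_inner_comm]
  rw [mul_comm]
  congr 2
  have : (Real.pi : ℂ) ≠ 0 := by exact_mod_cast Real.pi_ne_zero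
  push_cast
  field_simp

theorem lintegral_sq_freqT (f : SchwartzMap (Rn n) ℂ) :
    ∫⁻ ξ, ‖freqT f ξ‖ₑ ^ 2 = ENNReal.ofReal ((2 * Real.pi) ^ n) * ∫⁻ y, ‖f y‖ₑ ^ 2 := by
  simp_rw [freqT_apply]
  rw [lintegral_comp_smul (fun ξ => ‖𝓕 (f : Rn n → ℂ) ξ‖ₑ ^ 2) (by positivity)]
  rw [← eLpNorm_two_sq volume, eLpNorm_fourier_eq f.integrable (f.memLp 2), eLpNorm_two_sq]
  congr 2
  rw [inv_pow, inv_inv, abs_of_pos (by positivity)]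

theorem inner_single_one (y : Rn n) (j : Fin n) :
    ⟪y, EuclideanSpace.single j (1 : ℝ)⟫ = y j := by
  rw [EuclideanSpace.inner_single_right]
  simp

/-- The `j`-th coordinate relative to the base point `x₀`. -/
def coordFn (x₀ : Rn n) (j : Fin n) (y : Rn n) : ℂ := ((y j - x₀ j : ℝ) : ℂ)

theorem hasTemperateGrowth_coordFn (x₀ : Rn n) (j : Fin n) :
    (coordFn x₀ j).HasTemperateGrowth := by
  have h : (fun y : Rn n => inner ℝ y (EuclideanSpace.single j (1 : ℝ)) - x₀ j).HasTemperateGrowth := by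
    fun_prop
  have h2 := (Complex.ofRealCLM.hasTemperateGrowth).comp h
  refine (iff_of_eq (congrArg _ ?_)).1 h2
  ext y
  simp [coordFn, inner_single_one]

/-- Multiplication by a coordinate relative to `x₀`. -/
def coordMul (x₀ : Rn n) (j : Fin n) : SchwartzMap (Rn n) ℂ →L[ℂ] SchwartzMap (Rn n) ℂ :=
  smulLeftCLM ℂ (coordFn x₀ j)

/-- The frequency-side counterpart of `coordMul`. -/
def freqOp (x₀ : Rn n) (j : Fin n) (φ : SchwartzMap (Rn n) ℂ) : SchwartzMap (Rn n) ℂ :=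
  I • ∂_{EuclideanSpace.single j (1 : ℝ)} φ - ((x₀ j : ℝ) : ℂ) • φ

theorem coordMul_apply (x₀ : Rn n) (j : Fin n) (f : SchwartzMap (Rn n) ℂ) (y : Rn n) :
    coordMul x₀ j f y = coordFn x₀ j y * f y := by
  rw [coordMul, smulLeftCLM_apply_apply (hasTemperateGrowth_coordFn x₀ j), smul_eq_mul]

theorem freqOp_apply (x₀ : Rn n) (j : Fin n) (φ : SchwartzMap (Rn n) ℂ) (ξ : Rn n) :
    freqOp x₀ j φ ξ = I * fderiv ℝ φ ξ (EuclideanSpace.single j 1) - (x₀ j : ℂ) * φ ξ := by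
  simp [freqOp, SchwartzMap.lineDerivOp_apply_eq_fderiv]

theorem freqT_coordMul (x₀ : Rn n) (j : Fin n) (f : SchwartzMap (Rn n) ℂ) :
    freqT (coordMul x₀ j f) = freqOp x₀ j (freqT f) := by
  set e : Rn n := EuclideanSpace.single j (1 : ℝ)
  have hg : (fun y : Rn n => inner ℝ y e).HasTemperateGrowth := by fun_prop
  have h1 : coordMul x₀ j f = smulLeftCLM ℂ (fun y : Rn n => inner ℝ y e) f - (x₀ j : ℂ) • f := by
    ext y
    rw [coordMul_apply, _root_.sub_apply, smulLeftCLM_apply_apply hg]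
    simp [coordFn, e, inner_single_one]
    ring
  have h2 : ∀ g h : SchwartzMap (Rn n) ℂ, ∀ c : ℂ, freqT (g - c • h) = freqT g - c • freqT h := by
    intro g h c
    simp [freqT, sub_eq_add_neg, FourierTransform.fourier_add, FourierTransform.fourier_smul, ← neg_smul]
  ext ξ
  rw [h1, h2, freqOp_apply, _root_.sub_apply, _root_.smul_apply, smul_eq_mul]
  congr 1
  have h3 := SchwartzMap.lineDerivOp_fourier_eq f e
  have h4 := congrArg (fun F : SchwartzMap (Rn n) ℂ => F ((2 * Real.pi)⁻¹ • ξ)) h3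
  simp only [SchwartzMap.lineDerivOp_apply_eq_fderiv, FourierTransform.fourier_smul] at h4
  have h5 : fderiv ℝ (freqT f) ξ e =
      (2 * Real.pi)⁻¹ • fderiv ℝ (𝓕 f : SchwartzMap (Rn n) ℂ) ((2 * Real.pi)⁻¹ • ξ) e := by
    have : (freqT f : Rn n → ℂ) = fun ξ => (𝓕 f : SchwartzMap (Rn n) ℂ) ((2 * Real.pi)⁻¹ • ξ) := rfl
    rw [this, fderiv_comp_smul]
    rfl
  rw [h5, h4]
  simp only [_root_.smul_apply, real_smul, smul_eq_mul]
  have : (Real.pi : ℂ) ≠ 0 := by exact_mod_cast Real.pi_ne_zero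
  rw [freqT_apply, SchwartzMap.fourier_coe]
  push_cast
  field_simp
  rw [I_sq]
  ring

end Frequency

section Commutator

variable {n : ℕ}

theorem hasFDerivAt_phase (x : Rn n) (q : Rn n × Rn n) (v : Rn n × Rn n) :
    DifferentiableAt ℝ (phase x) q ∧
      fderiv ℝ (phase x) q v = I * ((⟪x, v.1 + v.2⟫ : ℝ) : ℂ) * phase x q := by
  set L : Rn n × Rn n →L[ℝ] ℝ :=
    (innerSL ℝ x).comp (ContinuousLinearMap.fst ℝ (Rn n) (Rn n) + ContinuousLinearMap.snd ℝ (Rn n) (Rn n))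
  have hL : HasFDerivAt (fun q : Rn n × Rn n => I * ((L q : ℝ) : ℂ))
      (I • (Complex.ofRealCLM.comp L)) q :=
    ((Complex.ofRealCLM.comp L).hasFDerivAt).const_mul I
  have h : HasFDerivAt (phase x) (phase x q • (I • (Complex.ofRealCLM.comp L))) q := hL.cexp
  refine ⟨h.differentiableAt, ?_⟩
  rw [h.fderiv]
  simp [L, inner_add_right]
  ring

theorem freezeOp_fderiv {A : PhaseSp n → ℂ} (hA : ContDiff ℝ (⊤ : ℕ∞) A) {v : Rn n × Rn n} {C C' : ℝ}
    (hC : ∀ p, ‖A p‖ ≤ C) (hC' : ∀ p, ‖dirDeriv A [(0, v)] p‖ ≤ C') {Ψ : Rn n × Rn n → ℂ}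
    (hd : Differentiable ℝ Ψ) (hΨ : Integrable Ψ) (hΨ' : Integrable fun q => fderiv ℝ Ψ q v)
    (y x : Rn n) :
    freezeOp A (fun q => fderiv ℝ Ψ q v) y x =
      -freezeOp (dirDeriv A [(0, v)]) Ψ y x - I * ((⟪x, v.1 + v.2⟫ : ℝ) : ℂ) * freezeOp A Ψ y x := by
  have hc : Continuous (dirDeriv A [(0, v)]) := (contDiff_dirDeriv hA _).continuous
  have hAd : Differentiable ℝ A := hA.differentiable (by simp)
  set f : Rn n × Rn n → ℂ := fun q => A (y, q) * phase x q with hf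
  have hAy : ∀ q, HasFDerivAt (fun q => A (y, q))
      ((fderiv ℝ A (y, q)).comp (ContinuousLinearMap.inr ℝ (Rn n) (Rn n × Rn n))) q := fun q =>
    (hAd (y, q)).hasFDerivAt.comp q (hasFDerivAt_prodMk_right y q)
  have hfd : Differentiable ℝ f := fun q => (hAy q).differentiableAt.mul (hasFDerivAt_phase x q v).1
  have hfv : ∀ q, fderiv ℝ f q v = dirDeriv A [(0, v)] (y, q) * phase x q +
      A (y, q) * (I * ((⟪x, v.1 + v.2⟫ : ℝ) : ℂ) * phase x q) := fun q => by
    rw [hf, fderiv_fun_mul (hAy q).differentiableAt (hasFDerivAt_phase x q v).1]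
    simp only [_root_.add_apply, _root_.smul_apply, smul_eq_mul, (hasFDerivAt_phase x q v).2,
      (hAy q).fderiv]
    rw [add_comm, mul_comm (phase x q)]
    rfl
  have i1 := integrable_symbol_mul hA.continuous hC hΨ y x
  have i2 := integrable_symbol_mul hA.continuous hC hΨ' y x
  have i3 := integrable_symbol_mul hc hC' hΨ y x
  have e1 : ∀ q, fderiv ℝ f q v * Ψ q = dirDeriv A [(0, v)] (y, q) * Ψ q * phase x q +
      I * ((⟪x, v.1 + v.2⟫ : ℝ) : ℂ) * (A (y, q) * Ψ q * phase x q) := fun q => by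
    rw [hfv]; ring
  have : (volume : Measure (Rn n × Rn n)).IsAddHaarMeasure :=
    Measure.prod.instIsAddHaarMeasure volume volume
  have h := integral_mul_fderiv_eq_neg_fderiv_mul_of_integrable (μ := (volume : Measure (Rn n × Rn n)))
    (f := f) (g := Ψ) (v := v)
    ((i3.add (i1.const_mul (I * ((⟪x, v.1 + v.2⟫ : ℝ) : ℂ)))).congr
      (Filter.Eventually.of_forall fun q => (e1 q).symm))
    (i2.congr (Filter.Eventually.of_forall fun q => by simp only [hf]; ring))
    (i1.congr (Filter.Eventually.of_forall fun q => by simp only [hf]; ring))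
    (fun q _ => hfd q) (fun q _ => hd q)
  have e2 : freezeOp A (fun q => fderiv ℝ Ψ q v) y x = ∫ q, f q * fderiv ℝ Ψ q v :=
    integral_congr_ae (Filter.Eventually.of_forall fun q => by simp only [hf]; ring)
  rw [e2, h, integral_congr_ae (Filter.Eventually.of_forall e1), integral_add i3 (i1.const_mul _),
    integral_const_mul, freezeOp, freezeOp]
  ring

theorem integrable_tens (φ γ : SchwartzMap (Rn n) ℂ) :
    Integrable (tens φ γ) (volume : Measure (Rn n × Rn n)) :=
  (φ.integrable (μ := volume)).mul_prod (γ.integrable (μ := volume))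

theorem fderiv_tens (φ γ : SchwartzMap (Rn n) ℂ) (q v : Rn n × Rn n) :
    DifferentiableAt ℝ (tens φ γ) q ∧ fderiv ℝ (tens φ γ) q v =
      fderiv ℝ φ q.1 v.1 * γ q.2 + φ q.1 * fderiv ℝ γ q.2 v.2 := by
  have h1 : HasFDerivAt (fun q : Rn n × Rn n => φ q.1)
      ((fderiv ℝ φ q.1).comp (ContinuousLinearMap.fst ℝ (Rn n) (Rn n))) q :=
    (φ.differentiableAt (x := q.1)).hasFDerivAt.comp q hasFDerivAt_fst
  have h2 : HasFDerivAt (fun q : Rn n × Rn n => γ q.2)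
      ((fderiv ℝ γ q.2).comp (ContinuousLinearMap.snd ℝ (Rn n) (Rn n))) q :=
    (γ.differentiableAt (x := q.2)).hasFDerivAt.comp q hasFDerivAt_snd
  have h := h1.mul h2
  refine ⟨h.differentiableAt, ?_⟩
  have h' : HasFDerivAt (tens φ γ) _ q := h
  rw [h'.fderiv]
  simp
  ring

theorem freezeOp_add {A : PhaseSp n → ℂ} (hA : Continuous A) {C : ℝ} (hC : ∀ p, ‖A p‖ ≤ C)
    {Ψ Φ : Rn n × Rn n → ℂ} (hΨ : Integrable Ψ) (hΦ : Integrable Φ) (y x : Rn n) :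
    freezeOp A (fun q => Ψ q + Φ q) y x = freezeOp A Ψ y x + freezeOp A Φ y x := by
  rw [freezeOp, freezeOp, freezeOp, ← integral_add (integrable_symbol_mul hA hC hΨ y x)
    (integrable_symbol_mul hA hC hΦ y x)]
  refine integral_congr_ae (Filter.Eventually.of_forall fun q => ?_)
  simp only []
  ring

theorem freezeOp_const_mul (A : PhaseSp n → ℂ) (c : ℂ) (Ψ : Rn n × Rn n → ℂ) (y x : Rn n) :
    freezeOp A (fun q => c * Ψ q) y x = c * freezeOp A Ψ y x := by
  rw [freezeOp, freezeOp, ← integral_const_mul]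
  refine integral_congr_ae (Filter.Eventually.of_forall fun q => ?_)
  simp only []
  ring

theorem tens_freqOp_left (x₀ : Rn n) (j : Fin n) (φ γ : SchwartzMap (Rn n) ℂ) :
    tens (freqOp x₀ j φ) γ = fun q => I * fderiv ℝ (tens φ γ) q (EuclideanSpace.single j 1, 0) +
      (-(x₀ j : ℂ)) * tens φ γ q := by
  ext q
  rw [(fderiv_tens φ γ q _).2]
  simp only [tens, freqOp_apply, map_zero]
  ring

theorem tens_freqOp_right (x₀ : Rn n) (j : Fin n) (φ γ : SchwartzMap (Rn n) ℂ) :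
    tens φ (freqOp x₀ j γ) = fun q => I * fderiv ℝ (tens φ γ) q (0, EuclideanSpace.single j 1) +
      (-(x₀ j : ℂ)) * tens φ γ q := by
  ext q
  rw [(fderiv_tens φ γ q _).2]
  simp only [tens, freqOp_apply, map_zero]
  ring

theorem integrable_fderiv_tens (φ γ : SchwartzMap (Rn n) ℂ) (v : Rn n × Rn n) :
    Integrable (fun q => fderiv ℝ (tens φ γ) q v) (volume : Measure (Rn n × Rn n)) := by
  have h := (integrable_tens (LineDeriv.lineDerivOp v.1 φ) γ).add
    (integrable_tens φ (LineDeriv.lineDerivOp v.2 γ))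
  refine h.congr (Filter.Eventually.of_forall fun q => ?_)
  simp only [(fderiv_tens φ γ q v).2]
  simp [tens, SchwartzMap.lineDerivOp_apply_eq_fderiv]

theorem freezeOp_commutator {ρ : ℝ} {A : PhaseSp n → ℂ} (hA : GoodSymbol ρ A) {v : Rn n × Rn n}
    (hv : GoodSymbol ρ (dirDeriv A [(0, v)])) (φ γ : SchwartzMap (Rn n) ℂ) (c : ℂ) (x : Rn n) :
    freezeOp A (fun q => I * fderiv ℝ (tens φ γ) q v + (-c) * tens φ γ q) x x =
      (((⟪x, v.1 + v.2⟫ : ℝ) : ℂ) - c) * freezeOp A (tens φ γ) x x -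
        I * freezeOp (dirDeriv A [(0, v)]) (tens φ γ) x x := by
  obtain ⟨C, hC⟩ := hA.bounded []
  obtain ⟨C', hC'⟩ := hv.bounded []
  rw [freezeOp_add hA.smooth.continuous hC ((integrable_fderiv_tens φ γ v).const_mul I)
    ((integrable_tens φ γ).const_mul (-c)), freezeOp_const_mul, freezeOp_const_mul,
    freezeOp_fderiv hA.smooth hC hC' (fun q => (fderiv_tens φ γ q v).1) (integrable_tens φ γ)
      (integrable_fderiv_tens φ γ v)]
  linear_combination (-((⟪x, v.1 + v.2⟫ : ℝ) : ℂ) * freezeOp A (tens φ γ) x x) * I_sq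

/-- Local `L²` boundedness, uniform in the base point, with modified arguments. -/
def LocBound (ρ : ℝ) (U V : Rn n → SchwartzMap (Rn n) ℂ → SchwartzMap (Rn n) ℂ) : Prop :=
  ∀ A : PhaseSp n → ℂ, GoodSymbol ρ A → ∃ K : ℝ≥0, ∀ (x₀ : Rn n) (φ γ : SchwartzMap (Rn n) ℂ),
    ∫⁻ x in ball x₀ (1 / (n + 1)), ‖freezeOp A (tens (U x₀ φ) (V x₀ γ)) x x‖ₑ ^ 2 ≤
      K * ((∫⁻ ξ, ‖φ ξ‖ₑ ^ 2) * ∫⁻ ξ, ‖γ ξ‖ₑ ^ 2)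

theorem GoodSymbol.measurable_freezeOp {ρ : ℝ} {A : PhaseSp n → ℂ} (hA : GoodSymbol ρ A)
    (φ γ : SchwartzMap (Rn n) ℂ) : Measurable fun x => ‖freezeOp A (tens φ γ) x x‖ₑ ^ 2 := by
  obtain ⟨C, hC⟩ := hA.bounded []
  exact (((continuous_freezeOp hA.smooth.continuous hC (integrable_tens φ γ)).comp
    (by fun_prop : Continuous fun x : Rn n => (x, x))).enorm.measurable).pow_const 2

theorem enorm_add_sq_le (z w : ℂ) : ‖z + w‖ₑ ^ 2 ≤ 2 * (‖z‖ₑ ^ 2 + ‖w‖ₑ ^ 2) := by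
  have h := ENNReal.sum_sq_le Finset.univ ![‖z‖ₑ, ‖w‖ₑ]
  simp only [Fin.sum_univ_two, Matrix.cons_val_zero, Matrix.cons_val_one, Finset.card_univ,
    Fintype.card_fin] at h
  norm_num at h
  exact (pow_le_pow_left' (enorm_add_le z w) 2).trans h

/-- Two bounds combine as soon as the new integrand is controlled by the old ones. -/
theorem lintegral_ball_le_of_sq_le {F G₁ G₂ : Rn n → ℂ} {s : Set (Rn n)} (hs : MeasurableSet s)
    (hG : Measurable fun x => ‖G₁ x‖ₑ ^ 2) {K₁ K₂ : ℝ≥0} {R : ℝ≥0∞}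
    (h : ∀ x ∈ s, ‖F x‖ₑ ^ 2 ≤ 2 * (‖G₁ x‖ₑ ^ 2 + ‖G₂ x‖ₑ ^ 2))
    (h₁ : ∫⁻ x in s, ‖G₁ x‖ₑ ^ 2 ≤ K₁ * R) (h₂ : ∫⁻ x in s, ‖G₂ x‖ₑ ^ 2 ≤ K₂ * R) :
    ∫⁻ x in s, ‖F x‖ₑ ^ 2 ≤ ((2 * (K₁ + K₂) : ℝ≥0) : ℝ≥0∞) * R := by
  refine (setLIntegral_mono' hs h).trans ?_
  rw [lintegral_const_mul' _ _ ENNReal.ofNat_ne_top, lintegral_add_left hG]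
  push_cast
  rw [mul_assoc, add_mul]
  gcongr

theorem LocBound.of_commutator {ρ : ℝ} {U V U' V' : Rn n → SchwartzMap (Rn n) ℂ → SchwartzMap (Rn n) ℂ}
    (h : LocBound ρ U V) (j : Fin n) (v : Rn n × Rn n) (hvj : v.1 + v.2 = EuclideanSpace.single j 1)
    (hv : ∀ A, GoodSymbol ρ A → GoodSymbol ρ (dirDeriv A [(0, v)]))
    (hU : ∀ x₀ φ γ, tens (U' x₀ φ) (V' x₀ γ) = fun q =>
      I * fderiv ℝ (tens (U x₀ φ) (V x₀ γ)) q v + (-(x₀ j : ℂ)) * tens (U x₀ φ) (V x₀ γ) q) :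
    LocBound ρ U' V' := by
  intro A hA
  obtain ⟨K₁, h₁⟩ := h A hA
  obtain ⟨K₂, h₂⟩ := h _ (hv A hA)
  refine ⟨2 * (K₁ + K₂), fun x₀ φ γ => ?_⟩
  refine lintegral_ball_le_of_sq_le measurableSet_ball (hA.measurable_freezeOp _ _) (fun x hx => ?_)
    (h₁ x₀ φ γ) (h₂ x₀ φ γ)
  rw [hU, freezeOp_commutator hA (hv A hA), hvj, inner_single_one, sub_eq_add_neg]
  refine (enorm_add_sq_le _ _).trans ?_
  have hx1 : ‖((x j : ℝ) : ℂ) - (x₀ j : ℂ)‖ₑ ≤ 1 := by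
    rw [← ofReal_sub, ← ofReal_norm, norm_real]
    refine ENNReal.ofReal_le_one.2 ?_
    have h1 := PiLp.norm_apply_le (x - x₀) j
    rw [mem_ball, dist_eq_norm] at hx
    have h3 : (1 : ℝ) / (n + 1) ≤ 1 := by
      rw [div_le_one (by positivity)]
      linarith [n.cast_nonneg (α := ℝ)]
    exact h1.trans (hx.le.trans h3)
  rw [enorm_neg, enorm_mul, enorm_mul]
  have hI : ‖I‖ₑ = 1 := by rw [← ofReal_norm, norm_I, ENNReal.ofReal_one]
  rw [hI, one_mul]
  gcongr
  exact mul_le_of_le_one_left' hx1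

theorem LocBound.freqOp_left {ρ : ℝ} (hρ : 0 < ρ)
    {U V : Rn n → SchwartzMap (Rn n) ℂ → SchwartzMap (Rn n) ℂ} (h : LocBound ρ U V) (j : Fin n) :
    LocBound ρ (fun x₀ φ => freqOp x₀ j (U x₀ φ)) V :=
  h.of_commutator j (EuclideanSpace.single j 1, 0) (by simp) (fun _ hA => hA.dirXi hρ j)
    fun x₀ _ _ => tens_freqOp_left x₀ j _ _

theorem LocBound.freqOp_right {ρ : ℝ} (hρ : 0 < ρ)
    {U V : Rn n → SchwartzMap (Rn n) ℂ → SchwartzMap (Rn n) ℂ} (h : LocBound ρ U V) (j : Fin n) :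
    LocBound ρ U (fun x₀ γ => freqOp x₀ j (V x₀ γ)) :=
  h.of_commutator j (0, EuclideanSpace.single j 1) (by simp) (fun _ hA => hA.dirEta hρ j)
    fun x₀ _ _ => tens_freqOp_right x₀ j _ _

theorem LocBound.add {ρ : ℝ} {U V U₁ V₁ U₂ V₂ : Rn n → SchwartzMap (Rn n) ℂ → SchwartzMap (Rn n) ℂ}
    (h₁ : LocBound ρ U₁ V₁) (h₂ : LocBound ρ U₂ V₂)
    (hU : ∀ x₀ φ γ, tens (U x₀ φ) (V x₀ γ) = fun q => tens (U₁ x₀ φ) (V₁ x₀ γ) q +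
      tens (U₂ x₀ φ) (V₂ x₀ γ) q) : LocBound ρ U V := by
  intro A hA
  obtain ⟨K₁, h₁⟩ := h₁ A hA
  obtain ⟨K₂, h₂⟩ := h₂ A hA
  obtain ⟨C, hC⟩ := hA.bounded []
  refine ⟨2 * (K₁ + K₂), fun x₀ φ γ => ?_⟩
  refine lintegral_ball_le_of_sq_le measurableSet_ball (hA.measurable_freezeOp _ _) (fun x hx => ?_)
    (h₁ x₀ φ γ) (h₂ x₀ φ γ)
  rw [hU, freezeOp_add hA.smooth.continuous hC (integrable_tens _ _) (integrable_tens _ _)]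
  exact enorm_add_sq_le _ _

/-- The frequency-side counterpart of multiplication by `1 + |y - x₀|²`. -/
def freqWeight (x₀ : Rn n) (φ : SchwartzMap (Rn n) ℂ) : SchwartzMap (Rn n) ℂ :=
  φ + ∑ j, freqOp x₀ j (freqOp x₀ j φ)

theorem tens_add_left (φ φ' γ : SchwartzMap (Rn n) ℂ) :
    tens (φ + φ' : SchwartzMap (Rn n) ℂ) γ = fun q => tens φ γ q + tens φ' γ q := by
  ext q
  simp [tens, add_mul]

theorem tens_add_right (φ γ γ' : SchwartzMap (Rn n) ℂ) :
    tens φ (γ + γ' : SchwartzMap (Rn n) ℂ) = fun q => tens φ γ q + tens φ γ' q := by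
  ext q
  simp [tens, mul_add]

theorem LocBound.freqWeight_left {ρ : ℝ} (hρ : 0 < ρ)
    {U V : Rn n → SchwartzMap (Rn n) ℂ → SchwartzMap (Rn n) ℂ} (h : LocBound ρ U V) :
    LocBound ρ (fun x₀ φ => freqWeight x₀ (U x₀ φ)) V := by
  have key : ∀ s : Finset (Fin n), LocBound ρ
      (fun x₀ φ => U x₀ φ + ∑ j ∈ s, freqOp x₀ j (freqOp x₀ j (U x₀ φ))) V := fun s => by
    classical
    induction s using Finset.induction_on with
    | empty => simpa using h
    | insert j s hj ih =>
      refine ((h.freqOp_left hρ j).freqOp_left hρ j).add ih fun x₀ φ γ => ?_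
      rw [← tens_add_left, Finset.sum_insert hj]
      congr 2
      abel
  exact key Finset.univ

theorem LocBound.freqWeight_right {ρ : ℝ} (hρ : 0 < ρ)
    {U V : Rn n → SchwartzMap (Rn n) ℂ → SchwartzMap (Rn n) ℂ} (h : LocBound ρ U V) :
    LocBound ρ U (fun x₀ φ => freqWeight x₀ (V x₀ φ)) := by
  have key : ∀ s : Finset (Fin n), LocBound ρ U
      (fun x₀ φ => V x₀ φ + ∑ j ∈ s, freqOp x₀ j (freqOp x₀ j (V x₀ φ))) := fun s => by
    classical
    induction s using Finset.induction_on with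
    | empty => simpa using h
    | insert j s hj ih =>
      refine ((h.freqOp_right hρ j).freqOp_right hρ j).add ih fun x₀ φ γ => ?_
      rw [← tens_add_right, Finset.sum_insert hj]
      congr 2
      abel
  exact key Finset.univ

theorem locBound_iterate {ρ : ℝ} (hρ : 0 < ρ) (M : ℕ) :
    LocBound (n := n) ρ (fun x₀ => (freqWeight x₀)^[M]) (fun x₀ => (freqWeight x₀)^[M]) := by
  induction M with
  | zero => exact fun A hA => exists_local_bound hA
  | succ M ih =>
    simp_rw [Function.iterate_succ']
    exact (ih.freqWeight_left hρ).freqWeight_right hρ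

end Commutator

section Weighted

open SchwartzMap

variable {n : ℕ}

/-- Multiplication by `1 + |y - x₀|²`. -/
def spaceWeight (x₀ : Rn n) (f : SchwartzMap (Rn n) ℂ) : SchwartzMap (Rn n) ℂ :=
  f + ∑ j, coordMul x₀ j (coordMul x₀ j f)

theorem sum_schwartz_apply {ι : Type*} (s : Finset ι) (F : ι → SchwartzMap (Rn n) ℂ) (y : Rn n) :
    (∑ j ∈ s, F j) y = ∑ j ∈ s, F j y := by
  classical
  induction s using Finset.induction_on with
  | empty => simp
  | insert j s hj ih => simp [Finset.sum_insert hj, ih]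

theorem spaceWeight_apply (x₀ : Rn n) (f : SchwartzMap (Rn n) ℂ) (y : Rn n) :
    spaceWeight x₀ f y = ((1 + ‖y - x₀‖ ^ 2 : ℝ) : ℂ) * f y := by
  rw [spaceWeight, _root_.add_apply, sum_schwartz_apply]
  simp only [coordMul_apply, ← mul_assoc, ← Finset.sum_mul]
  rw [EuclideanSpace.norm_sq_eq]
  simp only [coordFn]
  push_cast
  rw [add_mul, one_mul]
  congr 2
  refine Finset.sum_congr rfl fun j _ => ?_
  rw [← sq, ← ofReal_sub, ← ofReal_pow, ← ofReal_pow]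
  simp

theorem freqT_add (f g : SchwartzMap (Rn n) ℂ) : freqT (f + g) = freqT f + freqT g := by
  simp [freqT, FourierTransform.fourier_add]

theorem freqT_zero : freqT (0 : SchwartzMap (Rn n) ℂ) = 0 := by
  simpa using freqT_add (0 : SchwartzMap (Rn n) ℂ) 0

theorem freqT_sum {ι : Type*} (s : Finset ι) (F : ι → SchwartzMap (Rn n) ℂ) :
    freqT (∑ j ∈ s, F j) = ∑ j ∈ s, freqT (F j) := by
  classical
  induction s using Finset.induction_on with
  | empty => simp [freqT_zero]
  | insert j s hj ih => simp [Finset.sum_insert hj, ih, freqT_add]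

theorem freqT_spaceWeight (x₀ : Rn n) (f : SchwartzMap (Rn n) ℂ) :
    freqT (spaceWeight x₀ f) = freqWeight x₀ (freqT f) := by
  simp only [spaceWeight, freqWeight, freqT_add, freqT_sum, freqT_coordMul]

theorem spaceWeight_iterate_apply (x₀ : Rn n) (M : ℕ) (f : SchwartzMap (Rn n) ℂ) (y : Rn n) :
    (spaceWeight x₀)^[M] f y = ((1 + ‖y - x₀‖ ^ 2 : ℝ) : ℂ) ^ M * f y := by
  induction M with
  | zero => simp
  | succ M ih =>
    rw [Function.iterate_succ', Function.comp_apply, spaceWeight_apply, ih]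
    ring

theorem freqT_spaceWeight_iterate (x₀ : Rn n) (M : ℕ) (f : SchwartzMap (Rn n) ℂ) :
    freqT ((spaceWeight x₀)^[M] f) = (freqWeight x₀)^[M] (freqT f) :=
  Function.Semiconj.iterate_right (fun f => freqT_spaceWeight x₀ f) M f

/-- The decaying weight `(1 + |y|²)^{-M}`. -/
def decayFn (M : ℕ) (y : Rn n) : ℝ := (1 + ‖y‖ ^ 2) ^ (-(M : ℝ))

theorem hasTemperateGrowth_decay (M : ℕ) (x₀ : Rn n) :
    (fun y => ((decayFn M (y - x₀) : ℝ) : ℂ)).HasTemperateGrowth := by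
  have h1 : (fun y : Rn n => y - x₀).HasTemperateGrowth := by fun_prop
  exact Complex.ofRealCLM.hasTemperateGrowth.comp
    ((Function.hasTemperateGrowth_one_add_norm_sq_rpow (Rn n) (-(M : ℝ))).comp h1)

/-- Multiplication by the decaying weight centred at `x₀`. -/
def decayMul (M : ℕ) (x₀ : Rn n) : SchwartzMap (Rn n) ℂ →L[ℂ] SchwartzMap (Rn n) ℂ :=
  smulLeftCLM ℂ fun y => ((decayFn M (y - x₀) : ℝ) : ℂ)

theorem decayMul_apply (M : ℕ) (x₀ : Rn n) (f : SchwartzMap (Rn n) ℂ) (y : Rn n) :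
    decayMul M x₀ f y = ((decayFn M (y - x₀) : ℝ) : ℂ) * f y := by
  rw [decayMul, smulLeftCLM_apply_apply (hasTemperateGrowth_decay M x₀), smul_eq_mul]

theorem spaceWeight_decayMul (M : ℕ) (x₀ : Rn n) (f : SchwartzMap (Rn n) ℂ) :
    (spaceWeight x₀)^[M] (decayMul M x₀ f) = f := by
  ext y
  rw [spaceWeight_iterate_apply, decayMul_apply, ← mul_assoc, ← ofReal_pow, ← ofReal_mul, decayFn,
    ← Real.rpow_natCast, ← Real.rpow_add (by positivity)]
  simp

theorem exists_weighted_bound {ρ : ℝ} (hρ : 0 < ρ) {A : PhaseSp n → ℂ} (hA : GoodSymbol ρ A)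
    (M : ℕ) : ∃ K : ℝ≥0, ∀ (x₀ : Rn n) (f g : SchwartzMap (Rn n) ℂ),
      ∫⁻ x in ball x₀ (1 / (n + 1)), ‖freezeOp A (tens (freqT f) (freqT g)) x x‖ₑ ^ 2 ≤
        K * ((∫⁻ y, ‖decayMul M x₀ f y‖ₑ ^ 2) * ∫⁻ y, ‖decayMul M x₀ g y‖ₑ ^ 2) := by
  obtain ⟨K, hK⟩ := locBound_iterate hρ M A hA
  set c : ℝ≥0 := Real.toNNReal ((2 * Real.pi) ^ n)
  refine ⟨K * c * c, fun x₀ f g => ?_⟩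
  have h := hK x₀ (freqT (decayMul M x₀ f)) (freqT (decayMul M x₀ g))
  simp only [] at h
  rw [← freqT_spaceWeight_iterate, ← freqT_spaceWeight_iterate, spaceWeight_decayMul,
    spaceWeight_decayMul, lintegral_sq_freqT, lintegral_sq_freqT] at h
  refine h.trans (le_of_eq ?_)
  rw [ENNReal.coe_mul, ENNReal.coe_mul]
  simp only [ENNReal.ofReal, c]
  ring

theorem Tbilin_eq_freezeOp {ρ : ℝ} {a : Rn n → Rn n → Rn n → ℂ}
    (hA : GoodSymbol ρ (fun p : PhaseSp n => a p.1 p.2.1 p.2.2)) (f g : SchwartzMap (Rn n) ℂ)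
    (x : Rn n) : Tbilin a f g x =
      freezeOp (fun p : PhaseSp n => a p.1 p.2.1 p.2.2) (tens (freqT f) (freqT g)) x x := by
  obtain ⟨C, hC⟩ := hA.bounded []
  have h := integrable_symbol_mul hA.smooth.continuous hC (integrable_tens (freqT f) (freqT g)) x x
  rw [freezeOp, Measure.volume_eq_prod, integral_prod _ h, Tbilin]
  refine integral_congr_ae (Filter.Eventually.of_forall fun ξ => ?_)
  refine integral_congr_ae (Filter.Eventually.of_forall fun η => ?_)
  simp only [tens, phase, freqT_eq_fourierT, mul_assoc]

end Weighted

section Globalization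

variable {n : ℕ}

theorem lintegral_lintegral_ball {F : Rn n → ℝ≥0∞} (hF : Measurable F) (κ : ℝ) :
    ∫⁻ x₀, ∫⁻ x in ball x₀ κ, F x = volume (ball (0 : Rn n) κ) * ∫⁻ x, F x := by
  have h1 : ∀ x₀ : Rn n, ∫⁻ x in ball x₀ κ, F x =
      ∫⁻ x, {z : Rn n × Rn n | dist z.2 z.1 < κ}.indicator (fun z => F z.2) (x₀, x) := fun x₀ => by
    rw [← lintegral_indicator measurableSet_ball]
    rfl
  have hm : Measurable ({z : Rn n × Rn n | dist z.2 z.1 < κ}.indicator fun z => F z.2) :=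
    (hF.comp measurable_snd).indicator
      (isOpen_lt (by fun_prop) continuous_const).measurableSet
  simp_rw [h1]
  rw [lintegral_lintegral_swap (f := fun x₀ x => {z : Rn n × Rn n | dist z.2 z.1 < κ}.indicator
    (fun z => F z.2) (x₀, x)) hm.aemeasurable, ← lintegral_const_mul _ hF]
  refine lintegral_congr fun x => ?_
  have h2 : ∀ x₀ : Rn n, {z : Rn n × Rn n | dist z.2 z.1 < κ}.indicator (fun z => F z.2) (x₀, x) =
      (ball x κ).indicator (fun _ => F x) x₀ := fun x₀ => by
    simp only [Set.indicator, mem_ball, Set.mem_ofPred_eq, dist_comm x x₀]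
  simp_rw [h2]
  rw [lintegral_indicator measurableSet_ball, setLIntegral_const, Measure.addHaar_ball_center,
    mul_comm]

/-- The square of the decaying weight, as an extended nonnegative function. -/
def decaySq (M : ℕ) (z : Rn n) : ℝ≥0∞ := ‖((decayFn M z : ℝ) : ℂ)‖ₑ ^ 2

theorem measurable_decaySq (M : ℕ) : Measurable (decaySq M : Rn n → ℝ≥0∞) := by
  have h : (fun y : Rn n => ((decayFn M y : ℝ) : ℂ)).HasTemperateGrowth := by
    simpa using hasTemperateGrowth_decay M (0 : Rn n)
  exact (h.1.continuous.enorm.measurable).pow_const 2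

theorem exists_lintegral_decaySq_le (n : ℕ) :
    ∃ B : ℝ≥0, ∫⁻ z : Rn n, decaySq (n + 1) z ≤ B := by
  obtain ⟨B, hB⟩ := exists_lintegral_sq_weight_le (n := n) 1 (s := 2 * (n + 1 : ℕ)) (by
    push_cast
    linarith [n.cast_nonneg (α := ℝ)])
  refine ⟨B, le_trans (le_of_eq (lintegral_congr fun z => ?_)) hB⟩
  rw [decaySq, decayFn, ← ofReal_norm, norm_real, ofReal_norm, one_mul]
  congr 4
  ring

/-- Lebesgue measure weighted by a decaying bump at `x₀`. -/
def bumpMeasure (M : ℕ) (x₀ : Rn n) : Measure (Rn n) :=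
  volume.withDensity fun y => decaySq M (y - x₀)

theorem lintegral_bumpMeasure (M : ℕ) (x₀ : Rn n) {F : Rn n → ℝ≥0∞} (hF : Measurable F) :
    ∫⁻ y, F y ∂bumpMeasure M x₀ = ∫⁻ y, decaySq M (y - x₀) * F y := by
  have h : Measurable fun y => decaySq M (y - x₀) :=
    (measurable_decaySq M).comp (measurable_id.sub_const x₀)
  rw [bumpMeasure, lintegral_withDensity_eq_lintegral_mul _ h hF]
  rfl

theorem bumpMeasure_univ (M : ℕ) (x₀ : Rn n) :
    bumpMeasure M x₀ Set.univ = ∫⁻ z : Rn n, decaySq M z := by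
  rw [bumpMeasure, withDensity_apply _ MeasurableSet.univ, setLIntegral_univ,
    lintegral_sub_right_eq_self]

theorem lintegral_sq_decayMul (M : ℕ) (x₀ : Rn n) (f : SchwartzMap (Rn n) ℂ) :
    ∫⁻ y, ‖decayMul M x₀ f y‖ₑ ^ 2 = eLpNorm f 2 (bumpMeasure M x₀) ^ 2 := by
  rw [eLpNorm_two_sq, lintegral_bumpMeasure M x₀ ((f.continuous.enorm.measurable).pow_const 2)]
  refine lintegral_congr fun y => ?_
  rw [decayMul_apply, enorm_mul, mul_pow, decaySq]

theorem lintegral_lintegral_bumpMeasure (M : ℕ) {F : Rn n → ℝ≥0∞} (hF : Measurable F) :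
    ∫⁻ x₀, ∫⁻ y, F y ∂bumpMeasure M x₀ = (∫⁻ z : Rn n, decaySq M z) * ∫⁻ y, F y := by
  simp_rw [lintegral_bumpMeasure M _ hF]
  have hm : Measurable fun z : Rn n × Rn n => decaySq M (z.2 - z.1) * F z.2 :=
    ((measurable_decaySq M).comp (measurable_snd.sub measurable_fst)).mul (hF.comp measurable_snd)
  rw [lintegral_lintegral_swap hm.aemeasurable, ← lintegral_const_mul _ hF]
  refine lintegral_congr fun y => ?_
  have h : Measurable fun x => decaySq M (y - x) :=
    (measurable_decaySq M).comp (measurable_const.sub measurable_id)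
  rw [lintegral_mul_const _ h, lintegral_sub_left_eq_self]

/-- The local size of `f` near `x₀`. -/
def localSize (M : ℕ) (f : Rn n → ℂ) (x₀ : Rn n) : ℝ := (eLpNorm f 2 (bumpMeasure M x₀)).toReal

theorem bump_eLpNorm_le {B : ℝ≥0} (hB : ∫⁻ z : Rn n, decaySq (n + 1) z ≤ B) {p : ℝ≥0∞} (hp : 2 ≤ p)
    (f : SchwartzMap (Rn n) ℂ) (x₀ : Rn n) :
    eLpNorm f 2 (bumpMeasure (n + 1) x₀) ≤
      ((B ^ (1 / (2 : ℝ) - 1 / p.toReal) : ℝ≥0) : ℝ≥0∞) * eLpNorm f p (bumpMeasure (n + 1) x₀) := by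
  have h := eLpNorm_le_eLpNorm_mul_rpow_measure_univ (μ := bumpMeasure (n + 1) x₀) hp
    f.continuous.aestronglyMeasurable
  have he : 0 ≤ 1 / (2 : ℝ) - 1 / p.toReal := by
    rcases eq_or_ne p ∞ with rfl | hpt
    · simp
    · have : (2 : ℝ) ≤ p.toReal := by simpa using ENNReal.toReal_mono hpt hp
      have := one_div_le_one_div_of_le (by norm_num) this
      linarith
  rw [mul_comm] at h
  refine h.trans ?_
  rw [bumpMeasure_univ, ENNReal.coe_rpow_of_nonneg _ he]
  simp only [ENNReal.toReal_ofNat]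
  gcongr

theorem bump_eLpNorm_lt_top {B : ℝ≥0} (hB : ∫⁻ z : Rn n, decaySq (n + 1) z ≤ B)
    (f : SchwartzMap (Rn n) ℂ) (x₀ : Rn n) : eLpNorm f 2 (bumpMeasure (n + 1) x₀) < ∞ := by
  refine (bump_eLpNorm_le hB le_top f x₀).trans_lt (ENNReal.mul_lt_top ENNReal.coe_lt_top ?_)
  rw [eLpNorm_exponent_top]
  refine (eLpNormEssSup_mono_measure _ (withDensity_absolutelyContinuous _ _)).trans_lt ?_
  rw [← eLpNorm_exponent_top]
  exact (f.memLp ∞ volume).2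

theorem measurable_localSize (M : ℕ) (f : SchwartzMap (Rn n) ℂ) : Measurable (localSize M f) := by
  have hf : Measurable fun y => ‖f y‖ₑ ^ (2 : ℝ) := f.continuous.enorm.measurable.pow_const 2
  have hm : Measurable fun z : Rn n × Rn n => decaySq M (z.2 - z.1) * ‖f z.2‖ₑ ^ (2 : ℝ) :=
    ((measurable_decaySq M).comp (measurable_snd.sub measurable_fst)).mul (hf.comp measurable_snd)
  have h : localSize M f = fun x₀ =>
      ((∫⁻ y, decaySq M (y - x₀) * ‖f y‖ₑ ^ (2 : ℝ)) ^ (1 / (2 : ℝ))).toReal := by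
    ext x₀
    rw [localSize, eLpNorm_eq_lintegral_rpow_enorm_toReal (by simp) (by simp), ENNReal.toReal_ofNat,
      lintegral_bumpMeasure M x₀ hf]
  rw [h]
  exact (hm.lintegral_prod_right'.pow_const _).ennreal_toReal

theorem exists_eLpNorm_localSize_le (n : ℕ) {p : ℝ≥0∞} (hp : 2 ≤ p) :
    ∃ C : ℝ≥0, ∀ f : SchwartzMap (Rn n) ℂ,
      eLpNorm (localSize (n + 1) f) p volume ≤ C * eLpNorm f p volume := by
  obtain ⟨B, hB⟩ := exists_lintegral_decaySq_le n
  set c : ℝ≥0 := B ^ (1 / (2 : ℝ) - 1 / p.toReal)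
  have hpt : ∀ (f : SchwartzMap (Rn n) ℂ) x₀,
      ‖localSize (n + 1) f x₀‖ₑ ≤ c * eLpNorm f p (bumpMeasure (n + 1) x₀) := fun f x₀ => by
    refine le_trans (le_of_eq ?_) (bump_eLpNorm_le hB hp f x₀)
    rw [localSize, Real.enorm_of_nonneg ENNReal.toReal_nonneg,
      ENNReal.ofReal_toReal (bump_eLpNorm_lt_top hB f x₀).ne]
  rcases eq_or_ne p ∞ with rfl | hptop
  · refine ⟨c, fun f => ?_⟩
    rw [eLpNorm_exponent_top]
    refine eLpNormEssSup_le_of_ae_enorm_bound (Filter.Eventually.of_forall fun x₀ => ?_)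
    refine (hpt f x₀).trans ?_
    refine mul_le_mul' le_rfl ?_
    rw [eLpNorm_exponent_top]
    exact eLpNormEssSup_mono_measure (⇑f) (withDensity_absolutelyContinuous _ _)
  · have hp0 : p ≠ 0 := (lt_of_lt_of_le (by norm_num) hp).ne'
    have hp' : 0 < p.toReal := ENNReal.toReal_pos hp0 hptop
    refine ⟨c * B ^ (1 / p.toReal), fun f => ?_⟩
    have hf : Measurable fun y => ‖f y‖ₑ ^ p.toReal := f.continuous.enorm.measurable.pow_const _
    rw [eLpNorm_eq_lintegral_rpow_enorm_toReal hp0 hptop,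
      eLpNorm_eq_lintegral_rpow_enorm_toReal hp0 hptop]
    have hx : ∀ x₀, ‖localSize (n + 1) f x₀‖ₑ ^ p.toReal ≤
        (c : ℝ≥0∞) ^ p.toReal * ∫⁻ y, ‖f y‖ₑ ^ p.toReal ∂bumpMeasure (n + 1) x₀ := fun x₀ => by
      refine (ENNReal.rpow_le_rpow (hpt f x₀) hp'.le).trans (le_of_eq ?_)
      rw [eLpNorm_eq_lintegral_rpow_enorm_toReal hp0 hptop, ENNReal.mul_rpow_of_nonneg _ _ hp'.le,
        ← ENNReal.rpow_mul, one_div_mul_cancel hp'.ne', ENNReal.rpow_one]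
    calc (∫⁻ x₀, ‖localSize (n + 1) f x₀‖ₑ ^ p.toReal) ^ (1 / p.toReal)
        ≤ ((c : ℝ≥0∞) ^ p.toReal * (B * ∫⁻ y, ‖f y‖ₑ ^ p.toReal)) ^ (1 / p.toReal) := by
          refine ENNReal.rpow_le_rpow ?_ (by positivity)
          refine (lintegral_mono hx).trans ?_
          rw [lintegral_const_mul' _ _ (by finiteness), lintegral_lintegral_bumpMeasure _ hf]
          gcongr
      _ = _ := by
          rw [ENNReal.mul_rpow_of_nonneg _ _ (by positivity),
            ENNReal.mul_rpow_of_nonneg _ _ (by positivity), ← ENNReal.rpow_mul,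
            mul_one_div_cancel hp'.ne', ENNReal.rpow_one, ENNReal.coe_mul,
            ENNReal.coe_rpow_of_nonneg _ (by positivity : 0 ≤ 1 / p.toReal), mul_assoc]

/-- A uniform local bound by products of local sizes gives a global Lebesgue bound. -/
theorem exists_eLpNorm_le_of_local {κ : ℝ} (hκ : 0 < κ) (K : ℝ≥0) {p q r : ℝ≥0∞} (hp : 2 ≤ p)
    (hq : 2 ≤ q) (hr1 : 1 ≤ r) (hr2 : r ≤ 2) (hpqr : 1 / p + 1 / q = 1 / r) :
    ∃ C : ℝ≥0, ∀ (T : Rn n → ℂ) (f g : SchwartzMap (Rn n) ℂ), Continuous T →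
      (∀ x₀, ∫⁻ x in ball x₀ κ, ‖T x‖ₑ ^ 2 ≤ K * ((∫⁻ y, ‖decayMul (n + 1) x₀ f y‖ₑ ^ 2) *
        ∫⁻ y, ‖decayMul (n + 1) x₀ g y‖ₑ ^ 2)) →
      eLpNorm T r volume ≤ C * (eLpNorm f p volume * eLpNorm g q volume) := by
  obtain ⟨B, hB⟩ := exists_lintegral_decaySq_le n
  obtain ⟨Cf, hCf⟩ := exists_eLpNorm_localSize_le n hp
  obtain ⟨Cg, hCg⟩ := exists_eLpNorm_localSize_le n hq
  have hr0 : r ≠ 0 := (lt_of_lt_of_le (by norm_num) hr1).ne'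
  have hrt : r ≠ ∞ := (lt_of_le_of_lt hr2 (by norm_num)).ne
  have hr' : 0 < r.toReal := ENNReal.toReal_pos hr0 hrt
  set V : ℝ≥0∞ := volume (ball (0 : Rn n) κ) with hV
  have hV0 : V ≠ 0 := (measure_ball_pos _ _ hκ).ne'
  have hVt : V ≠ ∞ := measure_ball_lt_top.ne
  set e : ℝ := 1 / r.toReal - 1 / 2 with he
  have he0 : 0 ≤ e := by
    have h2 : r.toReal ≤ 2 := by simpa using ENNReal.toReal_mono (by norm_num) hr2
    have := one_div_le_one_div_of_le hr' h2
    linarith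
  set c : ℝ≥0∞ := (K : ℝ≥0∞) ^ (1 / (2 : ℝ)) * V ^ e with hc
  have hct : c ≠ ∞ := ENNReal.mul_ne_top (by finiteness) (by finiteness)
  have hVr : V ^ (-(1 / r.toReal)) ≠ ∞ := by
    rw [ENNReal.rpow_neg]
    exact ENNReal.inv_ne_top.2 (by simp [ENNReal.rpow_eq_zero_iff, hV0, hVt])
  refine ⟨(V ^ (-(1 / r.toReal)) * c).toNNReal * Cf * Cg, fun T f g hT h => ?_⟩
  have hTm : Measurable fun x => ‖T x‖ₑ ^ r.toReal := hT.enorm.measurable.pow_const _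
  set P : Rn n → ℝ := localSize (n + 1) f • localSize (n + 1) g with hP
  have hsize : ∀ (f : SchwartzMap (Rn n) ℂ) x₀,
      ‖localSize (n + 1) f x₀‖ₑ = eLpNorm f 2 (bumpMeasure (n + 1) x₀) := fun f x₀ => by
    rw [localSize, Real.enorm_of_nonneg ENNReal.toReal_nonneg,
      ENNReal.ofReal_toReal (bump_eLpNorm_lt_top hB f x₀).ne]
  have hloc : ∀ x₀, ∫⁻ x in ball x₀ κ, ‖T x‖ₑ ^ r.toReal ≤ c ^ r.toReal * ‖P x₀‖ₑ ^ r.toReal :=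
    fun x₀ => by
    have h1 : eLpNorm T 2 (volume.restrict (ball x₀ κ)) ≤ (K : ℝ≥0∞) ^ (1 / (2 : ℝ)) * ‖P x₀‖ₑ := by
      have h2 := h x₀
      rw [lintegral_sq_decayMul, lintegral_sq_decayMul, ← eLpNorm_two_sq, ← hsize, ← hsize,
        ← mul_pow, ← enorm_mul] at h2
      have h3 := ENNReal.rpow_le_rpow h2 (by norm_num : (0 : ℝ) ≤ 1 / 2)
      rw [ENNReal.mul_rpow_of_nonneg _ _ (by norm_num), ← ENNReal.rpow_natCast,
        ← ENNReal.rpow_natCast, ← ENNReal.rpow_mul, ← ENNReal.rpow_mul] at h3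
      norm_num at h3
      simpa [hP, enorm_mul] using h3
    have h2 := eLpNorm_le_eLpNorm_mul_rpow_measure_univ (μ := volume.restrict (ball x₀ κ)) hr2
      hT.aestronglyMeasurable
    rw [Measure.restrict_apply_univ, Measure.addHaar_ball_center, ENNReal.toReal_ofNat] at h2
    have h3 : eLpNorm T r (volume.restrict (ball x₀ κ)) ≤ c * ‖P x₀‖ₑ := by
      refine h2.trans ((mul_le_mul' h1 le_rfl).trans (le_of_eq ?_))
      rw [hc]
      ring
    have h4 := ENNReal.rpow_le_rpow h3 hr'.le
    rwa [eLpNorm_eq_lintegral_rpow_enorm_toReal hr0 hrt, ← ENNReal.rpow_mul,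
      one_div_mul_cancel hr'.ne', ENNReal.rpow_one, ENNReal.mul_rpow_of_nonneg _ _ hr'.le] at h4
  have hglob : V * ∫⁻ x, ‖T x‖ₑ ^ r.toReal ≤ c ^ r.toReal * ∫⁻ x₀, ‖P x₀‖ₑ ^ r.toReal := by
    rw [hV, ← lintegral_lintegral_ball hTm, ← lintegral_const_mul' _ _ (by finiteness)]
    exact lintegral_mono hloc
  have hroot : V ^ (1 / r.toReal) * eLpNorm T r volume ≤ c * eLpNorm P r volume := by
    have h1 := ENNReal.rpow_le_rpow hglob (by positivity : 0 ≤ 1 / r.toReal)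
    rwa [ENNReal.mul_rpow_of_nonneg _ _ (by positivity), ENNReal.mul_rpow_of_nonneg _ _ (by positivity),
      ← ENNReal.rpow_mul, mul_one_div_cancel hr'.ne', ENNReal.rpow_one,
      ← eLpNorm_eq_lintegral_rpow_enorm_toReal hr0 hrt,
      ← eLpNorm_eq_lintegral_rpow_enorm_toReal hr0 hrt] at h1
  have hHolder : eLpNorm P r volume ≤ (Cf * eLpNorm f p volume) * (Cg * eLpNorm g q volume) := by
    have : ENNReal.HolderTriple p q r := ⟨by simpa using hpqr⟩
    exact (eLpNorm_smul_le_mul_eLpNorm (measurable_localSize _ g).aestronglyMeasurable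
      (measurable_localSize _ f).aestronglyMeasurable).trans (mul_le_mul' (hCf f) (hCg g))
  have hVV : V ^ (-(1 / r.toReal)) * V ^ (1 / r.toReal) = 1 := by
    rw [← ENNReal.rpow_add _ _ hV0 hVt]
    simp
  calc eLpNorm T r volume = V ^ (-(1 / r.toReal)) * (V ^ (1 / r.toReal) * eLpNorm T r volume) := by
        rw [← mul_assoc, hVV, one_mul]
    _ ≤ V ^ (-(1 / r.toReal)) * (c * ((Cf * eLpNorm f p volume) * (Cg * eLpNorm g q volume))) := by
        exact mul_le_mul' le_rfl (hroot.trans (mul_le_mul' le_rfl hHolder))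
    _ = _ := by
        rw [ENNReal.coe_mul, ENNReal.coe_mul, ENNReal.coe_toNNReal (ENNReal.mul_ne_top hVr hct)]
        ring

end Globalization

theorem statement17 (n : ℕ) (ρ : ℝ) (hρ0 : 0 < ρ) (hρ1 : ρ ≤ 1)
    (a : Rn n → Rn n → Rn n → ℂ) (ha : BilinSmRhoDelta n 0 ρ 0 a)
    (hx : ∀ k : ℕ, ∃ B : ℝ, ∀ (x0 ζ : Rn n),
      ((∫⁻ x in Metric.ball x0 1, ∫⁻ η : Rn n,
          (‖iteratedFDeriv ℝ k (fun x' => a x' (ζ - η) η) x‖₊ : ℝ≥0∞) ^ (2:ℝ)) ^ ((1:ℝ)/2))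
        ≤ ENNReal.ofReal B)
    (p q r : ℝ≥0∞) (hp : 2 ≤ p) (hq : 2 ≤ q) (hr1 : 1 ≤ r) (hr2 : r ≤ 2)
    (hpqr : 1 / p + 1 / q = 1 / r) :
    ∃ Cst : ℝ≥0, 0 < Cst ∧ ∀ (f g : SchwartzMap (Rn n) ℂ),
      eLpNorm (fun x => Tbilin a (⇑f) (⇑g) x) r volume ≤
        Cst * eLpNorm (⇑f) p volume * eLpNorm (⇑g) q volume := by
  have hA := goodSymbol_of_bilinSmRhoDelta ha hx
  obtain ⟨K, hK⟩ := exists_weighted_bound hρ0 hA (n + 1)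
  obtain ⟨C, hC⟩ := exists_eLpNorm_le_of_local (n := n) (κ := 1 / (n + 1)) (by positivity) K
    hp hq hr1 hr2 hpqr
  obtain ⟨C₀, hC₀⟩ := hA.bounded []
  refine ⟨C + 1, by positivity, fun f g => ?_⟩
  simp_rw [Tbilin_eq_freezeOp hA]
  have hcont := (continuous_freezeOp hA.smooth.continuous hC₀
    (integrable_tens (freqT f) (freqT g))).comp (by fun_prop : Continuous fun x : Rn n => (x, x))
  refine (hC _ f g hcont fun x₀ => hK x₀ f g).trans ?_
  rw [mul_assoc]
  gcongr
  simp
end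
end

section
/- Let 0 < ρ ≤ 1 and let a ∈ S^0_{ρ,0}(n,2) satisfy, for each multi-index α, sup_{ζ∈ℝⁿ} (∫_{ℝⁿ}∫_{ℝⁿ} |∂_x^α a(x,ζ−η,η)|² dη dx)^{1/2} < ∞, and suppose in addition that a(x,ξ,η) = 0 whenever x lies outside a fixed unit ball B ⊂ ℝⁿ. Then there is a constant C such that ‖T_a(f,g)‖_{L^1(ℝⁿ)} ≤ C‖f‖_{L²(ℝⁿ)}‖g‖_{L²(ℝⁿ)} for all Schwartz functions f, g on ℝⁿ. -/
open MeasureTheory Metric Complex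
open scoped ENNReal NNReal RealInnerProductSpace BigOperators

noncomputable section

open FourierTransform SchwartzMap

/-- On `L¹ ∩ L²` the `L²` Fourier transform is given by the Fourier integral. -/
theorem fourier_toLp_ae_eq {n : ℕ} {h : Rn n → ℂ} (h1 : Integrable h) (h2 : MemLp h 2) :
    ((𝓕 (h2.toLp h) : Lp ℂ 2 (volume : Measure (Rn n))) : Rn n → ℂ) =ᵐ[volume] 𝓕 h := by
  have hc : Continuous (𝓕 h) :=
    VectorFourier.fourierIntegral_continuous Real.continuous_fourierChar
      (L := innerₗ (Rn n)) continuous_inner h1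
  refine ae_eq_of_integral_contDiff_smul_eq
    ((Lp.memLp _).locallyIntegrable (by norm_num)) hc.locallyIntegrable ?_
  intro φ hφ hφc
  have hφ' : ContDiff ℝ (⊤ : ℕ∞) (fun x => (φ x : ℂ)) := Complex.ofRealCLM.contDiff.comp hφ
  have hφc' : HasCompactSupport (fun x => (φ x : ℂ)) := hφc.comp_left (g := fun r : ℝ => (r : ℂ)) rfl
  set ψ : 𝓢(Rn n, ℂ) := hφc'.toSchwartzMap hφ' with hψ
  have e1 := congrArg (fun T => T ψ) (Lp.fourier_toTemperedDistribution_eq (h2.toLp h))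
  simp only [TemperedDistribution.fourier_apply, Lp.toTemperedDistribution_apply] at e1
  have e2 : ∫ x, (𝓕 ψ) x • (h2.toLp h) x = ∫ x, (𝓕 ψ) x • h x := by
    apply integral_congr_ae
    filter_upwards [h2.coeFn_toLp] with x hx
    rw [hx]
  have e3 : ∫ x, (𝓕 ψ) x • h x = ∫ x, ψ x • 𝓕 h x := by
    simpa using! VectorFourier.integral_bilin_fourierIntegral_eq_flip (.lsmul ℂ ℂ) (L := innerₗ (Rn n))
      Real.continuous_fourierChar continuous_inner ψ.integrable h1
  have e4 : ∀ x, ψ x = (φ x : ℂ) := fun x => rfl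
  rw [e2, e3] at e1
  simp only [e4, smul_eq_mul] at e1
  simp only [Complex.real_smul]
  exact e1.symm

/-- Plancherel's theorem for the Fourier integral of a function in `L¹ ∩ L²`. -/
theorem eLpNorm_fourier_eq_s18 {n : ℕ} {h : Rn n → ℂ} (h1 : Integrable h) (h2 : MemLp h 2) :
    eLpNorm (𝓕 h) 2 volume = eLpNorm h 2 volume := by
  rw [← eLpNorm_congr_ae (fourier_toLp_ae_eq h1 h2), ← Lp.enorm_def, ← Lp.enorm_toLp h2,
    ← ofReal_norm, ← ofReal_norm, Lp.norm_fourier_eq]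

theorem fourierT_eq_fourier {n : ℕ} (f : Rn n → ℂ) (ξ : Rn n) :
    fourierT f ξ = 𝓕 f ((2 * Real.pi)⁻¹ • ξ) := by
  rw [Real.fourier_eq', fourierT]
  congr 1
  ext y
  rw [smul_eq_mul, mul_comm]
  congr 2
  rw [inner_smul_right, real_inner_comm]
  have : (Real.pi : ℂ) ≠ 0 := by exact_mod_cast Real.pi_ne_zero
  push_cast
  field_simp

theorem eLpNorm_comp_smul {n : ℕ} (u : Rn n → ℂ) {r : ℝ} (hr : r ≠ 0)
    (hu : AEStronglyMeasurable u) :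
    eLpNorm (fun x => u (r • x)) 2 volume =
      ENNReal.ofReal (|(r ^ Module.finrank ℝ (Rn n))⁻¹|) ^ ((1 : ℝ) / 2) * eLpNorm u 2 volume := by
  have hm := Measure.map_addHaar_smul (volume : Measure (Rn n)) hr
  have := eLpNorm_map_measure (p := 2) (μ := (volume : Measure (Rn n))) (f := fun x => r • x)
    (g := u) (by rw [hm]; exact hu.smul_measure _) (by fun_prop)
  rw [hm, eLpNorm_smul_measure_of_ne_top (by norm_num)] at this
  simpa [Function.comp_def] using this.symm

/-- The constant in Plancherel's theorem for `fourierT`. -/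
def plancherelConst (n : ℕ) : ℝ≥0 :=
  (Real.toNNReal |(((2 * Real.pi)⁻¹ : ℝ) ^ Module.finrank ℝ (Rn n))⁻¹|) ^ ((1 : ℝ) / 2)

theorem continuous_fourierT {n : ℕ} {h : Rn n → ℂ} (h1 : Integrable h) :
    Continuous (fourierT h) := by
  have hc : Continuous (𝓕 h) :=
    VectorFourier.fourierIntegral_continuous Real.continuous_fourierChar
      (L := innerₗ (Rn n)) continuous_inner h1
  have : fourierT h = fun ξ => 𝓕 h ((2 * Real.pi)⁻¹ • ξ) := funext (fourierT_eq_fourier h)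
  rw [this]
  fun_prop

theorem eLpNorm_fourierT {n : ℕ} {h : Rn n → ℂ} (h1 : Integrable h) (h2 : MemLp h 2) :
    eLpNorm (fourierT h) 2 volume = plancherelConst n * eLpNorm h 2 volume := by
  have hc : Continuous (𝓕 h) :=
    VectorFourier.fourierIntegral_continuous Real.continuous_fourierChar
      (L := innerₗ (Rn n)) continuous_inner h1
  have : fourierT h = fun ξ => 𝓕 h ((2 * Real.pi)⁻¹ • ξ) := funext (fourierT_eq_fourier h)
  rw [this, eLpNorm_comp_smul _ (by positivity) hc.aestronglyMeasurable,
    eLpNorm_fourier_eq_s18 h1 h2, plancherelConst, ENNReal.coe_rpow_of_nonneg _ (by norm_num)]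
  rfl

theorem integrable_fourierT {n : ℕ} (f : 𝓢(Rn n, ℂ)) : Integrable (fourierT (f : Rn n → ℂ)) := by
  have : fourierT (f : Rn n → ℂ) = fun ξ => (𝓕 f) ((2 * Real.pi)⁻¹ • ξ) :=
    funext (fourierT_eq_fourier f)
  rw [this]
  exact (𝓕 f).integrable.comp_smul (by positivity)

theorem eLpNorm_two_rpow {α : Type*} [MeasurableSpace α] {μ : Measure α} {E : Type*}
    [NormedAddCommGroup E] (f : α → E) :
    eLpNorm f 2 μ ^ (2 : ℝ) = ∫⁻ x, ‖f x‖ₑ ^ (2 : ℝ) ∂μ := by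
  simpa using eLpNorm_nnreal_pow_eq_lintegral (f := f) (μ := μ) (p := 2) (by norm_num)

theorem lintegral_mul_sq_le {α : Type*} [MeasurableSpace α] {μ : Measure α} {f g : α → ℝ≥0∞}
    (hf : AEMeasurable f μ) (hg : AEMeasurable g μ) :
    (∫⁻ x, f x * g x ∂μ) ^ (2 : ℝ) ≤
      (∫⁻ x, f x ^ (2 : ℝ) ∂μ) * ∫⁻ x, g x ^ (2 : ℝ) ∂μ := by
  have h := ENNReal.lintegral_mul_le_Lp_mul_Lq μ Real.HolderConjugate.two_two hf hg
  calc _ ≤ _ := ENNReal.rpow_le_rpow h (by norm_num : (0 : ℝ) ≤ 2)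
    _ = _ := by
      rw [ENNReal.mul_rpow_of_nonneg _ _ (by norm_num), ← ENNReal.rpow_mul, ← ENNReal.rpow_mul]
      norm_num

/-- The measure-preserving change of variables `ζ = ξ + η` for functions of `(ξ, η)`. -/
theorem integrable_comp_sub {n : ℕ} {Φ : Rn n × Rn n → ℂ} (hΦ : Integrable Φ) :
    Integrable (fun p : Rn n × Rn n => Φ (p.1 - p.2, p.2)) :=
  (measurePreserving_sub_prod (volume : Measure (Rn n)) volume).integrable_comp_of_integrable hΦ

theorem integral_mul_cexp_add_eq {n : ℕ} {Φ : Rn n → Rn n → ℂ}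
    (hΦ : Integrable (fun p : Rn n × Rn n => Φ p.1 p.2)) (x : Rn n) :
    ∫ ξ : Rn n, ∫ η : Rn n, Φ ξ η * Complex.exp (Complex.I * ((⟪x, ξ + η⟫ : ℝ) : ℂ)) =
      fourierT (fun ζ => ∫ η, Φ (ζ - η) η) (-x) := by
  have hexp : ∀ (z : ℝ), ‖Complex.exp (Complex.I * (z : ℂ))‖ = 1 := fun z => by
    rw [mul_comm, Complex.norm_exp_ofReal_mul_I]
  have hi : Integrable (fun p : Rn n × Rn n =>
      Φ p.1 p.2 * Complex.exp (Complex.I * ((⟪x, p.1 + p.2⟫ : ℝ) : ℂ))) := by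
    refine hΦ.mul_bdd (c := 1) ?_ (ae_of_all _ fun p => (hexp _).le)
    exact Continuous.aestronglyMeasurable (by fun_prop)
  rw [integral_integral_swap hi]
  have h1 : ∀ η : Rn n,
      ∫ ξ : Rn n, Φ ξ η * Complex.exp (Complex.I * ((⟪x, ξ + η⟫ : ℝ) : ℂ)) =
      ∫ ζ : Rn n, Φ (ζ - η) η * Complex.exp (Complex.I * ((⟪x, ζ⟫ : ℝ) : ℂ)) := fun η => by
    rw [← integral_sub_right_eq_self _ η]
    simp
  simp_rw [h1]
  rw [integral_integral_swap]
  · unfold fourierT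
    congr 1
    ext ζ
    rw [integral_mul_const]
    simp
  · have := (integrable_comp_sub hi).swap
    simpa [Function.uncurry_def, Function.comp_def] using this

theorem eLpNorm_bilinear_multiplier_le {n : ℕ} {b : Rn n → Rn n → ℂ}
    (hb : StronglyMeasurable (fun p : Rn n × Rn n => b p.1 p.2)) {M : ℝ}
    (hM : ∀ ξ η, ‖b ξ η‖ ≤ M) {K : ℝ≥0∞} (hKt : K ≠ ∞)
    (hK : ∀ ζ, ∫⁻ η, ‖b (ζ - η) η‖ₑ ^ (2 : ℝ) ≤ K ^ (2 : ℝ))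
    {F G : Rn n → ℂ} (hFc : Continuous F) (hGc : Continuous G)
    (hF : Integrable F) (hG : Integrable G) (hF2 : MemLp F 2) (hG2 : MemLp G 2) :
    eLpNorm (fun x => ∫ ξ : Rn n, ∫ η : Rn n,
      b ξ η * F ξ * G η * Complex.exp (Complex.I * ((⟪x, ξ + η⟫ : ℝ) : ℂ))) 2 volume ≤
      plancherelConst n * (K * (eLpNorm F 2 volume * eLpNorm G 2 volume)) := by
  have hΦm : StronglyMeasurable (fun p : Rn n × Rn n => b p.1 p.2 * F p.1 * G p.2) :=
    (hb.mul (hFc.stronglyMeasurable.comp_measurable measurable_fst)).mul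
      (hGc.stronglyMeasurable.comp_measurable measurable_snd)
  have hΦ : Integrable (fun p : Rn n × Rn n => b p.1 p.2 * F p.1 * G p.2) := by
    have := (hF.mul_prod hG).bdd_mul (c := M) hb.aestronglyMeasurable
      (ae_of_all _ fun p => hM p.1 p.2)
    simp only [mul_assoc]
    exact this
  have hΦ' := integrable_comp_sub hΦ
  set h : Rn n → ℂ := fun ζ => ∫ η, b (ζ - η) η * F (ζ - η) * G η with hh
  have h1 : Integrable h := hΦ'.integral_prod_left
  have hbm : Measurable (fun p : Rn n × Rn n => ‖b (p.1 - p.2) p.2‖ₑ) :=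
    (hb.measurable.comp (measurable_fst.sub measurable_snd |>.prodMk measurable_snd)).enorm
  have hFGm : Measurable (fun p : Rn n × Rn n => ‖F (p.1 - p.2)‖ₑ * ‖G p.2‖ₑ) :=
    (hFc.measurable.comp (measurable_fst.sub measurable_snd)).enorm.mul
      (hGc.measurable.comp measurable_snd).enorm
  have hbound : eLpNorm h 2 volume ≤ K * (eLpNorm F 2 volume * eLpNorm G 2 volume) := by
    rw [← ENNReal.rpow_le_rpow_iff (by norm_num : (0 : ℝ) < 2), eLpNorm_two_rpow,
      ENNReal.mul_rpow_of_nonneg _ _ (by norm_num), ENNReal.mul_rpow_of_nonneg _ _ (by norm_num),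
      eLpNorm_two_rpow, eLpNorm_two_rpow]
    calc ∫⁻ ζ, ‖h ζ‖ₑ ^ (2 : ℝ)
        ≤ ∫⁻ ζ, K ^ (2 : ℝ) * ∫⁻ η, ‖F (ζ - η)‖ₑ ^ (2 : ℝ) * ‖G η‖ₑ ^ (2 : ℝ) := by
          refine lintegral_mono fun ζ => ?_
          calc ‖h ζ‖ₑ ^ (2 : ℝ)
              ≤ (∫⁻ η, ‖b (ζ - η) η‖ₑ * (‖F (ζ - η)‖ₑ * ‖G η‖ₑ)) ^ (2 : ℝ) := by
                refine ENNReal.rpow_le_rpow ?_ (by norm_num)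
                refine (enorm_integral_le_lintegral_enorm _).trans_eq ?_
                simp [enorm_mul, mul_assoc]
            _ ≤ _ := lintegral_mul_sq_le
                (hbm.comp (measurable_const.prodMk measurable_id)).aemeasurable
                (hFGm.comp (measurable_const.prodMk measurable_id)).aemeasurable
            _ ≤ _ := by
                refine mul_le_mul' (hK ζ) (le_of_eq ?_)
                simp_rw [ENNReal.mul_rpow_of_nonneg _ _ (by norm_num : (0 : ℝ) ≤ 2)]
      _ = K ^ (2 : ℝ) * ∫⁻ ζ, ∫⁻ η, ‖F (ζ - η)‖ₑ ^ (2 : ℝ) * ‖G η‖ₑ ^ (2 : ℝ) :=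
          lintegral_const_mul' _ _ (by finiteness)
      _ = K ^ (2 : ℝ) * ∫⁻ η, ∫⁻ ζ, ‖F (ζ - η)‖ₑ ^ (2 : ℝ) * ‖G η‖ₑ ^ (2 : ℝ) := by
          rw [lintegral_lintegral_swap]
          have := hFGm.pow_const (2 : ℝ)
          simp_rw [ENNReal.mul_rpow_of_nonneg _ _ (by norm_num : (0 : ℝ) ≤ 2)] at this
          exact this.aemeasurable
      _ = _ := by
          congr 1
          have : ∀ η, ∫⁻ ζ, ‖F (ζ - η)‖ₑ ^ (2 : ℝ) * ‖G η‖ₑ ^ (2 : ℝ) =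
              (∫⁻ ζ, ‖F ζ‖ₑ ^ (2 : ℝ)) * ‖G η‖ₑ ^ (2 : ℝ) := fun η => by
            rw [lintegral_mul_const' _ _ (by finiteness),
              lintegral_sub_right_eq_self (fun ζ => ‖F ζ‖ₑ ^ (2 : ℝ)) η]
          simp_rw [this]
          rw [lintegral_const_mul]
          exact (hGc.enorm.measurable).pow_const _
  have h2 : MemLp h 2 := ⟨h1.aestronglyMeasurable, hbound.trans_lt (by
    have := hF2.2.ne
    have := hG2.2.ne
    finiteness)⟩
  have key : (fun x => ∫ ξ : Rn n, ∫ η : Rn n,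
      b ξ η * F ξ * G η * Complex.exp (Complex.I * ((⟪x, ξ + η⟫ : ℝ) : ℂ))) =
      fourierT h ∘ Neg.neg := funext fun x =>
    integral_mul_cexp_add_eq (Φ := fun ξ η => b ξ η * F ξ * G η) hΦ x
  rw [key, eLpNorm_comp_measurePreserving (continuous_fourierT h1).aestronglyMeasurable
    (Measure.measurePreserving_neg volume), eLpNorm_fourierT h1 h2]
  gcongr

section CompactlySupported

variable {n : ℕ} {u : Rn n → ℂ} {x0 : Rn n}

theorem hasCompactSupport_of_eq_zero_off_ball (hs : ∀ x ∉ ball x0 1, u x = 0) :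
    HasCompactSupport u :=
  HasCompactSupport.intro (isCompact_closedBall x0 1) fun x hx =>
    hs x fun h => hx (ball_subset_closedBall h)

theorem iteratedFDeriv_eq_zero_off_closedBall (hs : ∀ x ∉ ball x0 1, u x = 0) (k : ℕ)
    {x : Rn n} (hx : x ∉ closedBall x0 1) : iteratedFDeriv ℝ k u x = 0 := by
  have h1 : tsupport u ⊆ closedBall x0 1 :=
    closure_minimal (fun y hy => ball_subset_closedBall (by_contra fun h => hy (hs y h)))
      isClosed_closedBall
  exact image_eq_zero_of_notMem_tsupport fun h => hx (h1 (tsupport_iteratedFDeriv_subset k h))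

theorem integrable_iteratedFDeriv (hu : ContDiff ℝ (⊤ : ℕ∞) u)
    (hs : ∀ x ∉ ball x0 1, u x = 0) (k : ℕ) : Integrable (iteratedFDeriv ℝ k u) :=
  (hu.continuous_iteratedFDeriv (by exact_mod_cast le_top)).integrable_of_hasCompactSupport
    ((hasCompactSupport_of_eq_zero_off_ball hs).iteratedFDeriv k)

theorem enorm_fourier_le (hu : ContDiff ℝ (⊤ : ℕ∞) u) (hs : ∀ x ∉ ball x0 1, u x = 0)
    (N : ℕ) (ω : Rn n) :
    ‖𝓕 u ω‖ₑ ≤ ENNReal.ofReal ((1 + ‖ω‖) ^ (-(N : ℝ))) *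
      (ENNReal.ofReal (2 ^ (N - 1) * (1 + 2 ^ N)) *
        ∑ p ∈ Finset.range (N + 1), ∫⁻ x, ‖iteratedFDeriv ℝ p u x‖ₑ) := by
  set S : ℝ := ∑ p ∈ Finset.range (N + 1), ∫ x, ‖iteratedFDeriv ℝ p u x‖ with hS
  have hS' : ENNReal.ofReal S = ∑ p ∈ Finset.range (N + 1), ∫⁻ x, ‖iteratedFDeriv ℝ p u x‖ₑ := by
    rw [hS, ENNReal.ofReal_sum_of_nonneg fun p _ => integral_nonneg fun x => norm_nonneg _]
    exact Finset.sum_congr rfl fun p _ =>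
      ofReal_integral_norm_eq_lintegral_enorm (integrable_iteratedFDeriv hu hs p)
  have hS0 : 0 ≤ S := Finset.sum_nonneg fun p _ => integral_nonneg fun x => norm_nonneg _
  have hI : ∀ k m : ℕ, (k : ℕ∞) ≤ (⊤ : ℕ∞) → (m : ℕ∞) ≤ (⊤ : ℕ∞) →
      Integrable (fun v => ‖v‖ ^ k * ‖iteratedFDeriv ℝ m u v‖) := fun k m _ _ => by
    refine Continuous.integrable_of_hasCompactSupport ?_ ?_
    · exact (continuous_norm.pow k).mul
        (hu.continuous_iteratedFDeriv (by exact_mod_cast le_top)).norm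
    · exact ((hasCompactSupport_of_eq_zero_off_ball hs).iteratedFDeriv m).norm.mul_left
  have hN : ‖ω‖ ^ N * ‖𝓕 u ω‖ ≤ 2 ^ N * S := by
    have := Real.pow_mul_norm_iteratedFDeriv_fourier_le (K := ⊤) (N := ⊤) hu hI
      (k := 0) (n := N) le_top le_top ω
    simpa [Finset.sum_product, hS] using this
  have h0 : ‖𝓕 u ω‖ ≤ S := by
    have h := Real.pow_mul_norm_iteratedFDeriv_fourier_le (K := ⊤) (N := ⊤) hu hI
      (k := 0) (n := 0) le_top le_top ω
    have h' : ‖𝓕 u ω‖ ≤ ∫ x, ‖iteratedFDeriv ℝ 0 u x‖ := by simpa using h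
    exact h'.trans (Finset.single_le_sum
      (f := fun p => ∫ x, ‖iteratedFDeriv ℝ p u x‖)
      (fun p _ => integral_nonneg fun x => norm_nonneg _) (by simp))
  have hpos : 0 < 1 + ‖ω‖ := by positivity
  have hmain : (1 + ‖ω‖) ^ N * ‖𝓕 u ω‖ ≤ 2 ^ (N - 1) * (1 + 2 ^ N) * S := by
    calc (1 + ‖ω‖) ^ N * ‖𝓕 u ω‖
        ≤ 2 ^ (N - 1) * (1 ^ N + ‖ω‖ ^ N) * ‖𝓕 u ω‖ := by
          gcongr
          exact add_pow_le zero_le_one (norm_nonneg _) N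
      _ = 2 ^ (N - 1) * (‖𝓕 u ω‖ + ‖ω‖ ^ N * ‖𝓕 u ω‖) := by ring
      _ ≤ 2 ^ (N - 1) * (S + 2 ^ N * S) := by gcongr
      _ = _ := by ring
  rw [← hS', ← ENNReal.ofReal_mul (by positivity), ← ENNReal.ofReal_mul (by positivity),
    ← ofReal_norm]
  refine ENNReal.ofReal_le_ofReal ?_
  rw [Real.rpow_neg hpos.le, Real.rpow_natCast, inv_mul_eq_div, le_div_iff₀ (by positivity)]
  linarith

end CompactlySupported

section Symbol

variable {n : ℕ} {a : Rn n → Rn n → Rn n → ℂ}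

theorem continuous_iteratedFDeriv_partial
    (ha : ContDiff ℝ (⊤ : ℕ∞) (fun p : Rn n × Rn n × Rn n => a p.1 p.2.1 p.2.2)) (k : ℕ) :
    Continuous (fun q : Rn n × Rn n × Rn n =>
      iteratedFDeriv ℝ k (fun x' => a x' q.2.1 q.2.2) q.1) := by
  set A : Rn n × Rn n × Rn n → ℂ := fun p => a p.1 p.2.1 p.2.2
  have h : ∀ q : Rn n × Rn n × Rn n, iteratedFDeriv ℝ k (fun x' => a x' q.2.1 q.2.2) q.1 =
      (iteratedFDeriv ℝ k A q).compContinuousLinearMap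
        fun _ => ContinuousLinearMap.inl ℝ (Rn n) (Rn n × Rn n) := fun q => by
    have h1 : (fun x' => a x' q.2.1 q.2.2) =
        (fun z => A (z + (0, q.2))) ∘ ContinuousLinearMap.inl ℝ (Rn n) (Rn n × Rn n) := by
      ext x'
      simp [A]
    have h2 : ContDiff ℝ (⊤ : ℕ∞) (fun z => A (z + (0, q.2))) :=
      ha.comp (contDiff_id.add contDiff_const)
    rw [h1, ContinuousLinearMap.iteratedFDeriv_comp_right _ h2 _ (by exact_mod_cast le_top),
      iteratedFDeriv_comp_add_right]
    simp
  simp_rw [h]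
  exact (ContinuousMultilinearMap.compContinuousLinearMapL
    (fun _ => ContinuousLinearMap.inl ℝ (Rn n) (Rn n × Rn n))).continuous.comp
      (ha.continuous_iteratedFDeriv (by exact_mod_cast le_top))

theorem BilinSmRhoDelta.exists_bound_iteratedFDeriv {ρ : ℝ} (ha : BilinSmRhoDelta n 0 ρ 0 a)
    (k : ℕ) : ∃ C : ℝ, ∀ x ξ η : Rn n,
      ‖iteratedFDeriv ℝ k (fun x' => a x' ξ η) x‖ ≤ C := by
  obtain ⟨C, hC⟩ := ha.2 k 0 0
  refine ⟨C, fun x ξ η => ?_⟩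
  have h := hC x ξ η
  simp only [iteratedFDeriv_zero_eq_comp] at h
  have e : (fun x' : Rn n =>
      ((continuousMultilinearCurryFin0 ℝ (Rn n)
          (ContinuousMultilinearMap ℝ (fun _ : Fin 0 => Rn n) ℂ)).symm ∘ fun ξ' =>
        ((continuousMultilinearCurryFin0 ℝ (Rn n) ℂ).symm ∘ fun η' => a x' ξ' η') η) ξ) =
      (continuousMultilinearCurryFin0 ℝ (Rn n)
        (ContinuousMultilinearMap ℝ (fun _ : Fin 0 => Rn n) ℂ)).symm ∘
      ((continuousMultilinearCurryFin0 ℝ (Rn n) ℂ).symm ∘ fun x' => a x' ξ η) := rfl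
  erw [e] at h
  rw [LinearIsometryEquiv.norm_iteratedFDeriv_comp_left,
    LinearIsometryEquiv.norm_iteratedFDeriv_comp_left] at h
  simpa using h

end Symbol

section PartialFourier

variable {n : ℕ} {a : Rn n → Rn n → Rn n → ℂ} {x0 : Rn n}

theorem contDiff_partial
    (ha : ContDiff ℝ (⊤ : ℕ∞) (fun p : Rn n × Rn n × Rn n => a p.1 p.2.1 p.2.2)) (ξ η : Rn n) :
    ContDiff ℝ (⊤ : ℕ∞) (fun x => a x ξ η) :=
  ha.comp (f := fun x => (x, ξ, η)) (contDiff_id.prodMk contDiff_const)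

theorem stronglyMeasurable_partialFourier
    (ha : ContDiff ℝ (⊤ : ℕ∞) (fun p : Rn n × Rn n × Rn n => a p.1 p.2.1 p.2.2)) :
    StronglyMeasurable (fun q : (Rn n × Rn n) × Rn n =>
      𝓕 (fun x => a x q.1.1 q.1.2) q.2) := by
  simp_rw [Real.fourier_eq']
  refine StronglyMeasurable.integral_prod_right'
    (f := fun q : ((Rn n × Rn n) × Rn n) × Rn n =>
      Complex.exp (↑(-2 * Real.pi * ⟪q.2, q.1.2⟫) * Complex.I) • a q.2 q.1.1.1 q.1.1.2) ?_
  have h1 : Continuous (fun q : ((Rn n × Rn n) × Rn n) × Rn n => a q.2 q.1.1.1 q.1.1.2) :=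
    ha.continuous.comp (f := fun q : ((Rn n × Rn n) × Rn n) × Rn n =>
      (q.2, q.1.1.1, q.1.1.2)) (by fun_prop)
  exact Continuous.stronglyMeasurable (by fun_prop)

theorem lintegral_enorm_iteratedFDeriv_eq
    (hsupp : ∀ x : Rn n, x ∉ ball x0 1 → ∀ ξ η : Rn n, a x ξ η = 0) (k : ℕ) (ξ η : Rn n) :
    ∫⁻ x, ‖iteratedFDeriv ℝ k (fun x' => a x' ξ η) x‖ₑ =
      ∫⁻ x in closedBall x0 1, ‖iteratedFDeriv ℝ k (fun x' => a x' ξ η) x‖ₑ := by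
  refine (setLIntegral_eq_of_support_subset fun x hx => by_contra fun h => hx ?_).symm
  simp [iteratedFDeriv_eq_zero_off_closedBall (fun x hx => hsupp x hx ξ η) k h]

/-- Rapid decay of the Fourier transform of the symbol in `x`, uniformly in `(ξ, η)`. -/
theorem exists_norm_partialFourier_le {ρ : ℝ} (ha : BilinSmRhoDelta n 0 ρ 0 a)
    (hsupp : ∀ x : Rn n, x ∉ ball x0 1 → ∀ ξ η : Rn n, a x ξ η = 0) (N : ℕ) :
    ∃ M : ℝ, ∀ ω ξ η : Rn n,
      ‖𝓕 (fun x => a x ξ η) ω‖ ≤ (1 + ‖ω‖) ^ (-(N : ℝ)) * M := by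
  choose C hC using fun k => ha.exists_bound_iteratedFDeriv k
  set M : ℝ≥0∞ := ENNReal.ofReal (2 ^ (N - 1) * (1 + 2 ^ N)) *
    ∑ p ∈ Finset.range (N + 1), ENNReal.ofReal (C p) * volume (closedBall x0 1) with hM
  have hMt : M ≠ ∞ := by
    refine ENNReal.mul_ne_top ENNReal.ofReal_ne_top (ENNReal.sum_ne_top.2 fun p _ => ?_)
    exact ENNReal.mul_ne_top ENNReal.ofReal_ne_top measure_closedBall_lt_top.ne
  refine ⟨M.toReal, fun ω ξ η => ?_⟩
  have h := enorm_fourier_le (contDiff_partial ha.1 ξ η) (fun x hx => hsupp x hx ξ η) N ω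
  have h2 : ‖𝓕 (fun x => a x ξ η) ω‖ₑ ≤ ENNReal.ofReal ((1 + ‖ω‖) ^ (-(N : ℝ))) * M := by
    refine h.trans (mul_le_mul' le_rfl (mul_le_mul' le_rfl (Finset.sum_le_sum fun p _ => ?_)))
    rw [lintegral_enorm_iteratedFDeriv_eq hsupp, ← setLIntegral_const]
    refine lintegral_mono fun x => ?_
    rw [← ofReal_norm]
    exact ENNReal.ofReal_le_ofReal (hC p x ξ η)
  rw [← ENNReal.ofReal_toReal hMt, ← ENNReal.ofReal_mul (by positivity), ← ofReal_norm] at h2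
  exact (ENNReal.ofReal_le_ofReal_iff (by positivity)).1 h2

/-- Rapid decay of the Fourier transform of the symbol in `x`, in `L²` along `ξ + η = ζ`. -/
theorem exists_lintegral_partialFourier_le
    (ha : ContDiff ℝ (⊤ : ℕ∞) (fun p : Rn n × Rn n × Rn n => a p.1 p.2.1 p.2.2))
    (hx : ∀ k : ℕ, ∃ B : ℝ, ∀ ζ : Rn n,
      ((∫⁻ x : Rn n, ∫⁻ η : Rn n,
          (‖iteratedFDeriv ℝ k (fun x' => a x' (ζ - η) η) x‖₊ : ℝ≥0∞) ^ (2:ℝ)) ^ ((1:ℝ)/2))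
        ≤ ENNReal.ofReal B)
    (hsupp : ∀ x : Rn n, x ∉ ball x0 1 → ∀ ξ η : Rn n, a x ξ η = 0) (N : ℕ) :
    ∃ K : ℝ≥0, ∀ ω ζ : Rn n,
      ∫⁻ η, ‖𝓕 (fun x => a x (ζ - η) η) ω‖ₑ ^ (2 : ℝ) ≤
        (ENNReal.ofReal ((1 + ‖ω‖) ^ (-(N : ℝ))) * K) ^ (2 : ℝ) := by
  choose B hB using hx
  set D : ℝ≥0∞ := ENNReal.ofReal (2 ^ (N - 1) * (1 + 2 ^ N)) with hD
  set V : ℝ≥0∞ := volume (closedBall x0 1) with hV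
  have hVt : V ≠ ∞ := measure_closedBall_lt_top.ne
  set R : ℝ≥0∞ := (N + 1 : ℕ) * ∑ p ∈ Finset.range (N + 1), V * ENNReal.ofReal (B p) ^ (2 : ℝ)
    with hR
  have hRt : R ≠ ∞ := by
    refine ENNReal.mul_ne_top (ENNReal.natCast_ne_top _) (ENNReal.sum_ne_top.2 fun p _ => ?_)
    finiteness
  set K : ℝ≥0∞ := D * R ^ ((1 : ℝ) / 2) with hK
  have hKt : K ≠ ∞ := by finiteness
  have hK2 : K ^ (2 : ℝ) = D ^ (2 : ℝ) * R := by
    rw [hK, ENNReal.mul_rpow_of_nonneg _ _ (by norm_num), ← ENNReal.rpow_mul]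
    norm_num
  have hmeas : ∀ (p : ℕ) (ζ : Rn n), Measurable (fun q : Rn n × Rn n =>
      ‖iteratedFDeriv ℝ p (fun x' => a x' (ζ - q.1) q.1) q.2‖ₑ) := fun p ζ => by
    refine Continuous.measurable (Continuous.enorm ?_)
    exact (continuous_iteratedFDeriv_partial ha p).comp
      (f := fun q : Rn n × Rn n => (q.2, ζ - q.1, q.1)) (by fun_prop)
  refine ⟨K.toNNReal, fun ω ζ => ?_⟩
  rw [ENNReal.coe_toNNReal hKt, ENNReal.mul_rpow_of_nonneg _ _ (by norm_num), hK2]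
  set W := ENNReal.ofReal ((1 + ‖ω‖) ^ (-(N : ℝ)))
  set J : ℕ → Rn n → ℝ≥0∞ := fun p η =>
    ∫⁻ x, ‖iteratedFDeriv ℝ p (fun x' => a x' (ζ - η) η) x‖ₑ ^ (2 : ℝ) with hJ
  have hJm : ∀ p, Measurable (J p) := fun p =>
    ((hmeas p ζ).pow_const (2 : ℝ)).lintegral_prod_right'
  have hJB : ∀ p, ∫⁻ η, J p η ≤ ENNReal.ofReal (B p) ^ (2 : ℝ) := fun p => by
    rw [hJ, lintegral_lintegral_swap ((hmeas p ζ).pow_const (2 : ℝ)).aemeasurable]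
    have h := ENNReal.rpow_le_rpow (hB p ζ) (by norm_num : (0 : ℝ) ≤ 2)
    rw [← ENNReal.rpow_mul] at h
    norm_num at h
    simpa [enorm_eq_nnnorm] using h
  have hpt : ∀ η, ‖𝓕 (fun x => a x (ζ - η) η) ω‖ₑ ^ (2 : ℝ) ≤
      W ^ (2 : ℝ) * (D ^ (2 : ℝ) * ((N + 1 : ℕ) * ∑ p ∈ Finset.range (N + 1), V * J p η)) := by
    intro η
    have h := enorm_fourier_le (contDiff_partial ha (ζ - η) η)
      (fun x hx => hsupp x hx (ζ - η) η) N ω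
    refine (ENNReal.rpow_le_rpow h (by norm_num : (0 : ℝ) ≤ 2)).trans ?_
    rw [ENNReal.mul_rpow_of_nonneg _ _ (by norm_num), ENNReal.mul_rpow_of_nonneg _ _ (by norm_num)]
    refine mul_le_mul' le_rfl (mul_le_mul' le_rfl ?_)
    refine (ENNReal.rpow_sum_le_const_mul_sum_rpow _ _ (by norm_num : (1 : ℝ) ≤ 2)).trans ?_
    norm_num only [Finset.card_range, ENNReal.rpow_one]
    refine mul_le_mul' le_rfl (Finset.sum_le_sum fun p _ => ?_)
    rw [lintegral_enorm_iteratedFDeriv_eq hsupp]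
    have hm : Measurable (fun x => ‖iteratedFDeriv ℝ p (fun x' => a x' (ζ - η) η) x‖ₑ) :=
      ((contDiff_partial ha (ζ - η) η).continuous_iteratedFDeriv
        (by exact_mod_cast le_top)).enorm.measurable
    have h2 := lintegral_mul_sq_le (μ := volume.restrict (closedBall x0 1)) (f := fun _ => 1)
      aemeasurable_const hm.aemeasurable
    simp only [one_mul, ENNReal.one_rpow, lintegral_const, Measure.restrict_apply_univ] at h2
    refine h2.trans ?_
    rw [← hV]
    gcongr
    exact setLIntegral_le_lintegral _ _
  calc _ ≤ ∫⁻ η, W ^ (2 : ℝ) *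
        (D ^ (2 : ℝ) * ((N + 1 : ℕ) * ∑ p ∈ Finset.range (N + 1), V * J p η)) :=
        lintegral_mono hpt
    _ = W ^ (2 : ℝ) * (D ^ (2 : ℝ) * ((N + 1 : ℕ) *
          ∑ p ∈ Finset.range (N + 1), V * ∫⁻ η, J p η)) := by
        have hVJ : ∀ p ∈ Finset.range (N + 1), Measurable (fun η => V * J p η) :=
          fun p _ => (hJm p).const_mul V
        have hsum := Finset.measurable_fun_sum _ hVJ
        rw [lintegral_const_mul _ ((hsum.const_mul _).const_mul _),
          lintegral_const_mul _ (hsum.const_mul _), lintegral_const_mul _ hsum,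
          lintegral_finsetSum _ hVJ]
        simp_rw [lintegral_const_mul _ (hJm _)]
    _ ≤ _ := by
        rw [hR]
        gcongr with p
        exact hJB p

end PartialFourier

theorem lintegral_restrict_enorm_le_eLpNorm_two {α E : Type*} [MeasurableSpace α]
    [NormedAddCommGroup E] {μ : Measure α} {f : α → E} (hf : AEStronglyMeasurable f μ)
    (s : Set α) :
    ∫⁻ x in s, ‖f x‖ₑ ∂μ ≤ μ s ^ ((1 : ℝ) / 2) * eLpNorm f 2 μ := by
  have h := eLpNorm_le_eLpNorm_mul_rpow_measure_univ (μ := μ.restrict s) (p := 1) (q := 2)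
    (by norm_num) hf.restrict
  rw [eLpNorm_one_eq_lintegral_enorm, Measure.restrict_apply_univ, mul_comm] at h
  norm_num at h
  refine h.trans ?_
  rw [one_div]
  gcongr
  exact Measure.restrict_le_self

/-- The bilinear Fourier multiplier operator whose symbol is the Fourier transform of `a` in `x`
at frequency `ω`. -/
def frequencyPiece {n : ℕ} (a : Rn n → Rn n → Rn n → ℂ) (F G : Rn n → ℂ) (ω x : Rn n) : ℂ :=
  ∫ ξ : Rn n, ∫ η : Rn n, 𝓕 (fun y => a y ξ η) ω * F ξ * G η *
    Complex.exp (Complex.I * ((⟪x, ξ + η⟫ : ℝ) : ℂ))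

section FrequencyPiece

variable {n : ℕ} {a : Rn n → Rn n → Rn n → ℂ} {F G : Rn n → ℂ}

theorem stronglyMeasurable_frequencyPiece
    (ha : ContDiff ℝ (⊤ : ℕ∞) (fun p : Rn n × Rn n × Rn n => a p.1 p.2.1 p.2.2))
    (hF : Continuous F) (hG : Continuous G) :
    StronglyMeasurable (fun q : Rn n × Rn n => frequencyPiece a F G q.1 q.2) := by
  have h : StronglyMeasurable (fun q : ((Rn n × Rn n) × Rn n) × Rn n =>
      𝓕 (fun y => a y q.1.2 q.2) q.1.1.1 * F q.1.2 * G q.2 *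
        Complex.exp (Complex.I * ((⟪q.1.1.2, q.1.2 + q.2⟫ : ℝ) : ℂ))) := by
    refine StronglyMeasurable.mul (StronglyMeasurable.mul (StronglyMeasurable.mul ?_ ?_) ?_) ?_
    · exact (stronglyMeasurable_partialFourier ha).comp_measurable
        (g := fun q : ((Rn n × Rn n) × Rn n) × Rn n => ((q.1.2, q.2), q.1.1.1)) (by fun_prop)
    all_goals exact Continuous.stronglyMeasurable (by fun_prop)
  exact h.integral_prod_right'.integral_prod_right'

theorem enorm_Tbilin_le {f g : Rn n → ℂ} {x0 : Rn n}
    (ha : ContDiff ℝ (⊤ : ℕ∞) (fun p : Rn n × Rn n × Rn n => a p.1 p.2.1 p.2.2))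
    (hsupp : ∀ x : Rn n, x ∉ ball x0 1 → ∀ ξ η : Rn n, a x ξ η = 0)
    {w : Rn n → ℝ} (hw : Integrable w)
    (hA : ∀ ω ξ η : Rn n, ‖𝓕 (fun x => a x ξ η) ω‖ ≤ w ω)
    (hFc : Continuous (fourierT f)) (hGc : Continuous (fourierT g))
    (hF : Integrable (fourierT f)) (hG : Integrable (fourierT g)) (x : Rn n) :
    ‖Tbilin a f g x‖ₑ ≤ ∫⁻ ω, ‖frequencyPiece a (fourierT f) (fourierT g) ω x‖ₑ := by
  set F := fourierT f
  set G := fourierT g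
  have hexp : ∀ (z : ℝ), ‖Complex.exp (Complex.I * (z : ℂ))‖ = 1 := fun z => by
    rw [mul_comm, Complex.norm_exp_ofReal_mul_I]
  have hexp' : ∀ (z : ℝ), ‖Complex.exp ((z : ℂ) * Complex.I)‖ = 1 := fun z =>
    Complex.norm_exp_ofReal_mul_I z
  have hAm := stronglyMeasurable_partialFourier ha
  set Ψ : Rn n × Rn n → Rn n → ℂ := fun z ω =>
    Complex.exp (↑(2 * Real.pi * ⟪ω, x⟫) * Complex.I) *
      (𝓕 (fun y => a y z.1 z.2) ω * F z.1 * G z.2 *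
        Complex.exp (Complex.I * ((⟪x, z.1 + z.2⟫ : ℝ) : ℂ))) with hΨ
  have hΨm : StronglyMeasurable (fun q : (Rn n × Rn n) × Rn n => Ψ q.1 q.2) := by
    refine StronglyMeasurable.mul ?_
      (StronglyMeasurable.mul (StronglyMeasurable.mul (StronglyMeasurable.mul hAm ?_) ?_) ?_)
    all_goals exact Continuous.stronglyMeasurable (by fun_prop)
  have hbd : Integrable (fun q : (Rn n × Rn n) × Rn n => (F q.1.1 * G q.1.2) * (w q.2 : ℂ)) :=
    (hF.mul_prod hG).mul_prod hw.ofReal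
  have hΨi : Integrable (fun q : (Rn n × Rn n) × Rn n => Ψ q.1 q.2) := by
    refine hbd.mono hΨm.aestronglyMeasurable (ae_of_all _ fun q => ?_)
    simp only [hΨ, norm_mul, hexp, hexp', one_mul, mul_one, Complex.norm_real]
    have h1 := (hA q.2 q.1.1 q.1.2).trans (le_abs_self _)
    rw [← Real.norm_eq_abs] at h1
    calc _ ≤ ‖w q.2‖ * ‖F q.1.1‖ * ‖G q.1.2‖ := by gcongr
      _ = _ := by ring
  have hinv : ∀ ξ η, a x ξ η = ∫ ω, Complex.exp (↑(2 * Real.pi * ⟪ω, x⟫) * Complex.I) *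
      𝓕 (fun y => a y ξ η) ω := fun ξ η => by
    have hc : Continuous (fun y => a y ξ η) := (contDiff_partial ha ξ η).continuous
    have hi : Integrable (fun y => a y ξ η) := hc.integrable_of_hasCompactSupport
      (hasCompactSupport_of_eq_zero_off_ball fun y hy => hsupp y hy ξ η)
    have hFi : Integrable (𝓕 (fun y => a y ξ η)) := by
      refine hw.mono' ?_ (ae_of_all _ fun ω => hA ω ξ η)
      exact (hAm.comp_measurable (measurable_prodMk_left (x := (ξ, η)))).aestronglyMeasurable
    have h := congrFun (hc.fourierInv_fourier_eq hi hFi) x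
    rw [Real.fourierInv_eq'] at h
    simpa using h.symm
  have hT : Tbilin a f g x = ∫ z, ∫ ω, Ψ z ω := by
    have hint := hΨi.integral_prod_left
    rw [Measure.volume_eq_prod, integral_prod _ hint]
    unfold Tbilin
    congr 1
    ext ξ
    congr 1
    ext η
    rw [hinv ξ η, ← integral_mul_const, ← integral_mul_const, ← integral_mul_const]
    congr 1
    ext ω
    simp only [hΨ]
    ring
  rw [hT, integral_integral_swap hΨi]
  refine (enorm_integral_le_lintegral_enorm _).trans (lintegral_mono_ae ?_)
  filter_upwards [hΨi.prod_left_ae] with ω hω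
  have h1 : ∫ z, Ψ z ω = Complex.exp (↑(2 * Real.pi * ⟪ω, x⟫) * Complex.I) *
      frequencyPiece a F G ω x := by
    rw [Measure.volume_eq_prod, integral_prod _ hω, frequencyPiece]
    simp only [hΨ, integral_const_mul]
  rw [h1, enorm_mul, ← ofReal_norm, hexp', ENNReal.ofReal_one, one_mul]

end FrequencyPiece

theorem statement18 (n : ℕ) (ρ : ℝ) (hρ0 : 0 < ρ) (hρ1 : ρ ≤ 1)
    (a : Rn n → Rn n → Rn n → ℂ) (ha : BilinSmRhoDelta n 0 ρ 0 a)
    (hx : ∀ k : ℕ, ∃ B : ℝ, ∀ ζ : Rn n,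
      ((∫⁻ x : Rn n, ∫⁻ η : Rn n,
          (‖iteratedFDeriv ℝ k (fun x' => a x' (ζ - η) η) x‖₊ : ℝ≥0∞) ^ (2:ℝ)) ^ ((1:ℝ)/2))
        ≤ ENNReal.ofReal B)
    (x0 : Rn n)
    (hsupp : ∀ x : Rn n, x ∉ Metric.ball x0 1 → ∀ ξ η : Rn n, a x ξ η = 0) :
    ∃ Cst : ℝ≥0, 0 < Cst ∧ ∀ (f g : SchwartzMap (Rn n) ℂ),
      eLpNorm (fun x => Tbilin a (⇑f) (⇑g) x) 1 volume ≤
        Cst * eLpNorm (⇑f) 2 volume * eLpNorm (⇑g) 2 volume := by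
  obtain ⟨M, hM⟩ := exists_norm_partialFourier_le ha hsupp (n + 1)
  obtain ⟨K, hK⟩ := exists_lintegral_partialFourier_le ha.1 hx hsupp (n + 1)
  have hw : Integrable (fun ω : Rn n => (1 + ‖ω‖) ^ (-((n + 1 : ℕ) : ℝ))) :=
    integrable_one_add_norm (by simp)
  set P := plancherelConst n
  set V : ℝ≥0∞ := volume (ball x0 1)
  have hVt : V ≠ ∞ := measure_ball_lt_top.ne
  set J : ℝ≥0∞ := ∫⁻ ω : Rn n, ENNReal.ofReal ((1 + ‖ω‖) ^ (-((n + 1 : ℕ) : ℝ))) with hJ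
  have hJt : J ≠ ∞ := hw.lintegral_lt_top.ne
  set Q : ℝ≥0∞ := V ^ ((1 : ℝ) / 2) * P * K * P * P * J with hQ
  have hQt : Q ≠ ∞ := by finiteness
  refine ⟨Q.toNNReal + 1, by positivity, fun f g => ?_⟩
  have hf1 := f.integrable (μ := volume)
  have hg1 := g.integrable (μ := volume)
  have hf2 := f.memLp 2 (μ := volume)
  have hg2 := g.memLp 2 (μ := volume)
  set F := fourierT f with hFdef
  set G := fourierT g with hGdef
  have hFc : Continuous F := continuous_fourierT hf1
  have hGc : Continuous G := continuous_fourierT hg1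
  have hFn : eLpNorm F 2 volume = P * eLpNorm f 2 volume := eLpNorm_fourierT hf1 hf2
  have hGn : eLpNorm G 2 volume = P * eLpNorm g 2 volume := eLpNorm_fourierT hg1 hg2
  have hft := hf2.2.ne
  have hgt := hg2.2.ne
  have hF2 : MemLp F 2 := ⟨hFc.aestronglyMeasurable, by rw [hFn]; finiteness⟩
  have hG2 : MemLp G 2 := ⟨hGc.aestronglyMeasurable, by rw [hGn]; finiteness⟩
  have hSm := stronglyMeasurable_frequencyPiece ha.1 hFc hGc
  have hpiece : ∀ ω, ∫⁻ x in ball x0 1, ‖frequencyPiece a F G ω x‖ₑ ≤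
      V ^ ((1 : ℝ) / 2) * (P * ((ENNReal.ofReal ((1 + ‖ω‖) ^ (-((n + 1 : ℕ) : ℝ))) * K) *
        (eLpNorm F 2 volume * eLpNorm G 2 volume))) := fun ω => by
    refine (lintegral_restrict_enorm_le_eLpNorm_two
      (hSm.comp_measurable (measurable_prodMk_left (x := ω))).aestronglyMeasurable _).trans ?_
    refine mul_le_mul' le_rfl ?_
    exact eLpNorm_bilinear_multiplier_le
      ((stronglyMeasurable_partialFourier ha.1).comp_measurable
        (measurable_prodMk_right (y := ω)))
      (fun ξ η => hM ω ξ η) (by finiteness) (hK ω) hFc hGc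
      (integrable_fourierT f) (integrable_fourierT g) hF2 hG2
  have hsuppT : ∀ x ∉ ball x0 1, Tbilin a f g x = 0 := fun x hx => by
    simp [Tbilin, hsupp x hx]
  calc eLpNorm (fun x => Tbilin a (⇑f) (⇑g) x) 1 volume
      = ∫⁻ x in ball x0 1, ‖Tbilin a f g x‖ₑ := by
        rw [eLpNorm_one_eq_lintegral_enorm]
        refine (setLIntegral_eq_of_support_subset fun x hx => by_contra fun h => hx ?_).symm
        simp [hsuppT x h]
    _ ≤ ∫⁻ x in ball x0 1, ∫⁻ ω, ‖frequencyPiece a F G ω x‖ₑ :=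
        lintegral_mono fun x => enorm_Tbilin_le ha.1 hsupp (hw.mul_const M) hM hFc hGc
          (integrable_fourierT f) (integrable_fourierT g) x
    _ = ∫⁻ ω, ∫⁻ x in ball x0 1, ‖frequencyPiece a F G ω x‖ₑ := by
        refine lintegral_lintegral_swap ?_
        exact (hSm.enorm.comp measurable_swap).aemeasurable
    _ ≤ ∫⁻ ω : Rn n, ENNReal.ofReal ((1 + ‖ω‖) ^ (-((n + 1 : ℕ) : ℝ))) *
          (V ^ ((1 : ℝ) / 2) * P * K * (eLpNorm F 2 volume * eLpNorm G 2 volume)) :=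
        lintegral_mono fun ω => (hpiece ω).trans_eq (by ring)
    _ = Q * eLpNorm f 2 volume * eLpNorm g 2 volume := by
        rw [lintegral_mul_const _ (by fun_prop), hFn, hGn, hQ, hJ]
        ring
    _ ≤ _ := by
        gcongr
        rw [ENNReal.coe_add, ENNReal.coe_toNNReal hQt]
        exact le_self_add
end
end
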